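/- Let 1/2 < p < 1. There are positive constants c(p), c₁(p), c₂(p) such that for all n ≥ 1, with ℙ_p-probability at least 1 − c₁·exp(−c₂·log²n), one has Φ_n ≤ c·n⁻¹. -/

import Mathlib

open MeasureTheory Set Filter

noncomputable section

/-- Vertices of the square lattice `ℤ²`. -/
abbrev Vert : Type := ℤ × ℤ

/-- Edges of `ℤ²`, encoded as a base vertex together with a direction:
`false` for the horizontal edge to `x + (1,0)`, `true` for the vertical edge to `x + (0,1)`. -/
abbrev Edge : Type := Vert × Bool

/-- Percolation configurations: each edge is open (`true`) or closed (`false`). -/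
abbrev Config : Type := Edge → Bool

/-- The second endpoint of an edge. -/
def edgeTip (e : Edge) : Vert := e.1 + (if e.2 then (0, 1) else (1, 0))

/-- `x` and `y` are joined by an open edge in the configuration `ω`. -/
def openAdj (ω : Config) (x y : Vert) : Prop :=
  ∃ e : Edge, ω e = true ∧ ((e.1 = x ∧ edgeTip e = y) ∨ (e.1 = y ∧ edgeTip e = x))

/-- The open cluster of a vertex `x`: all vertices joined to `x` by an open path. -/
def cluster (ω : Config) (x : Vert) : Set Vert :=
  {y | Relation.ReflTransGen (openAdj ω) x y}

/-- The union of the infinite open clusters (a.s. the unique infinite cluster `C∞`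
in the supercritical regime). -/
def Cinf (ω : Config) : Set Vert := {x | (cluster ω x).Infinite}

/-- The box `[-n,n]²` of the lattice. -/
def latBox (n : ℕ) : Set Vert := {x | |x.1| ≤ (n : ℤ) ∧ |x.2| ≤ (n : ℤ)}

/-- The vertex set `C̃ₙ = C∞ ∩ [-n,n]²`. -/
def Ctilde (ω : Config) (n : ℕ) : Set Vert := Cinf ω ∩ latBox n

/-- Adjacency by an open edge within `C̃ₙ`. -/
def adjIn (ω : Config) (n : ℕ) (x y : Vert) : Prop :=
  openAdj ω x y ∧ x ∈ Ctilde ω n ∧ y ∈ Ctilde ω n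

/-- The connected component of `x` in the graph `C̃ₙ`. -/
def compIn (ω : Config) (n : ℕ) (x : Vert) : Set Vert :=
  {y | Relation.ReflTransGen (adjIn ω n) x y} ∩ Ctilde ω n

/-- The giant component `Cₙ`: a connected component of `C̃ₙ` of maximal cardinality. -/
def giant (ω : Config) (n : ℕ) : Set Vert :=
  compIn ω n (Classical.epsilon fun x =>
    x ∈ Ctilde ω n ∧ ∀ y ∈ Ctilde ω n, (compIn ω n y).ncard ≤ (compIn ω n x).ncard)

/-- The set of open edges of the graph induced on `G` having exactly one endpoint in `H`. -/
def edgeBdry (ω : Config) (G H : Set Vert) : Set Edge :=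
  {e | ω e = true ∧ e.1 ∈ G ∧ edgeTip e ∈ G ∧
    ((e.1 ∈ H ∧ edgeTip e ∉ H) ∨ (e.1 ∉ H ∧ edgeTip e ∈ H))}

/-- The Cheeger constant of the open subgraph of `ω` induced on the vertex set `G`:
the minimum of `|∂H|/|H|` over vertex sets `H ⊆ G` with `0 < |H| ≤ |G|/2`. -/
def cheeger (ω : Config) (G : Set Vert) : ℝ :=
  sInf {r : ℝ | ∃ H : Set Vert, H ⊆ G ∧ 0 < H.ncard ∧ 2 * H.ncard ≤ G.ncard ∧
    r = ((edgeBdry ω G H).ncard : ℝ) / (H.ncard : ℝ)}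

/-- `Φₙ`, the Cheeger constant of the giant component. -/
def Phi (ω : Config) (n : ℕ) : ℝ := cheeger ω (giant ω n)

/-- The set `𝒢ₙ` of Cheeger optimizers of the giant component. -/
def optimizers (ω : Config) (n : ℕ) : Set (Set Vert) :=
  {H | H ⊆ giant ω n ∧ 0 < H.ncard ∧ 2 * H.ncard ≤ (giant ω n).ncard ∧
    ((edgeBdry ω (giant ω n) H).ncard : ℝ) / (H.ncard : ℝ) = Phi ω n}

/-- `P` is the Bernoulli bond percolation measure with parameter `p`: a probability
measure under which the states of the edges are i.i.d. Bernoulli(`p`). -/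
def IsBernoulli (P : Measure Config) (p : ℝ) : Prop :=
  IsProbabilityMeasure P ∧
    ∀ (s : Finset Edge) (f : Edge → Bool),
      P {ω : Config | ∀ e ∈ s, ω e = f e} =
        ∏ e ∈ s, (if f e then ENNReal.ofReal p else ENNReal.ofReal (1 - p))

end

noncomputable section PartOne
open scoped Classical

/-- configuration whose open edges are exactly `T` -/
def indc (T : Finset Edge) : Config := fun e => decide (e ∈ T)

/-- expectation over the edges of `F` (all other edges closed) -/
def Ex (s : ℝ) (F : Finset Edge) (f : Config → ℝ) : ℝ :=
  ∑ T ∈ F.powerset, s ^ T.card * (1 - s) ^ (F.card - T.card) * f (indc T)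

/-- `f` depends only on the edges in `A` -/
def DepOn {α : Sort*} (A : Set Edge) (f : Config → α) : Prop :=
  ∀ ω ω' : Config, (∀ e ∈ A, ω e = ω' e) → f ω = f ω'

def up (e : Edge) (b : Bool) (ω : Config) : Config := Function.update ω e b

/-- indicator -/
def I (p : Config → Prop) : Config → ℝ := fun ω => if p ω then 1 else 0

/-- probability -/
def Pr (s : ℝ) (F : Finset Edge) (p : Config → Prop) : ℝ := Ex s F (I p)

theorem up_self (e : Edge) (b : Bool) (ω : Config) : up e b ω e = b := by simp [up]
theorem up_ne {e e' : Edge} (h : e' ≠ e) (b : Bool) (ω : Config) : up e b ω e' = ω e' := by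
  simp [up, h]
theorem up_up (e : Edge) (b c : Bool) (ω : Config) : up e b (up e c ω) = up e b ω := by
  simp [up]
theorem up_comm {e e' : Edge} (h : e ≠ e') (b c : Bool) (ω : Config) :
    up e b (up e' c ω) = up e' c (up e b ω) := by
  unfold up; exact Function.update_comm h.symm c b ω |>.symm ▸ rfl
theorem up_mono (e : Edge) (b : Bool) : Monotone (up e b) := by
  intro ω ω' h x
  by_cases hx : x = e
  · subst hx; simp [up]
  · simp [up, hx, h x]
theorem le_up_true (e : Edge) (ω : Config) : ω ≤ up e true ω := by
  intro x
  by_cases hx : x = e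
  · subst hx; simp [up]
  · simp [up, hx]
theorem up_false_le (e : Edge) (ω : Config) : up e false ω ≤ ω := by
  intro x
  by_cases hx : x = e
  · subst hx; simp [up]
  · simp [up, hx]

theorem Ex_empty (s : ℝ) (f : Config → ℝ) : Ex s ∅ f = f (indc ∅) := by simp [Ex]

theorem Ex_insert (s : ℝ) {F : Finset Edge} {e : Edge} (he : e ∉ F) (f : Config → ℝ) :
    Ex s (insert e F) f = s * Ex s F (fun ω => f (up e true ω))
      + (1 - s) * Ex s F (fun ω => f (up e false ω)) := by
  unfold Ex
  rw [Finset.sum_powerset_insert he, add_comm, Finset.mul_sum, Finset.mul_sum]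
  congr 1
  · refine Finset.sum_congr rfl fun T hT => ?_
    have hTF := Finset.mem_powerset.1 hT
    have heT : e ∉ T := fun h => he (hTF h)
    have h1 : indc (insert e T) = up e true (indc T) := by
      funext x
      by_cases hx : x = e
      · subst hx; simp [indc, up]
      · simp [indc, up, hx]
    rw [h1, Finset.card_insert_of_notMem heT, Finset.card_insert_of_notMem he]
    have : F.card + 1 - (T.card + 1) = F.card - T.card := by omega
    rw [this]; ring
  · refine Finset.sum_congr rfl fun T hT => ?_
    have hTF := Finset.mem_powerset.1 hT
    have heT : e ∉ T := fun h => he (hTF h)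
    have h1 : indc T = up e false (indc T) := by
      funext x
      by_cases hx : x = e
      · subst hx; simp [indc, up, heT]
      · simp [up, hx]
    beta_reduce
    rw [← h1, Finset.card_insert_of_notMem he]
    have hc := Finset.card_le_card hTF
    have : F.card + 1 - T.card = (F.card - T.card) + 1 := by omega
    rw [this]; ring

theorem Ex_add (s : ℝ) (F : Finset Edge) (f g : Config → ℝ) :
    Ex s F (fun ω => f ω + g ω) = Ex s F f + Ex s F g := by
  simp [Ex, mul_add, Finset.sum_add_distrib]
theorem Ex_sub (s : ℝ) (F : Finset Edge) (f g : Config → ℝ) :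
    Ex s F (fun ω => f ω - g ω) = Ex s F f - Ex s F g := by
  simp [Ex, mul_sub, Finset.sum_sub_distrib]
theorem Ex_mul (s : ℝ) (F : Finset Edge) (c : ℝ) (f : Config → ℝ) :
    Ex s F (fun ω => c * f ω) = c * Ex s F f := by
  simp only [Ex, Finset.mul_sum]
  exact Finset.sum_congr rfl fun T _ => by ring
theorem Ex_sum {ι : Type*} (s : ℝ) (F : Finset Edge) (A : Finset ι) (f : ι → Config → ℝ) :
    Ex s F (fun ω => ∑ i ∈ A, f i ω) = ∑ i ∈ A, Ex s F (f i) := by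
  simp only [Ex, Finset.mul_sum]
  rw [Finset.sum_comm]
theorem Ex_const (s : ℝ) (F : Finset Edge) (c : ℝ) : Ex s F (fun _ => c) = c := by
  simp only [Ex, ← Finset.sum_mul]
  rw [Finset.sum_pow_mul_eq_add_pow]; simp
theorem Ex_mono {s : ℝ} (h0 : 0 ≤ s) (h1 : s ≤ 1) (F : Finset Edge) {f g : Config → ℝ}
    (h : ∀ ω, f ω ≤ g ω) : Ex s F f ≤ Ex s F g := by
  refine Finset.sum_le_sum fun T _ => ?_
  have : 0 ≤ 1 - s := by linarith
  have := h (indc T)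
  gcongr
theorem Ex_nonneg {s : ℝ} (h0 : 0 ≤ s) (h1 : s ≤ 1) (F : Finset Edge) {f : Config → ℝ}
    (h : ∀ ω, 0 ≤ f ω) : 0 ≤ Ex s F f := by
  have := Ex_mono h0 h1 F h
  rwa [Ex_const] at this

theorem I_nonneg (p : Config → Prop) (ω : Config) : 0 ≤ I p ω := by unfold I; split_ifs <;> norm_num
theorem I_le_one (p : Config → Prop) (ω : Config) : I p ω ≤ 1 := by unfold I; split_ifs <;> norm_num
theorem I_mono {p q : Config → Prop} (h : ∀ ω, p ω → q ω) (ω : Config) : I p ω ≤ I q ω := by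
  unfold I
  by_cases hp : p ω
  · simp [hp, h ω hp]
  · simp only [hp, if_false]; split_ifs <;> norm_num
theorem I_and (p q : Config → Prop) (ω : Config) : I (fun ω => p ω ∧ q ω) ω = I p ω * I q ω := by
  unfold I; by_cases hp : p ω <;> by_cases hq : q ω <;> simp [hp, hq]
theorem I_not (p : Config → Prop) (ω : Config) : I (fun ω => ¬ p ω) ω = 1 - I p ω := by
  unfold I; by_cases hp : p ω <;> simp [hp]

theorem Pr_mono {s : ℝ} (h0 : 0 ≤ s) (h1 : s ≤ 1) (F : Finset Edge) {p q : Config → Prop}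
    (h : ∀ ω, p ω → q ω) : Pr s F p ≤ Pr s F q := Ex_mono h0 h1 F (I_mono h)
theorem Pr_nonneg {s : ℝ} (h0 : 0 ≤ s) (h1 : s ≤ 1) (F : Finset Edge) (p : Config → Prop) :
    0 ≤ Pr s F p := Ex_nonneg h0 h1 F (I_nonneg p)
theorem Pr_le_one {s : ℝ} (h0 : 0 ≤ s) (h1 : s ≤ 1) (F : Finset Edge) (p : Config → Prop) :
    Pr s F p ≤ 1 := by
  have := Ex_mono h0 h1 F (I_le_one p)
  rwa [Ex_const] at this
theorem Pr_not (s : ℝ) (F : Finset Edge) (p : Config → Prop) :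
    Pr s F (fun ω => ¬ p ω) = 1 - Pr s F p := by
  unfold Pr
  rw [show I (fun ω => ¬ p ω) = fun ω => 1 - I p ω from funext (I_not p), Ex_sub, Ex_const]
theorem Pr_or_le {s : ℝ} (h0 : 0 ≤ s) (h1 : s ≤ 1) (F : Finset Edge) (p q : Config → Prop) :
    Pr s F (fun ω => p ω ∨ q ω) ≤ Pr s F p + Pr s F q := by
  unfold Pr
  rw [← Ex_add]
  refine Ex_mono h0 h1 F fun ω => ?_
  unfold I; by_cases hp : p ω <;> by_cases hq : q ω <;> simp [hp, hq]

theorem DepOn.up {α : Sort*} {A : Set Edge} {f : Config → α} (h : DepOn A f) (e : Edge) (b : Bool) :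
    DepOn A (fun ω => f (up e b ω)) := by
  intro ω ω' hω
  apply h
  intro x hx
  by_cases hxe : x = e
  · subst hxe; simp [_root_.up]
  · simp [_root_.up, hxe, hω x hx]
theorem DepOn.up_diff {α : Sort*} {A : Set Edge} {f : Config → α} {e : Edge} (h : DepOn (insert e A) f) (b : Bool) :
    DepOn A (fun ω => f (_root_.up e b ω)) := by
  intro ω ω' hω
  apply h
  intro x hx
  by_cases hxe : x = e
  · subst hxe; simp [_root_.up]
  · simp [_root_.up, hxe, hω x (hx.resolve_left hxe)]
theorem DepOn.up_eq {α : Sort*} {A : Set Edge} {f : Config → α} (h : DepOn A f) {e : Edge} (he : e ∉ A)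
    (b : Bool) (ω : Config) : f (_root_.up e b ω) = f ω := by
  apply h
  intro x hx
  have : x ≠ e := fun h => he (h ▸ hx)
  simp [_root_.up, this]
theorem DepOn.mono {α : Sort*} {A B : Set Edge} {f : Config → α} (h : DepOn A f) (hAB : A ⊆ B) : DepOn B f :=
  fun ω ω' hω => h ω ω' fun e he => hω e (hAB he)
theorem DepOn.I {A : Set Edge} {p : Config → Prop} (h : DepOn A p) : DepOn A (I p) := by
  intro ω ω' hω
  have := h ω ω' hω
  simp only [_root_.I, this]
theorem DepOn.comp {α β : Sort*} {A : Set Edge} {f : Config → α} (h : DepOn A f) (g : α → β) :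
    DepOn A (fun ω => g (f ω)) := fun ω ω' hω => congrArg g (h ω ω' hω)
theorem DepOn.comp₂ {α β γ : Sort*} {A : Set Edge} {f : Config → α} {f' : Config → β} (h : DepOn A f)
    (h' : DepOn A f') (g : α → β → γ) :
    DepOn A (fun ω => g (f ω) (f' ω)) := fun ω ω' hω => congrArg₂ g (h ω ω' hω) (h' ω ω' hω)

theorem Ex_indep (s : ℝ) {A B : Set Edge} (hAB : Disjoint A B) (F : Finset Edge) :
    ∀ {f g : Config → ℝ}, DepOn A f → DepOn B g →
    Ex s F (fun ω => f ω * g ω) = Ex s F f * Ex s F g := by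
  induction F using Finset.induction_on with
  | empty => intro f g _ _; simp [Ex_empty]
  | insert e F he ih =>
    intro f g hf hg
    rw [Ex_insert s he, Ex_insert s he, Ex_insert s he, ih (hf.up e true) (hg.up e true),
      ih (hf.up e false) (hg.up e false)]
    by_cases heA : e ∈ A
    · have heB : e ∉ B := fun h => (Set.disjoint_left.1 hAB) heA h
      simp only [hg.up_eq heB]; ring
    · simp only [hf.up_eq heA]; ring

theorem Ex_marg (s : ℝ) {A : Set Edge} {f : Config → ℝ} (hf : DepOn A f) {F G : Finset Edge}
    (hFG : F ⊆ G) (hA : ∀ e ∈ G, e ∈ A → e ∈ F) : Ex s G f = Ex s F f := by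
  obtain ⟨D, hD, rfl⟩ : ∃ D : Finset Edge, Disjoint D F ∧ G = D ∪ F :=
    ⟨G \ F, Finset.sdiff_disjoint, (Finset.sdiff_union_of_subset hFG).symm⟩
  clear hFG
  induction D using Finset.induction_on with
  | empty => simp
  | insert e D he ih =>
    rw [Finset.disjoint_insert_left] at hD
    have he' : e ∉ D ∪ F := by simp [he, hD.1]
    rw [Finset.insert_union, Ex_insert s he']
    have heA : e ∉ A := fun h => hD.1 (hA e (by simp) h)
    simp only [hf.up_eq heA]
    have := ih hD.2 (fun x hx => hA x (by simp only [Finset.insert_union, Finset.mem_insert]; exact Or.inr hx))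
    have e1 : Ex s (D ∪ F) (fun ω => f ω) = Ex s F f := this
    rw [e1]; ring

theorem Ex_marg' (s : ℝ) {A : Set Edge} {f : Config → ℝ} (hf : DepOn A f) {F G : Finset Edge}
    (hF : A ⊆ F) (hG : A ⊆ G) : Ex s G f = Ex s F f := by
  rw [Ex_marg s hf (F := F ∩ G) (G := G) Finset.inter_subset_right
      (fun e he h => Finset.mem_inter.2 ⟨hF h, he⟩),
    Ex_marg s hf (F := F ∩ G) (G := F) Finset.inter_subset_left
      (fun e he h => Finset.mem_inter.2 ⟨he, hG h⟩)]

theorem Ex_fkg {s : ℝ} (h0 : 0 ≤ s) (h1 : s ≤ 1) (F : Finset Edge) :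
    ∀ {f g : Config → ℝ}, Monotone f → Monotone g →
    Ex s F f * Ex s F g ≤ Ex s F (fun ω => f ω * g ω) := by
  induction F using Finset.induction_on with
  | empty => intro f g _ _; simp [Ex_empty]
  | insert e F he ih =>
    intro f g hf hg
    rw [Ex_insert s he, Ex_insert s he, Ex_insert s he]
    have i1 := ih (hf.comp (up_mono e true)) (hg.comp (up_mono e true))
    have i2 := ih (hf.comp (up_mono e false)) (hg.comp (up_mono e false))
    have hle : ∀ ω, up e false ω ≤ up e true ω := fun ω => (up_false_le e ω).trans (le_up_true e ω)
    have m1 := Ex_mono h0 h1 F (f := fun ω => f (up e false ω)) (g := fun ω => f (up e true ω))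
      (fun ω => hf (hle ω))
    have m2 := Ex_mono h0 h1 F (f := fun ω => g (up e false ω)) (g := fun ω => g (up e true ω))
      (fun ω => hg (hle ω))
    simp only [Function.comp_def] at i1 i2
    have h2 : 0 ≤ 1 - s := by linarith
    have a1 := mul_le_mul_of_nonneg_left i1 h0
    have a2 := mul_le_mul_of_nonneg_left i2 h2
    have a3 := mul_nonneg (mul_nonneg h0 h2) (mul_nonneg (sub_nonneg.2 m1) (sub_nonneg.2 m2))
    nlinarith

theorem Ex_mono_s {s t : ℝ} (h0 : 0 ≤ s) (hst : s ≤ t) (h1 : t ≤ 1) (F : Finset Edge) :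
    ∀ {f : Config → ℝ}, Monotone f → Ex s F f ≤ Ex t F f := by
  induction F using Finset.induction_on with
  | empty => intro f _; simp [Ex_empty]
  | insert e F he ih =>
    intro f hf
    rw [Ex_insert s he, Ex_insert t he]
    have i1 := ih (hf.comp (up_mono e true))
    have i2 := ih (hf.comp (up_mono e false))
    have hle : ∀ ω, up e false ω ≤ up e true ω := fun ω => (up_false_le e ω).trans (le_up_true e ω)
    have m1 := Ex_mono h0 (hst.trans h1) F (f := fun ω => f (up e false ω)) (g := fun ω => f (up e true ω))
      (fun ω => hf (hle ω))
    simp only [Function.comp_def] at i1 i2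
    have a1 := mul_le_mul_of_nonneg_left i1 (h0.trans hst)
    have a2 := mul_le_mul_of_nonneg_left i2 (sub_nonneg.2 h1)
    nlinarith [mul_nonneg (sub_nonneg.2 hst) (sub_nonneg.2 m1)]

theorem Ex_up_le {s : ℝ} (h0 : 0 ≤ s) (h1 : s ≤ 1) {F : Finset Edge} {e : Edge} (he : e ∈ F)
    {g : Config → ℝ} (hg : ∀ ω, 0 ≤ g ω) : s * Ex s F (fun ω => g (up e true ω)) ≤ Ex s F g := by
  obtain ⟨G, hG, rfl⟩ : ∃ G, e ∉ G ∧ F = insert e G :=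
    ⟨F.erase e, by simp, (Finset.insert_erase he).symm⟩
  rw [Ex_insert s hG, Ex_insert s hG]
  simp only [up_up]
  have := Ex_nonneg h0 h1 G (f := fun ω => g (up e false ω)) (fun ω => hg _)
  have h2 : 0 ≤ 1 - s := by linarith
  nlinarith [mul_nonneg h2 this]

/-- an event not depending on `e`, intersected with `e` closed -/
theorem Ex_closed (s : ℝ) {F : Finset Edge} {e : Edge} (he : e ∈ F)
    {g : Config → ℝ} (hg : ∀ ω b, g (up e b ω) = g ω) :
    Ex s F (fun ω => if ω e = false then g ω else 0) = (1 - s) * Ex s F g := by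
  obtain ⟨G, hG, rfl⟩ : ∃ G, e ∉ G ∧ F = insert e G :=
    ⟨F.erase e, by simp, (Finset.insert_erase he).symm⟩
  rw [Ex_insert s hG, Ex_insert s hG]
  simp only [up_self, hg]
  have : Ex s G (fun ω => if true = false then g ω else 0) = 0 := by
    simpa using Ex_const s G 0
  rw [this]
  simp only [if_true]
  ring
theorem Ex_open (s : ℝ) {F : Finset Edge} {e : Edge} (he : e ∈ F) :
    Pr s F (fun ω => ω e = true) = s := by
  obtain ⟨G, hG, rfl⟩ : ∃ G, e ∉ G ∧ F = insert e G :=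
    ⟨F.erase e, by simp, (Finset.insert_erase he).symm⟩
  unfold Pr I
  rw [Ex_insert s hG]
  simp [up_self, Ex_const]

theorem russo (F : Finset Edge) : ∀ (f : Config → ℝ) (s : ℝ),
    HasDerivAt (fun s => Ex s F f)
      (∑ e ∈ F, Ex s F (fun ω => f (up e true ω) - f (up e false ω))) s := by
  induction F using Finset.induction_on with
  | empty => intro f s; simpa [Ex_empty] using hasDerivAt_const s (f (indc ∅))
  | insert e F he ih =>
    intro f s
    have h1 := ih (fun ω => f (up e true ω)) s
    have h2 := ih (fun ω => f (up e false ω)) s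
    have h3 := ((hasDerivAt_id s).mul h1).add (((hasDerivAt_id s).const_sub 1).mul h2)
    have hfun : (fun s => Ex s (insert e F) f) = fun s => s * Ex s F (fun ω => f (up e true ω))
      + (1 - s) * Ex s F (fun ω => f (up e false ω)) := funext fun s => Ex_insert s he f
    rw [hfun]
    refine HasDerivAt.congr_deriv h3 ?_
    rw [Finset.sum_insert he, Ex_insert s he]
    simp only [up_up, Ex_sub, id]
    have : ∑ x ∈ F, Ex s (insert e F) (fun ω => f (up x true ω) - f (up x false ω)) =
       s * ∑ x ∈ F, (Ex s F (fun ω => f (up e true (up x true ω))) - Ex s F (fun ω => f (up e true (up x false ω))))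
       + (1 - s) * ∑ x ∈ F, (Ex s F (fun ω => f (up e false (up x true ω))) - Ex s F (fun ω => f (up e false (up x false ω)))) := by
      rw [Finset.mul_sum, Finset.mul_sum, ← Finset.sum_add_distrib]
      refine Finset.sum_congr rfl fun x hx => ?_
      have hxe : x ≠ e := fun h => he (h ▸ hx)
      rw [Ex_insert s he]
      simp only [Ex_sub, up_comm hxe]
    simp only [Ex_sub] at this
    rw [this]
    ring

/-- the pull back of a configuration under an edge relabelling, with optional flip -/
def pullCfg (c : Bool) (τ : Edge ≃ Edge) (ω : Config) : Config := fun e => xor c (ω (τ e))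

theorem Ex_pullCfg (c : Bool) (τ : Edge ≃ Edge) (s : ℝ) (F : Finset Edge) :
    ∀ {g : Config → ℝ}, DepOn (F : Set Edge) g →
    Ex s (F.map τ.toEmbedding) (fun ω => g (pullCfg c τ ω)) = Ex (if c then 1 - s else s) F g := by
  induction F using Finset.induction_on with
  | empty =>
    intro g hg
    simp only [Finset.map_empty, Ex_empty]
    apply hg; simp
  | insert e F he ih =>
    intro g hg
    have he' : τ e ∉ F.map τ.toEmbedding := by simpa using he
    rw [Finset.map_insert]
    have h0 : τ.toEmbedding e = τ e := rfl
    rw [h0, Ex_insert s he', Ex_insert _ he]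
    have key : ∀ b ω, pullCfg c τ (up (τ e) b ω) = up e (xor c b) (pullCfg c τ ω) := by
      intro b ω; funext x
      by_cases hx : x = e
      · subst hx; simp [pullCfg, up]
      · simp [pullCfg, up, hx]
    simp only [key]
    rw [Finset.coe_insert] at hg
    rw [ih (g := fun ω => g (up e (xor c true) ω)) (hg.up_diff _),
      ih (g := fun ω => g (up e (xor c false) ω)) (hg.up_diff _)]
    cases c
    · simp
    · simp; ring

theorem Ex_pullCfg' (c : Bool) (τ : Edge ≃ Edge) (s : ℝ) {A : Set Edge} {F G : Finset Edge}
    {g : Config → ℝ} (hg : DepOn A g) (hF : A ⊆ F) (hG : ∀ e ∈ A, τ e ∈ G) :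
    Ex s G (fun ω => g (pullCfg c τ ω)) = Ex (if c then 1 - s else s) F g := by
  rw [← Ex_pullCfg c τ s F (hg.mono hF)]
  have hd : DepOn (τ '' A) (fun ω => g (pullCfg c τ ω)) := by
    intro ω ω' h
    apply hg
    intro e he
    simp only [pullCfg]; rw [h (τ e) ⟨e, he, rfl⟩]
  apply Ex_marg' s hd
  · rintro _ ⟨e, he, rfl⟩
    simpa using hF he
  · rintro _ ⟨e, he, rfl⟩
    exact hG e he

theorem Ex_prod {ι : Type*} (s : ℝ) (F : Finset Edge) (A : ι → Set Edge) (f : ι → Config → ℝ)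
    (hf : ∀ i, DepOn (A i) (f i)) (J : Finset ι) :
    (∀ i ∈ J, ∀ j ∈ J, i ≠ j → Disjoint (A i) (A j)) →
    Ex s F (fun ω => ∏ i ∈ J, f i ω) = ∏ i ∈ J, Ex s F (f i) := by
  induction J using Finset.induction_on with
  | empty => intro _; simpa using Ex_const s F 1
  | insert a J ha ih =>
    intro hd
    simp only [Finset.prod_insert ha]
    rw [← ih (fun i hi j hj => hd i (by simp [hi]) j (by simp [hj]))]
    refine Ex_indep s (A := A a) (B := ⋃ i ∈ J, A i) ?_ F (hf a) ?_
    · rw [Set.disjoint_iUnion₂_right]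
      intro i hi
      exact hd a (by simp) i (by simp [hi]) (fun h => ha (h ▸ hi))
    · intro ω ω' h
      refine Finset.prod_congr rfl fun i hi => hf i ω ω' fun e he => h e ?_
      simp only [Set.mem_iUnion]; exact ⟨i, hi, he⟩

theorem P_cyl {P : Measure Config} {p : ℝ} (h0 : 0 ≤ p) (h1 : p ≤ 1) (hP : IsBernoulli P p)
    {F T : Finset Edge} (hT : T ⊆ F) :
    P {ω : Config | ∀ e ∈ F, ω e = indc T e}
      = ENNReal.ofReal (p ^ T.card * (1 - p) ^ (F.card - T.card)) := by
  rw [hP.2 F (indc T)]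
  have h2 : 0 ≤ 1 - p := by linarith
  rw [ENNReal.ofReal_mul (by positivity), ENNReal.ofReal_pow h0, ENNReal.ofReal_pow h2]
  simp only [indc, decide_eq_true_eq]
  rw [Finset.prod_ite, Finset.prod_const, Finset.prod_const]
  congr 2
  · congr 1; ext e; simp only [Finset.mem_filter]; exact ⟨fun h => h.2, fun h => ⟨hT h, h⟩⟩
  · rw [← Finset.card_sdiff_of_subset hT]
    congr 1; ext e; simp

theorem P_le {P : Measure Config} {p : ℝ} (h0 : 0 ≤ p) (h1 : p ≤ 1) (hP : IsBernoulli P p)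
    {F : Finset Edge} {A : Config → Prop} (hA : DepOn (F : Set Edge) A) :
    P {ω | A ω} ≤ ENNReal.ofReal (Pr p F A) := by
  have hsub : {ω | A ω} ⊆ ⋃ T ∈ F.powerset.filter (fun T => A (indc T)),
      {ω : Config | ∀ e ∈ F, ω e = indc T e} := by
    intro ω hω
    simp only [Set.mem_iUnion]
    have hag : ∀ e ∈ F, ω e = indc (F.filter (fun e => ω e = true)) e := by
      intro e he; simp only [indc, Finset.mem_filter, he, true_and]; simp
    refine ⟨F.filter (fun e => ω e = true), ?_, hag⟩
    simp only [Finset.mem_filter, Finset.mem_powerset]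
    refine ⟨Finset.filter_subset _ _, ?_⟩
    rw [← hA ω _ hag]; exact hω
  refine (measure_mono hsub).trans ((measure_biUnion_finset_le _ _).trans ?_)
  have h2 : 0 ≤ 1 - p := by linarith
  unfold Pr Ex
  rw [ENNReal.ofReal_sum_of_nonneg (fun T _ => mul_nonneg (by positivity) (I_nonneg _ _)),
    Finset.sum_filter]
  refine Finset.sum_le_sum fun T hT => ?_
  by_cases h : A (indc T)
  · simp only [h, if_true, I, mul_one]
    rw [P_cyl h0 h1 hP (Finset.mem_powerset.1 hT)]
  · simp [h]
end PartOne

noncomputable section PartTwo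
open scoped Classical

/-- sup norm -/
def nrm (v : Vert) : ℤ := max |v.1| |v.2|
/-- box -/
def box (n : ℤ) : Set Vert := {v | nrm v ≤ n}
/-- connection inside `S` -/
def conn (ω : Config) (S : Set Vert) : Vert → Vert → Prop :=
  Relation.ReflTransGen (fun u v => openAdj ω u v ∧ u ∈ S ∧ v ∈ S)
/-- edges inside `S` -/
def edgesIn (S : Set Vert) : Set Edge := {e | e.1 ∈ S ∧ edgeTip e ∈ S}
/-- finite set of edges based in a box -/
def EF (n : ℤ) : Finset Edge :=
  ((Finset.Icc (-n) n) ×ˢ (Finset.Icc (-n) n)) ×ˢ Finset.univ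

theorem nrm_le {v : Vert} {n : ℤ} : nrm v ≤ n ↔ -n ≤ v.1 ∧ v.1 ≤ n ∧ -n ≤ v.2 ∧ v.2 ≤ n := by
  simp only [nrm, max_le_iff, abs_le]; tauto
theorem nrm_nonneg (v : Vert) : 0 ≤ nrm v := le_max_of_le_left (abs_nonneg _)
theorem nrm_zero : nrm 0 = 0 := by simp [nrm]
theorem mem_box {v : Vert} {n : ℤ} : v ∈ box n ↔ -n ≤ v.1 ∧ v.1 ≤ n ∧ -n ≤ v.2 ∧ v.2 ≤ n := nrm_le
theorem mem_EF {e : Edge} {n : ℤ} : e ∈ EF n ↔ nrm e.1 ≤ n := by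
  rw [nrm_le]; simp [EF, and_assoc]
theorem edgesIn_box_EF {n : ℤ} : edgesIn (box n) ⊆ (EF n : Set Edge) := fun _ he => mem_EF.2 he.1
theorem edgesIn_mono {S T : Set Vert} (h : S ⊆ T) : edgesIn S ⊆ edgesIn T :=
  fun _ he => ⟨h he.1, h he.2⟩
theorem box_mono {m n : ℤ} (h : m ≤ n) : box m ⊆ box n := fun _ hv => le_trans hv h
theorem edgesIn_box_EF' {S : Set Vert} {n : ℤ} (h : S ⊆ box n) : edgesIn S ⊆ (EF n : Set Edge) :=
  (edgesIn_mono h).trans edgesIn_box_EF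

theorem openAdj_iff {ω : Config} {x y : Vert} : openAdj ω x y ↔
    (ω (x, false) = true ∧ y = (x.1 + 1, x.2)) ∨ (ω (x, true) = true ∧ y = (x.1, x.2 + 1)) ∨
    (ω (y, false) = true ∧ x = (y.1 + 1, y.2)) ∨ (ω (y, true) = true ∧ x = (y.1, y.2 + 1)) := by
  constructor
  · rintro ⟨⟨⟨a, b⟩, c⟩, ho, (⟨h1, h2⟩ | ⟨h1, h2⟩)⟩
    · cases c <;> simp only [edgeTip] at h1 h2 <;> subst h1 <;> subst h2
      · left; exact ⟨ho, by simp⟩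
      · right; left; exact ⟨ho, by simp⟩
    · cases c <;> simp only [edgeTip] at h1 h2 <;> subst h1 <;> subst h2
      · right; right; left; exact ⟨ho, by simp⟩
      · right; right; right; exact ⟨ho, by simp⟩
  · rintro (⟨h, rfl⟩ | ⟨h, rfl⟩ | ⟨h, rfl⟩ | ⟨h, rfl⟩)
    · exact ⟨_, h, Or.inl ⟨rfl, by ext <;> simp [edgeTip]⟩⟩
    · exact ⟨_, h, Or.inl ⟨rfl, by ext <;> simp [edgeTip]⟩⟩
    · exact ⟨_, h, Or.inr ⟨rfl, by ext <;> simp [edgeTip]⟩⟩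
    · exact ⟨_, h, Or.inr ⟨rfl, by ext <;> simp [edgeTip]⟩⟩

theorem openAdj_symm {ω : Config} {x y : Vert} (h : openAdj ω x y) : openAdj ω y x := by
  obtain ⟨e, ho, h⟩ := h; exact ⟨e, ho, h.symm⟩
theorem openAdj_mono {ω ω' : Config} (h : ω ≤ ω') {x y : Vert} (ha : openAdj ω x y) :
    openAdj ω' x y := by
  obtain ⟨e, ho, h'⟩ := ha
  refine ⟨e, ?_, h'⟩
  have := h e; rw [ho] at this
  exact top_le_iff.1 this
theorem openAdj_dist {ω : Config} {x y : Vert} (h : openAdj ω x y) :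
    |y.1 - x.1| + |y.2 - x.2| = 1 := by
  rcases openAdj_iff.1 h with ⟨_, rfl⟩ | ⟨_, rfl⟩ | ⟨_, rfl⟩ | ⟨_, rfl⟩ <;> simp

theorem conn_refl (ω : Config) (S : Set Vert) (x : Vert) : conn ω S x x := Relation.ReflTransGen.refl
theorem conn_trans {ω : Config} {S : Set Vert} {x y z : Vert} (h : conn ω S x y) (h' : conn ω S y z) :
    conn ω S x z := Relation.ReflTransGen.trans h h'
theorem conn_symm {ω : Config} {S : Set Vert} {x y : Vert} (h : conn ω S x y) : conn ω S y x := by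
  induction h with
  | refl => exact conn_refl _ _ _
  | tail _ h ih => exact Relation.ReflTransGen.head ⟨openAdj_symm h.1, h.2.2, h.2.1⟩ ih
theorem conn_mono {ω ω' : Config} {S S' : Set Vert} (hω : ω ≤ ω') (hS : S ⊆ S') {x y : Vert}
    (h : conn ω S x y) : conn ω' S' x y :=
  Relation.ReflTransGen.mono (fun _ _ h => ⟨openAdj_mono hω h.1, hS h.2.1, hS h.2.2⟩) _ _ h
theorem conn_single {ω : Config} {S : Set Vert} {x y : Vert} (h : openAdj ω x y) (hx : x ∈ S) (hy : y ∈ S) :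
    conn ω S x y := Relation.ReflTransGen.single ⟨h, hx, hy⟩
theorem conn_mem {ω : Config} {S : Set Vert} {x y : Vert} (h : conn ω S x y) (hx : x ∈ S) : y ∈ S := by
  induction h with
  | refl => exact hx
  | tail _ h _ => exact h.2.2
theorem conn_DepOn (S : Set Vert) (x y : Vert) : DepOn (edgesIn S) (fun ω => conn ω S x y) := by
  have key : ∀ ω ω' : Config, (∀ e ∈ edgesIn S, ω e = ω' e) → conn ω S x y → conn ω' S x y := by
    intro ω ω' h hc
    refine Relation.ReflTransGen.mono ?_ _ _ hc
    rintro u v ⟨⟨e, ho, he⟩, hu, hv⟩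
    refine ⟨⟨e, ?_, he⟩, hu, hv⟩
    rw [← h e ?_, ho]
    rcases he with ⟨h1, h2⟩ | ⟨h1, h2⟩
    · exact ⟨h1 ▸ hu, h2 ▸ hv⟩
    · exact ⟨h1 ▸ hv, h2 ▸ hu⟩
  intro ω ω' h
  exact propext ⟨key ω ω' h, key ω' ω fun e he => (h e he).symm⟩

/-- 1-Lipschitz height function -/
def Lip (h : Vert → ℤ) : Prop := ∀ (ω : Config) u v, openAdj ω u v → h v ≤ h u + 1

theorem Lip_nrm (c : Vert) : Lip (fun v => nrm (v - c)) := by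
  intro ω u v h
  have hd := openAdj_dist h
  simp only [nrm, Prod.fst_sub, Prod.snd_sub]
  have h1 : |v.1 - u.1| ≤ 1 := by linarith [abs_nonneg (v.2 - u.2)]
  have h2 : |v.2 - u.2| ≤ 1 := by linarith [abs_nonneg (v.1 - u.1)]
  have h3 : |v.1 - c.1| ≤ |v.1 - u.1| + |u.1 - c.1| := abs_sub_le _ _ _
  have h4 : |v.2 - c.2| ≤ |v.2 - u.2| + |u.2 - c.2| := abs_sub_le _ _ _
  have := le_max_left |u.1 - c.1| |u.2 - c.2|
  have := le_max_right |u.1 - c.1| |u.2 - c.2|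
  apply max_le <;> linarith
theorem Lip_nrm0 : Lip nrm := by simpa using Lip_nrm 0
theorem Lip_neg {h : Vert → ℤ} (hh : Lip h) : Lip (fun v => - h v) := by
  intro ω u v hu
  have := hh ω v u (openAdj_symm hu)
  simp only; linarith

theorem conn_last {h : Vert → ℤ} (hh : Lip h) {ω : Config} {S : Set Vert} {x y : Vert} {k : ℤ}
    (hx : h x ≤ k) (hc : conn ω S x y) (hy : k ≤ h y) :
    ∃ z, h z = k ∧ conn ω (S ∩ {v | k ≤ h v}) z y ∧ conn ω S x z := by
  induction hc with
  | refl => exact ⟨x, le_antisymm hx hy, conn_refl _ _ _, conn_refl _ _ _⟩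
  | @tail b c hb hbc ih =>
    by_cases hk : k ≤ h b
    · obtain ⟨z, hz, h1, h2⟩ := ih hk
      exact ⟨z, hz, h1.tail ⟨hbc.1, ⟨hbc.2.1, hk⟩, ⟨hbc.2.2, hy⟩⟩, h2⟩
    · have := hh ω b c hbc.1
      exact ⟨c, by omega, conn_refl _ _ _, Relation.ReflTransGen.tail hb hbc⟩
theorem conn_first {h : Vert → ℤ} (hh : Lip h) {ω : Config} {S : Set Vert} {x y : Vert} {k : ℤ}
    (hx : h x ≤ k) (hc : conn ω S x y) (hy : k ≤ h y) :
    ∃ z, h z = k ∧ conn ω (S ∩ {v | h v ≤ k}) x z ∧ conn ω S z y := by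
  obtain ⟨z, hz, h1, h2⟩ := conn_last (Lip_neg hh) (k := -k) (by simpa using hy) (conn_symm hc)
    (by simpa using hx)
  refine ⟨z, by linarith, ?_, conn_symm h2⟩
  simpa using conn_symm h1

/-- lattice automorphism, acting on vertices and edges -/
structure Auto where
  /-- vertex map -/
  v : Vert ≃ Vert
  /-- edge map -/
  e : Edge ≃ Edge
  compat : ∀ x, ((e x).1 = v x.1 ∧ edgeTip (e x) = v (edgeTip x)) ∨
    ((e x).1 = v (edgeTip x) ∧ edgeTip (e x) = v x.1)

theorem Auto.openAdj (τ : Auto) {ω : Config} {x y : Vert} :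
    openAdj (pullCfg false τ.e ω) x y ↔ openAdj ω (τ.v x) (τ.v y) := by
  constructor
  · rintro ⟨e, ho, he⟩
    refine ⟨τ.e e, by simpa [pullCfg] using ho, ?_⟩
    rcases τ.compat e with ⟨h1, h2⟩ | ⟨h1, h2⟩ <;> rcases he with ⟨rfl, rfl⟩ | ⟨rfl, rfl⟩ <;> simp [h1, h2]
  · rintro ⟨e, ho, he⟩
    obtain ⟨e, rfl⟩ := τ.e.surjective e
    refine ⟨e, by simpa [pullCfg] using ho, ?_⟩
    rcases τ.compat e with ⟨h1, h2⟩ | ⟨h1, h2⟩ <;> rw [h1, h2] at he <;> simp only [τ.v.apply_eq_iff_eq] at he <;> tauto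

theorem Auto.conn (τ : Auto) {ω : Config} {S : Set Vert} {x y : Vert} :
    conn (pullCfg false τ.e ω) (τ.v ⁻¹' S) x y ↔ conn ω S (τ.v x) (τ.v y) := by
  constructor
  · intro h
    refine Relation.ReflTransGen.lift τ.v ?_ _ _ h
    rintro u v ⟨h, hu, hv⟩
    exact ⟨τ.openAdj.1 h, hu, hv⟩
  · intro h
    have : Relation.ReflTransGen (fun u v => _root_.openAdj (pullCfg false τ.e ω) u v ∧ u ∈ τ.v ⁻¹' S ∧ v ∈ τ.v ⁻¹' S)
        (τ.v.symm (τ.v x)) (τ.v.symm (τ.v y)) := by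
      refine Relation.ReflTransGen.lift τ.v.symm ?_ _ _ h
      rintro u v ⟨h, hu, hv⟩
      exact ⟨τ.openAdj.2 (by simpa using h), by simpa using hu, by simpa using hv⟩
    simp only [Equiv.symm_apply_apply] at this
    exact this

/-- translation -/
def Tr (c : Vert) : Auto where
  v := Equiv.addRight c
  e := ⟨fun e => (e.1 + c, e.2), fun e => (e.1 - c, e.2), fun e => by simp, fun e => by simp⟩
  compat := by rintro ⟨x, b⟩; left; refine ⟨rfl, ?_⟩; simp only [edgeTip, Equiv.coe_fn_mk, Equiv.coe_addRight]; ring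
/-- reflection of first coordinate -/
def Fl : Auto where
  v := ⟨fun x => (-x.1, x.2), fun x => (-x.1, x.2), fun x => by simp, fun x => by simp⟩
  e := ⟨fun e => ((if e.2 then -e.1.1 else -e.1.1 - 1, e.1.2), e.2),
        fun e => ((if e.2 then -e.1.1 else -e.1.1 - 1, e.1.2), e.2),
        by rintro ⟨⟨x, y⟩, b⟩; cases b <;> simp, by rintro ⟨⟨x, y⟩, b⟩; cases b <;> simp⟩
  compat := by
    rintro ⟨⟨x, y⟩, b⟩
    cases b
    · right; simp [edgeTip]; ring
    · left; simp [edgeTip]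
/-- swap of coordinates -/
def Sw : Auto where
  v := Equiv.prodComm ℤ ℤ
  e := ⟨fun e => ((e.1.2, e.1.1), !e.2), fun e => ((e.1.2, e.1.1), !e.2), fun e => by simp, fun e => by simp⟩
  compat := by
    rintro ⟨⟨x, y⟩, b⟩
    left
    cases b <;> simp [edgeTip]

theorem Tr_v (c x : Vert) : (Tr c).v x = x + c := rfl
theorem Tr_e (c : Vert) (e : Edge) : (Tr c).e e = (e.1 + c, e.2) := rfl

/-- Two events related by an automorphism have equal probability. -/
theorem Pr_auto (τ : Auto) (s : ℝ) {F G : Finset Edge} {A B : Config → Prop} {S : Set Vert}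
    (hA : DepOn (edgesIn S) A) (hF : edgesIn S ⊆ F) (hG : ∀ e ∈ edgesIn S, τ.e e ∈ G)
    (hAB : ∀ ω, B ω ↔ A (pullCfg false τ.e ω)) : Pr s G B = Pr s F A := by
  have := Ex_pullCfg' false τ.e s (g := I A) hA.I hF hG
  simp only [Bool.false_eq_true, if_false] at this
  unfold Pr
  rw [← this]
  congr 1
  funext ω
  simp only [I, hAB]

theorem openAdj_edge {ω : Config} {e : Edge} (h : ω e = true) : openAdj ω e.1 (edgeTip e) :=
  ⟨e, h, Or.inl ⟨rfl, rfl⟩⟩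

theorem nrm_add_le (u v : Vert) : nrm (u + v) ≤ nrm u + nrm v := by
  have h1 : |u.1 + v.1| ≤ |u.1| + |v.1| := abs_add_le _ _
  have h2 : |u.2 + v.2| ≤ |u.2| + |v.2| := abs_add_le _ _
  unfold nrm
  have := le_max_left |u.1| |u.2|
  have := le_max_right |u.1| |u.2|
  have := le_max_left |v.1| |v.2|
  have := le_max_right |v.1| |v.2|
  apply max_le <;> simp only [Prod.fst_add, Prod.snd_add] <;> linarith
theorem nrm_neg (u : Vert) : nrm (-u) = nrm u := by simp [nrm]

/-- `0` is connected to distance `n` -/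
def arm0 (n : ℤ) (ω : Config) : Prop := ∃ v, nrm v = n ∧ conn ω (box n) 0 v
/-- the box `box k` is connected to distance `n` -/
def armk (k n : ℤ) (ω : Config) : Prop := ∃ a ∈ box k, ∃ v, nrm v = n ∧ conn ω (box n) a v

theorem DepOn_exists {ι : Sort*} {A : Set Edge} {p : ι → Config → Prop} (h : ∀ i, DepOn A (p i)) :
    DepOn A (fun ω => ∃ i, p i ω) := fun ω ω' hω => by
  simp only [fun i => h i ω ω' hω]
theorem DepOn_and {A : Set Edge} {p q : Config → Prop} (h : DepOn A p) (h' : DepOn A q) :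
    DepOn A (fun ω => p ω ∧ q ω) := h.comp₂ h' _
theorem DepOn_not {A : Set Edge} {p : Config → Prop} (h : DepOn A p) :
    DepOn A (fun ω => ¬ p ω) := h.comp _
theorem DepOn_const {α : Sort*} {A : Set Edge} (p : α) : DepOn A (fun _ => p) := fun _ _ _ => rfl
theorem DepOn_edge {A : Set Edge} {e : Edge} (h : e ∈ A) (b : Bool) : DepOn A (fun ω => ω e = b) :=
  fun ω ω' hω => by simp only [hω e h]

theorem arm0_DepOn (n : ℤ) : DepOn (edgesIn (box n)) (arm0 n) :=
  DepOn_exists fun v => DepOn_and (DepOn_const _) (conn_DepOn _ _ _)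
theorem armk_DepOn (k n : ℤ) : DepOn (edgesIn (box n)) (armk k n) :=
  DepOn_exists fun a => DepOn_and (DepOn_const _) (DepOn_exists fun v =>
    DepOn_and (DepOn_const _) (conn_DepOn _ _ _))
theorem arm0_mono {ω ω' : Config} (h : ω ≤ ω') (n : ℤ) : arm0 n ω → arm0 n ω' :=
  fun ⟨v, hv, hc⟩ => ⟨v, hv, conn_mono h subset_rfl hc⟩
theorem armk_mono {ω ω' : Config} (h : ω ≤ ω') (k n : ℤ) : armk k n ω → armk k n ω' :=
  fun ⟨a, ha, v, hv, hc⟩ => ⟨a, ha, v, hv, conn_mono h subset_rfl hc⟩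
theorem I_monotone {p : Config → Prop} (h : ∀ ω ω', ω ≤ ω' → p ω → p ω') : Monotone (I p) := by
  intro ω ω' hω
  have := h ω ω' hω
  unfold I
  by_cases hp : p ω
  · simp [hp, this hp]
  · simp only [hp, if_false]; split_ifs <;> norm_num
theorem Pr_mono_s {s t : ℝ} (h0 : 0 ≤ s) (hst : s ≤ t) (h1 : t ≤ 1) (F : Finset Edge)
    {p : Config → Prop} (h : ∀ ω ω', ω ≤ ω' → p ω → p ω') : Pr s F p ≤ Pr t F p :=
  Ex_mono_s h0 hst h1 F (I_monotone h)
theorem Pr_marg (s : ℝ) {A : Set Edge} {p : Config → Prop} (hf : DepOn A p) {F G : Finset Edge}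
    (hF : A ⊆ F) (hG : A ⊆ G) : Pr s G p = Pr s F p := Ex_marg' s hf.I hF hG
theorem Pr_indep (s : ℝ) {A B : Set Edge} (hAB : Disjoint A B) (F : Finset Edge)
    {p q : Config → Prop} (hp : DepOn A p) (hq : DepOn B q) :
    Pr s F (fun ω => p ω ∧ q ω) = Pr s F p * Pr s F q := by
  unfold Pr
  rw [← Ex_indep s hAB F hp.I hq.I]
  congr 1; funext ω; exact I_and p q ω
end PartTwo

noncomputable section PartThree
open scoped Classical

/-- inner endpoint -/
def inn (S : Set Vert) (e : Edge) : Vert := if e.1 ∈ S then e.1 else edgeTip e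
/-- outer endpoint -/
def out (S : Set Vert) (e : Edge) : Vert := if e.1 ∈ S then edgeTip e else e.1
/-- edge boundary -/
def bd (n : ℤ) (S : Set Vert) : Finset Edge :=
  (EF n).filter fun e => (e.1 ∈ S ∧ edgeTip e ∉ S) ∨ (e.1 ∉ S ∧ edgeTip e ∈ S)
/-- the quantity of Duminil-Copin and Tassion -/
def phi (s : ℝ) (n : ℤ) (S : Set Vert) : ℝ :=
  s * ∑ e ∈ bd n S, Pr s (EF n) (fun ω => conn ω S 0 (inn S e))

theorem bd_spec {n : ℤ} {S : Set Vert} {e : Edge} (he : e ∈ bd n S) :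
    inn S e ∈ S ∧ out S e ∉ S ∧ ((e.1 = inn S e ∧ edgeTip e = out S e) ∨
      (e.1 = out S e ∧ edgeTip e = inn S e)) := by
  simp only [bd, Finset.mem_filter] at he
  rcases he.2 with ⟨h1, h2⟩ | ⟨h1, h2⟩ <;> simp [inn, out, h1, h2]

theorem dist_tip (e : Edge) : |(edgeTip e).1 - e.1.1| + |(edgeTip e).2 - e.1.2| = 1 := by
  have := openAdj_dist (openAdj_edge (ω := fun _ => true) (e := e) rfl)
  exact this

theorem adj_full (ω : Config) {x y : Vert} (h : openAdj ω x y) : openAdj (fun _ => true) x y :=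
  openAdj_mono (fun _ => le_top) h

theorem bd_adj {n : ℤ} {S : Set Vert} {e : Edge} (he : e ∈ bd n S) :
    openAdj (fun _ => true) (inn S e) (out S e) := ⟨e, rfl, (bd_spec he).2.2⟩

theorem nrm_adj {ω : Config} {x y : Vert} (h : openAdj ω x y) : nrm y ≤ nrm x + 1 := Lip_nrm0 ω x y h

/-- finite box -/
def boxF (n : ℤ) : Finset Vert := (Finset.Icc (-n) n) ×ˢ (Finset.Icc (-n) n)
theorem mem_boxF {n : ℤ} {v : Vert} : v ∈ boxF n ↔ v ∈ box n := by
  rw [mem_box]; simp [boxF, and_assoc]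

/-- connection to the boundary of the box -/
def toB (n : ℤ) (x : Vert) (ω : Config) : Prop := ∃ v, nrm v = n ∧ conn ω (box n) x v
/-- vertices not connected to the boundary -/
def SS (n : ℤ) (ω : Config) : Finset Vert := (boxF n).filter fun x => ¬ toB n x ω

theorem mem_SS {n : ℤ} {ω : Config} {x : Vert} : x ∈ SS n ω ↔ x ∈ box n ∧ ¬ toB n x ω := by
  simp [SS, mem_boxF]
theorem SS_sub {n : ℤ} {ω : Config} {x : Vert} (hx : x ∈ SS n ω) : x ∈ box (n - 1) := by
  rw [mem_SS] at hx
  have h1 : nrm x ≤ n := hx.1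
  have h2 : nrm x ≠ n := fun h => hx.2 ⟨x, h, conn_refl _ _ _⟩
  show nrm x ≤ n - 1
  omega
theorem toB_adj {n : ℤ} {ω : Config} {x y : Vert} (h : openAdj ω x y) (hx : x ∈ box n) (hy : y ∈ box n)
    (ht : toB n y ω) : toB n x ω := by
  obtain ⟨v, hv, hc⟩ := ht
  exact ⟨v, hv, Relation.ReflTransGen.head ⟨h, hx, hy⟩ hc⟩

theorem SS_key {n : ℤ} {S : Finset Vert} {ω ω' : Config} (h : ∀ e ∈ (edgesIn (S : Set Vert))ᶜ, ω e = ω' e)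
    (hS : SS n ω = S) : SS n ω' = S := by
  have h1 : ∀ x ∈ box n, x ∉ S → toB n x ω' := by
    intro x hx hxS
    have : toB n x ω := by
      by_contra hc; exact hxS (hS ▸ mem_SS.2 ⟨hx, hc⟩)
    obtain ⟨v, hv, hc⟩ := this
    refine ⟨v, hv, ?_⟩
    clear hxS hx
    induction hc using Relation.ReflTransGen.head_induction_on with
    | refl => exact conn_refl _ _ _
    | @head a b hab hbv ih =>
      have haS : a ∉ S := by
        rw [← hS, mem_SS]; rintro ⟨_, h⟩; exact h ⟨v, hv, Relation.ReflTransGen.head hab hbv⟩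
      refine Relation.ReflTransGen.head ⟨?_, hab.2⟩ ih
      obtain ⟨e, ho, he⟩ := hab.1
      refine ⟨e, ?_, he⟩
      rw [← h e ?_, ho]
      rintro ⟨h3, h4⟩
      rcases he with ⟨h5, h6⟩ | ⟨h5, h6⟩
      · exact haS (h5 ▸ h3)
      · exact haS (h6 ▸ h4)
  have h2 : ∀ x, toB n x ω' → x ∉ S := by
    rintro x ⟨v, hv, hc⟩
    induction hc using Relation.ReflTransGen.head_induction_on with
    | refl => rw [← hS, mem_SS]; rintro ⟨_, h⟩; exact h ⟨v, hv, conn_refl _ _ _⟩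
    | @head a b hab hbv ih =>
      intro haS
      obtain ⟨e, ho, he⟩ := hab.1
      have ho' : ω e = true := by
        rw [h e ?_, ho]
        rintro ⟨h3, h4⟩
        rcases he with ⟨h5, h6⟩ | ⟨h5, h6⟩
        · exact ih (h6 ▸ h4)
        · exact ih (h5 ▸ h3)
      have : toB n b ω := by
        by_contra hc; exact ih (hS ▸ mem_SS.2 ⟨hab.2.2, hc⟩)
      have := toB_adj ⟨e, ho', he⟩ hab.2.1 hab.2.2 this
      rw [← hS, mem_SS] at haS
      exact haS.2 this
  ext x
  rw [mem_SS]
  constructor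
  · rintro ⟨hx, ht⟩; by_contra hxS; exact ht (h1 x hx hxS)
  · intro hx
    refine ⟨?_, fun ht => h2 x ht hx⟩
    rw [← hS, mem_SS] at hx; exact hx.1

theorem SS_DepOn (n : ℤ) (S : Finset Vert) : DepOn (edgesIn (S : Set Vert))ᶜ (fun ω => SS n ω = S) := by
  intro ω ω' h
  exact propext ⟨SS_key h, SS_key fun e he => (h e he).symm⟩

theorem SS_pivotal {n : ℤ} {ω : Config} {e : Edge} (h0 : (0 : Vert) ∈ SS n ω)
    (he : e ∈ bd n (SS n ω : Set Vert)) (hc : conn ω (SS n ω : Set Vert) 0 (inn (SS n ω : Set Vert) e)) :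
    arm0 n (up e true ω) ∧ ¬ arm0 n (up e false ω) := by
  obtain ⟨h1, h2, h3⟩ := bd_spec he
  have hadj := bd_adj he
  set a := inn (SS n ω : Set Vert) e
  set b := out (SS n ω : Set Vert) e
  have ha : a ∈ box n := (mem_SS.1 (Finset.mem_coe.1 h1)).1
  have hb : b ∈ box n := by
    have h4 : nrm a ≤ n - 1 := SS_sub (Finset.mem_coe.1 h1)
    have := nrm_adj hadj
    show nrm b ≤ n
    omega
  have hbt : toB n b ω := by
    by_contra hcc; exact h2 (Finset.mem_coe.2 (mem_SS.2 ⟨hb, hcc⟩))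
  constructor
  · obtain ⟨v, hv, hbv⟩ := hbt
    refine ⟨v, hv, ?_⟩
    have e1 : conn (up e true ω) (box n) 0 a :=
      conn_mono (le_up_true e ω) (fun x hx => (mem_SS.1 (Finset.mem_coe.1 hx)).1) hc
    have e2 : conn (up e true ω) (box n) a b := conn_single ⟨e, up_self _ _ _, h3⟩ ha hb
    exact conn_trans e1 (conn_trans e2 (conn_mono (le_up_true e ω) subset_rfl hbv))
  · intro h
    have := arm0_mono (up_false_le e ω) n h
    exact (mem_SS.1 h0).2 this

theorem dct_deriv {n : ℤ} (hn : 0 ≤ n) {q s : ℝ} (h0 : 0 ≤ q) (hqs : q ≤ s) (h1 : s ≤ 1)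
    (H : ∀ S : Finset Vert, (S : Set Vert) ⊆ box (n - 1) → (0 : Vert) ∈ S → 1 ≤ phi q n S) :
    1 - Pr s (EF n) (arm0 n) ≤
      ∑ e ∈ EF n, Ex s (EF n) (fun ω => I (arm0 n) (up e true ω) - I (arm0 n) (up e false ω)) := by
  have hs0 : 0 ≤ s := h0.trans hqs
  set Q := (boxF (n-1)).powerset.filter (fun S => (0 : Vert) ∈ S) with hQ
  have hQm : ∀ S ∈ Q, (S : Set Vert) ⊆ box (n-1) ∧ (0 : Vert) ∈ S := by
    intro S hS
    rw [hQ, Finset.mem_filter, Finset.mem_powerset] at hS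
    exact ⟨fun x hx => mem_boxF.1 (hS.1 hx), hS.2⟩
  have step1 : ∀ e ∈ EF n, ∑ S ∈ Q, (if e ∈ bd n S then
      Pr s (EF n) (fun ω => conn ω (S : Set Vert) 0 (inn S e)) * Pr s (EF n) (fun ω => SS n ω = S) else 0) ≤
      Ex s (EF n) (fun ω => I (arm0 n) (up e true ω) - I (arm0 n) (up e false ω)) := by
    intro e _
    have : ∀ S ∈ Q, (if e ∈ bd n S then
      Pr s (EF n) (fun ω => conn ω (S : Set Vert) 0 (inn S e)) * Pr s (EF n) (fun ω => SS n ω = S) else 0)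
      = Ex s (EF n) (fun ω => if e ∈ bd n S then I (fun ω => conn ω (S : Set Vert) 0 (inn S e) ∧ SS n ω = S) ω else 0) := by
      intro S _
      split_ifs with he
      · rw [← Pr_indep s disjoint_compl_right (EF n) (conn_DepOn _ _ _) (SS_DepOn n S)]
        rfl
      · rw [Ex_const]
    rw [Finset.sum_congr rfl this, ← Ex_sum]
    refine Ex_mono hs0 h1 _ fun ω => ?_
    have hmono : 0 ≤ I (arm0 n) (up e true ω) - I (arm0 n) (up e false ω) := by
      have := I_monotone (fun ω ω' h => arm0_mono h n) ((up_false_le e ω).trans (le_up_true e ω))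
      linarith
    have hz : ∀ S ∈ Q, S ≠ SS n ω → (if e ∈ bd n S then I (fun ω => conn ω (S : Set Vert) 0 (inn S e) ∧ SS n ω = S) ω else 0) = 0 := by
      intro S _ hS
      have : ¬ SS n ω = S := fun h => hS h.symm
      simp [I, this]
    by_cases hmem : SS n ω ∈ Q
    · rw [Finset.sum_eq_single_of_mem _ hmem hz]
      split_ifs with he
      · by_cases hc : conn ω (SS n ω : Set Vert) 0 (inn (SS n ω : Set Vert) e)
        · have := SS_pivotal (hQm _ hmem).2 he hc
          simp [I, this.1, this.2, hc]
        · simpa [I, hc] using hmono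
      · exact hmono
    · rw [Finset.sum_eq_zero (fun S hS => hz S hS (fun h => hmem (h ▸ hS)))]
      exact hmono
  refine le_trans ?_ (Finset.sum_le_sum step1)
  rw [Finset.sum_comm]
  have step2 : ∀ S ∈ Q, Pr s (EF n) (fun ω => SS n ω = S) ≤ ∑ e ∈ EF n, (if e ∈ bd n S then
      Pr s (EF n) (fun ω => conn ω (S : Set Vert) 0 (inn S e)) * Pr s (EF n) (fun ω => SS n ω = S) else 0) := by
    intro S hS
    rw [← Finset.sum_filter, ← Finset.sum_mul]
    have hfe : (EF n).filter (fun e => e ∈ bd n (S : Set Vert)) = bd n S := by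
      ext e; simp [bd]
    rw [hfe]
    have hp := H S (hQm S hS).1 (hQm S hS).2
    unfold phi at hp
    set A := ∑ e ∈ bd n (S : Set Vert), Pr q (EF n) (fun ω => conn ω (S : Set Vert) 0 (inn S e))
    set B := ∑ e ∈ bd n (S : Set Vert), Pr s (EF n) (fun ω => conn ω (S : Set Vert) 0 (inn S e))
    have hAB : A ≤ B := Finset.sum_le_sum fun e _ =>
      Pr_mono_s h0 hqs h1 _ (fun ω ω' h => conn_mono h subset_rfl)
    have hA0 : 0 ≤ A := Finset.sum_nonneg fun e _ => Pr_nonneg h0 (hqs.trans h1) _ _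
    have hA1 : 1 ≤ A := by nlinarith
    have := Pr_nonneg hs0 h1 (EF n) (fun ω => SS n ω = S)
    nlinarith
  refine le_trans ?_ (Finset.sum_le_sum step2)
  rw [← Pr_not]
  unfold Pr
  rw [← Ex_sum]
  refine Ex_mono hs0 h1 _ fun ω => ?_
  by_cases ha : arm0 n ω
  · simp only [I, ha, not_true, if_false]
    exact Finset.sum_nonneg fun S _ => by split_ifs <;> norm_num
  · have hmem : SS n ω ∈ Q := by
      rw [hQ, Finset.mem_filter, Finset.mem_powerset]
      refine ⟨fun x hx => mem_boxF.2 (SS_sub hx), mem_SS.2 ⟨?_, ha⟩⟩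
      show nrm 0 ≤ n
      rw [nrm_zero]; exact hn
    have := Finset.single_le_sum (f := fun S => I (fun ω => SS n ω = S) ω) (fun S _ => I_nonneg _ _) hmem
    refine le_trans ?_ this
    simp [I, ha]

theorem dct {n : ℤ} (hn : 0 ≤ n) {q t : ℝ} (h0 : 0 ≤ q) (hqt : q ≤ t) (h1 : t ≤ 1)
    (H : ∀ S : Finset Vert, (S : Set Vert) ⊆ box (n - 1) → (0 : Vert) ∈ S → 1 ≤ phi q n S) :
    1 - Real.exp (-(t - q)) ≤ Pr t (EF n) (arm0 n) := by
  set f : ℝ → ℝ := fun s => Pr s (EF n) (arm0 n) with hf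
  set f' : ℝ → ℝ := fun s => ∑ e ∈ EF n, Ex s (EF n)
    (fun ω => I (arm0 n) (up e true ω) - I (arm0 n) (up e false ω))
  have hd : ∀ s, HasDerivAt f (f' s) s := fun s => russo (EF n) (I (arm0 n)) s
  have hg : ∀ s, HasDerivAt (fun s => (1 - f s) * Real.exp s) ((0 - f' s) * Real.exp s + (1 - f s) * Real.exp s) s :=
    fun s => ((hasDerivAt_const s (1:ℝ)).sub (hd s)).mul (Real.hasDerivAt_exp s)
  have hanti : AntitoneOn (fun s => (1 - f s) * Real.exp s) (Set.Icc q t) := by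
    apply antitoneOn_of_deriv_nonpos (convex_Icc q t)
    · exact fun s _ => (hg s).continuousAt.continuousWithinAt
    · exact fun s _ => (hg s).differentiableAt.differentiableWithinAt
    · intro s hs
      rw [interior_Icc] at hs
      rw [(hg s).deriv]
      have : 1 - f s ≤ f' s := dct_deriv hn h0 hs.1.le (hs.2.le.trans h1) H
      have := Real.exp_pos s
      nlinarith
  have := hanti (Set.left_mem_Icc.2 hqt) (Set.right_mem_Icc.2 hqt) hqt
  simp only at this
  have hf0 : 0 ≤ f q := Pr_nonneg h0 (hqt.trans h1) _ _
  have h2 : (1 - f t) * Real.exp t ≤ Real.exp q := by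
    have := Real.exp_pos q
    nlinarith
  have h3 : Real.exp (-(t-q)) * Real.exp t = Real.exp q := by rw [← Real.exp_add]; congr 1; ring
  have := Real.exp_pos t
  show _ ≤ f t
  nlinarith
end PartThree

noncomputable section PartFour
open scoped Classical

/-- annulus crossing -/
def ann (k N : ℤ) (ω : Config) : Prop :=
  ∃ u v, nrm u = k ∧ nrm v = N ∧ conn ω (box N ∩ {v | k ≤ nrm v}) u v

theorem ann_armk {k N : ℤ} {ω : Config} (h : ann k N ω) : armk k N ω := by
  obtain ⟨u, v, hu, hv, hc⟩ := h
  exact ⟨u, hu.le, v, hv, conn_mono le_rfl inter_subset_left hc⟩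
theorem ann_DepOn (k N : ℤ) : DepOn (edgesIn (box N ∩ {v | k ≤ nrm v})) (ann k N) :=
  DepOn_exists fun _ => DepOn_exists fun _ =>
    DepOn_and (DepOn_const _) (DepOn_and (DepOn_const _) (conn_DepOn _ _ _))
theorem arm0_ann {k N n : ℤ} (hk : 0 ≤ k) (hkN : k ≤ N) (hN : N ≤ n) {ω : Config} (h : arm0 n ω) : ann k N ω := by
  obtain ⟨v, hv, hc⟩ := h
  obtain ⟨z, hz, h1, h2⟩ := conn_first Lip_nrm0 (k := N) (by rw [nrm_zero]; omega) hc (by omega)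
  obtain ⟨w, hw, h3, h4⟩ := conn_last Lip_nrm0 (k := k) (by rw [nrm_zero]; omega) h1 (by omega)
  refine ⟨w, z, hw, hz, conn_mono le_rfl ?_ h3⟩
  rintro x ⟨⟨_, hx⟩, hx'⟩
  exact ⟨hx, hx'⟩

theorem exists_k {q θ0 δ : ℝ} (h0 : 0 ≤ q) (h1 : q ≤ 1) (hθ : 0 < θ0)
    (H : ∀ n : ℤ, 0 ≤ n → θ0 ≤ Pr q (EF n) (arm0 n)) (hδ : 0 < δ) :
    ∃ k : ℤ, 0 ≤ k ∧ ∀ N, k < N → 1 - δ ≤ Pr q (EF N) (armk k N) := by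
  by_contra hcon
  push Not at hcon
  have hδ1 : 0 ≤ 1 - δ := by
    obtain ⟨N, _, hN⟩ := hcon 0 le_rfl
    have := Pr_nonneg h0 h1 (EF N) (armk 0 N)
    linarith
  have key : ∀ j : ℕ, ∃ m : ℤ, 0 ≤ m ∧ ∃ A : Config → Prop, DepOn (edgesIn (box (m-1))) A ∧
      (∀ n ω, m ≤ n → arm0 n ω → A ω) ∧ Pr q (EF m) A ≤ (1 - δ) ^ j := by
    intro j
    induction j with
    | zero => exact ⟨0, le_rfl, fun _ => True, DepOn_const _, fun _ _ _ _ => trivial, by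
        simpa using Pr_le_one h0 h1 (EF 0) (fun _ => True)⟩
    | succ j ih =>
      obtain ⟨m, hm, A, hA, hA2, hA3⟩ := ih
      obtain ⟨N, hN, hN2⟩ := hcon m hm
      have hsub : edgesIn (box (m-1)) ⊆ edgesIn (box N) := edgesIn_mono (box_mono (by omega))
      refine ⟨N + 1, by omega, fun ω => A ω ∧ ann m N ω, ?_, ?_, ?_⟩
      · rw [show N + 1 - 1 = N by ring]
        exact DepOn_and (hA.mono hsub) ((ann_DepOn m N).mono (edgesIn_mono inter_subset_left))
      · intro n ω hn ha
        exact ⟨hA2 n ω (by omega) ha, arm0_ann hm hN.le (by omega) ha⟩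
      · have hdis : Disjoint (edgesIn (box (m-1))) (edgesIn (box N ∩ {v | m ≤ nrm v})) := by
          rw [Set.disjoint_left]
          rintro e ⟨he, _⟩ ⟨⟨_, he2⟩, _⟩
          have : nrm e.1 ≤ m - 1 := he
          have : m ≤ nrm e.1 := he2
          omega
        rw [Pr_indep q hdis _ hA (ann_DepOn m N)]
        have e1 : Pr q (EF (N+1)) A = Pr q (EF m) A :=
          Pr_marg q hA (edgesIn_box_EF' (box_mono (by omega))) (edgesIn_box_EF' (box_mono (by omega)))
        have e2 : Pr q (EF (N+1)) (ann m N) = Pr q (EF N) (ann m N) :=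
          Pr_marg q (ann_DepOn m N) (edgesIn_box_EF' inter_subset_left)
            (edgesIn_box_EF' (inter_subset_left.trans (box_mono (by omega))))
        have e3 : Pr q (EF N) (ann m N) ≤ 1 - δ := (Pr_mono h0 h1 _ (fun ω => ann_armk)).trans hN2.le
        rw [e1, e2, pow_succ]
        exact mul_le_mul hA3 e3 (Pr_nonneg h0 h1 _ _) (pow_nonneg hδ1 _)
  obtain ⟨j, hj⟩ := exists_pow_lt_of_lt_one hθ (show 1 - δ < 1 by linarith)
  obtain ⟨m, hm, A, hA, hA2, hA3⟩ := key j
  have h2 := H m hm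
  have h3 := Pr_mono h0 h1 (EF m) (p := arm0 m) (q := A) (fun ω h => hA2 m ω le_rfl h)
  linarith
end PartFour

noncomputable section PartFive
open scoped Classical

theorem card_image_mono {α β : Type*} (s : Finset α) (f g : α → β)
    (h : ∀ x ∈ s, ∀ y ∈ s, f x = f y → g x = g y) : (s.image g).card ≤ (s.image f).card := by
  by_cases hs : s.Nonempty
  · obtain ⟨x0, hx0⟩ := hs
    let r : β → β := fun c => if hc : ∃ x ∈ s, f x = c then g hc.choose else g x0
    have hr : ∀ x ∈ s, r (f x) = g x := by
      intro x hx
      have hc : ∃ y ∈ s, f y = f x := ⟨x, hx, rfl⟩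
      simp only [r, dif_pos hc]
      exact h _ hc.choose_spec.1 _ hx hc.choose_spec.2
    have : s.image g ⊆ (s.image f).image r := by
      intro c hc
      obtain ⟨x, hx, rfl⟩ := Finset.mem_image.1 hc
      exact Finset.mem_image.2 ⟨f x, Finset.mem_image_of_mem _ hx, hr x hx⟩
    exact (Finset.card_le_card this).trans Finset.card_image_le
  · rw [Finset.not_nonempty_iff_eq_empty] at hs; simp [hs]

theorem card_image_strict {α β : Type*} (s : Finset α) (f g : α → β)
    (h : ∀ x ∈ s, ∀ y ∈ s, f x = f y → g x = g y) {u v : α} (hu : u ∈ s) (hv : v ∈ s)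
    (hg : g u = g v) (hf : f u ≠ f v) : (s.image g).card + 1 ≤ (s.image f).card := by
  have hsub : s.image g ⊆ (s.filter (fun x => f x ≠ f u)).image g := by
    intro c hc
    obtain ⟨x, hx, rfl⟩ := Finset.mem_image.1 hc
    by_cases hxu : f x = f u
    · rw [h x hx u hu hxu, hg]
      exact Finset.mem_image_of_mem _ (Finset.mem_filter.2 ⟨hv, hf.symm⟩)
    · exact Finset.mem_image_of_mem _ (Finset.mem_filter.2 ⟨hx, hxu⟩)
  have h1 := Finset.card_le_card hsub
  have h2 : ((s.filter (fun x => f x ≠ f u)).image g).card ≤ ((s.filter (fun x => f x ≠ f u)).image f).card :=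
    card_image_mono _ _ _ fun x hx y hy =>
      h x (Finset.mem_of_mem_filter _ hx) y (Finset.mem_of_mem_filter _ hy)
  have h3 : (s.filter (fun x => f x ≠ f u)).image f ⊆ (s.image f).erase (f u) := by
    intro c hc
    obtain ⟨x, hx, rfl⟩ := Finset.mem_image.1 hc
    rw [Finset.mem_filter] at hx
    exact Finset.mem_erase.2 ⟨hx.2, Finset.mem_image_of_mem _ hx.1⟩
  have h4 := Finset.card_le_card h3
  have h5 := Finset.card_erase_add_one (Finset.mem_image_of_mem f hu)
  omega

/-- boundary of the box -/
def sph (N : ℤ) : Finset Vert := (boxF N).filter fun x => nrm x = N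
/-- cluster inside a box -/
def clb (N : ℤ) (ω : Config) (x : Vert) : Set Vert := {y | conn ω (box N) x y}
/-- number of boundary clusters -/
def KK (N : ℤ) (ω : Config) : ℕ := ((sph N).image (clb N ω)).card

theorem mem_sph {N : ℤ} {x : Vert} : x ∈ sph N ↔ nrm x = N := by
  simp only [sph, Finset.mem_filter, mem_boxF]
  exact ⟨fun h => h.2, fun h => ⟨h.le, h⟩⟩
theorem clb_eq {N : ℤ} {ω : Config} {x y : Vert} : clb N ω x = clb N ω y ↔ conn ω (box N) x y := by
  constructor
  · intro h
    have : y ∈ clb N ω y := conn_refl _ _ _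
    rw [← h] at this; exact this
  · intro h
    ext z
    exact ⟨fun hz => conn_trans (conn_symm h) hz, fun hz => conn_trans h hz⟩
theorem KK_anti {N : ℤ} {ω ω' : Config} (h : ω ≤ ω') : KK N ω' ≤ KK N ω :=
  card_image_mono _ _ _ fun x _ y _ hxy => clb_eq.2 (conn_mono h subset_rfl (clb_eq.1 hxy))
theorem KK_le (N : ℤ) (ω : Config) : KK N ω ≤ (sph N).card := Finset.card_image_le
theorem KK_strict {N : ℤ} {ω ω' : Config} (h : ω ≤ ω') {a b : Vert} (ha : toB N a ω) (hb : toB N b ω)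
    (hn : ¬ conn ω (box N) a b) (hc : conn ω' (box N) a b) : KK N ω' + 1 ≤ KK N ω := by
  obtain ⟨u, hu, hau⟩ := ha
  obtain ⟨v, hv, hbv⟩ := hb
  refine card_image_strict (sph N) (clb N ω) (clb N ω')
    (fun x _ y _ hxy => clb_eq.2 (conn_mono h subset_rfl (clb_eq.1 hxy))) (mem_sph.2 hu) (mem_sph.2 hv) ?_ ?_
  · rw [clb_eq]
    exact conn_trans (conn_symm (conn_mono h subset_rfl hau)) (conn_trans hc (conn_mono h subset_rfl hbv))
  · rw [Ne, clb_eq]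
    exact fun hh => hn (conn_trans hau (conn_trans hh (conn_symm hbv)))

theorem sph_card (N : ℤ) (hN : 0 ≤ N) : ((sph N).card : ℤ) ≤ 4 * (2 * N + 1) := by
  have hsub : sph N ⊆ ((({N, -N} : Finset ℤ) ×ˢ (Finset.Icc (-N) N)) ∪ ((Finset.Icc (-N) N) ×ˢ ({N, -N} : Finset ℤ))) := by
    intro x hx
    rw [mem_sph] at hx
    have h1 := nrm_le.1 hx.le
    have h2 : |x.1| = N ∨ |x.2| = N := by
      unfold nrm at hx
      rcases max_choice |x.1| |x.2| with h | h <;> rw [h] at hx <;> tauto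
    simp only [Finset.mem_union, Finset.mem_product, Finset.mem_insert, Finset.mem_singleton, Finset.mem_Icc]
    rcases h2 with h | h
    · left; rcases abs_cases x.1 with h' | h' <;> constructor <;> omega
    · right; rcases abs_cases x.2 with h' | h' <;> constructor <;> omega
  have h1 := (Finset.card_le_card hsub).trans (Finset.card_union_le _ _)
  rw [Finset.card_product, Finset.card_product, Int.card_Icc] at h1
  have h2 : ({N, -N} : Finset ℤ).card ≤ 2 := Finset.card_le_two
  have h3 : ((N + 1 - -N).toNat : ℤ) = 2 * N + 1 := by rw [Int.toNat_of_nonneg (by omega)]; ring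
  have : (sph N).card ≤ 4 * (N + 1 - -N).toNat := by nlinarith
  zify at this
  rw [h3] at this
  exact this

/-- open all edges of `A` -/
def opn (A : Finset Edge) (ω : Config) : Config := fun e => if e ∈ A then true else ω e
theorem le_opn (A : Finset Edge) (ω : Config) : ω ≤ opn A ω := by
  intro e; unfold opn; split_ifs
  · exact le_top
  · exact le_rfl
theorem opn_empty (ω : Config) : opn ∅ ω = ω := by funext e; simp [opn]
theorem opn_insert (e : Edge) (A : Finset Edge) (ω : Config) :
    opn (insert e A) ω = opn A (up e true ω) := by
  funext x
  by_cases hx : x = e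
  · subst hx; simp [opn, up]
  · simp [opn, up, hx]

theorem opn_bound {s : ℝ} (h0 : 0 ≤ s) (h1 : s ≤ 1) (F : Finset Edge) (N : ℤ) (A : Finset Edge) (hA : A ⊆ F) :
    s ^ A.card * Ex s F (fun ω => (KK N ω : ℝ) - KK N (opn A ω)) ≤
      ∑ e ∈ A, Ex s F (fun ω => (KK N (up e false ω) : ℝ) - KK N (up e true ω)) := by
  induction A using Finset.induction_on with
  | empty => simp [opn_empty, Ex_const]
  | insert e A he ih =>
    rw [Finset.sum_insert he, Finset.card_insert_of_notMem he]
    have heF := hA (Finset.mem_insert_self _ _)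
    have ih := ih ((Finset.subset_insert _ _).trans hA)
    have e1 : Ex s F (fun ω => (KK N ω : ℝ) - KK N (opn (insert e A) ω)) =
      Ex s F (fun ω => (KK N ω : ℝ) - KK N (up e true ω)) +
      Ex s F (fun ω => (KK N (up e true ω) : ℝ) - KK N (opn A (up e true ω))) := by
      rw [← Ex_add]; congr 1; funext ω; rw [opn_insert]; ring
    rw [e1, mul_add]
    have b1 : Ex s F (fun ω => (KK N ω : ℝ) - KK N (up e true ω)) ≤
        Ex s F (fun ω => (KK N (up e false ω) : ℝ) - KK N (up e true ω)) := by
      refine Ex_mono h0 h1 _ fun ω => ?_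
      have : (KK N ω : ℝ) ≤ KK N (up e false ω) := by exact_mod_cast KK_anti (up_false_le e ω)
      linarith
    have b0 : 0 ≤ Ex s F (fun ω => (KK N ω : ℝ) - KK N (up e true ω)) := by
      refine Ex_nonneg h0 h1 _ fun ω => ?_
      have : (KK N (up e true ω) : ℝ) ≤ KK N ω := by exact_mod_cast KK_anti (le_up_true e ω)
      linarith
    have b2 : s * Ex s F (fun ω => (KK N (up e true ω) : ℝ) - KK N (opn A (up e true ω))) ≤
        Ex s F (fun ω => (KK N ω : ℝ) - KK N (opn A ω)) :=
      Ex_up_le h0 h1 heF (g := fun ω => (KK N ω : ℝ) - KK N (opn A ω)) fun ω => by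
        have : (KK N (opn A ω) : ℝ) ≤ KK N ω := by exact_mod_cast KK_anti (le_opn A ω)
        linarith
    refine add_le_add ?_ ?_
    · refine le_trans ?_ b1
      have : s ^ (A.card + 1) ≤ 1 := pow_le_one₀ h0 h1
      nlinarith
    · refine le_trans ?_ ih
      rw [pow_succ, mul_assoc]
      exact mul_le_mul_of_nonneg_left b2 (pow_nonneg h0 _)

/-- two separate arms from `box k + x` to the boundary of `box N` -/
def Ekx (k N : ℤ) (x : Vert) (ω : Config) : Prop :=
  ∃ a b, nrm (a - x) ≤ k ∧ nrm (b - x) ≤ k ∧ toB N a ω ∧ toB N b ω ∧ ¬ conn ω (box N) a b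
/-- edges of the block -/
def blk (k : ℤ) (x : Vert) : Finset Edge := (EF k).map (Tr x).e.toEmbedding

theorem mem_blk {k : ℤ} {x : Vert} {e : Edge} : e ∈ blk k x ↔ nrm (e.1 - x) ≤ k := by
  simp only [blk, Finset.mem_map_equiv, mem_EF]
  rfl

/-- any two points in a connected (fully open) block are connected -/
theorem block_conn {k N : ℤ} {x : Vert} {ω : Config} (hs : ∀ v, nrm (v - x) ≤ k → v ∈ box N)
    (ho : ∀ e ∈ blk k x, ω e = true) {a : Vert} (ha : nrm (a - x) ≤ k) : conn ω (box N) x a := by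
  have key : ∀ j : ℕ, ∀ a : Vert, nrm (a - x) ≤ k → |(a - x).1| + |(a-x).2| = j → conn ω (box N) x a := by
    intro j
    induction j with
    | zero =>
      intro a _ h
      have h1 := abs_nonneg (a - x).1
      have h2 := abs_nonneg (a - x).2
      have h3 : (a - x).1 = 0 := abs_eq_zero.1 (by push_cast at h; omega)
      have h4 : (a - x).2 = 0 := abs_eq_zero.1 (by push_cast at h; omega)
      have : a = x := by
        simp only [Prod.fst_sub, Prod.snd_sub] at h3 h4
        exact Prod.ext (by omega) (by omega)
      rw [this]; exact conn_refl _ _ _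
    | succ j ih =>
      intro a ha h
      have step : ∀ b : Vert, nrm (b - x) ≤ k → |(b - x).1| + |(b-x).2| = j →
          (∃ e : Edge, nrm (e.1 - x) ≤ k ∧ ((e.1 = b ∧ edgeTip e = a) ∨ (e.1 = a ∧ edgeTip e = b))) →
          conn ω (box N) x a := by
        rintro b hb hj ⟨e, he, hea⟩
        exact (ih b hb hj).tail ⟨⟨e, ho e (mem_blk.2 he), hea⟩, hs b hb, hs a ha⟩
      obtain ⟨a1, a2⟩ := a
      obtain ⟨x1, x2⟩ := x
      have ha' := nrm_le.1 ha
      simp only [Prod.fst_sub, Prod.snd_sub] at ha' h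
      push_cast at h
      rcases lt_trichotomy (a1 - x1) 0 with h1 | h1 | h1
      · refine step (a1 + 1, a2) (nrm_le.2 ?_) ?_ ⟨((a1, a2), false), ha, Or.inr ⟨rfl, by simp [edgeTip]⟩⟩
        · simp only [Prod.fst_sub, Prod.snd_sub]; omega
        · simp only [Prod.fst_sub, Prod.snd_sub]
          rw [abs_of_nonpos (by omega)]; rw [abs_of_neg h1] at h; omega
      · rw [h1, abs_zero] at h
        rcases lt_trichotomy (a2 - x2) 0 with h2 | h2 | h2
        · refine step (a1, a2 + 1) (nrm_le.2 ?_) ?_ ⟨((a1, a2), true), ha, Or.inr ⟨rfl, by simp [edgeTip]⟩⟩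
          · simp only [Prod.fst_sub, Prod.snd_sub]; omega
          · simp only [Prod.fst_sub, Prod.snd_sub]
            rw [h1, abs_zero, abs_of_nonpos (by omega)]; rw [abs_of_neg h2] at h; omega
        · rw [h2] at h; simp at h; omega
        · refine step (a1, a2 - 1) (nrm_le.2 ?_) ?_ ⟨((a1, a2 - 1), true), nrm_le.2 ?_, Or.inl ⟨rfl, by simp [edgeTip]⟩⟩
          · simp only [Prod.fst_sub, Prod.snd_sub]; omega
          · simp only [Prod.fst_sub, Prod.snd_sub]
            rw [h1, abs_zero, abs_of_nonneg (by omega)]; rw [abs_of_pos h2] at h; omega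
          · simp only [Prod.fst_sub, Prod.snd_sub]; omega
      · refine step (a1 - 1, a2) (nrm_le.2 ?_) ?_ ⟨((a1 - 1, a2), false), nrm_le.2 ?_, Or.inl ⟨rfl, by simp [edgeTip]⟩⟩
        · simp only [Prod.fst_sub, Prod.snd_sub]; omega
        · simp only [Prod.fst_sub, Prod.snd_sub]
          rw [abs_of_nonneg (by omega)]; rw [abs_of_pos h1] at h; omega
        · simp only [Prod.fst_sub, Prod.snd_sub]; omega
  have hj : ((|(a - x).1| + |(a-x).2|).toNat : ℤ) = |(a - x).1| + |(a-x).2| :=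
    Int.toNat_of_nonneg (add_nonneg (abs_nonneg _) (abs_nonneg _))
  exact key _ a ha hj.symm

theorem Ekx_drop {k N : ℤ} {x : Vert} {ω : Config} (hs : ∀ v, nrm (v - x) ≤ k → v ∈ box N)
    (h : Ekx k N x ω) : KK N (opn (blk k x) ω) + 1 ≤ KK N ω := by
  obtain ⟨a, b, ha, hb, h1, h2, h3⟩ := h
  have ho : ∀ e ∈ blk k x, opn (blk k x) ω e = true := fun e he => by simp [opn, he]
  exact KK_strict (le_opn _ _) h1 h2 h3
    (conn_trans (conn_symm (block_conn hs ho ha)) (block_conn hs ho hb))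

theorem Ekx_pr {s : ℝ} (h0 : 0 ≤ s) (h1 : s ≤ 1) {k N : ℤ} {x : Vert}
    (hs : ∀ v, nrm (v - x) ≤ k → v ∈ box N) :
    s ^ (EF k).card * Pr s (EF N) (Ekx k N x) ≤
      ∑ e ∈ blk k x, Ex s (EF N) (fun ω => (KK N (up e false ω) : ℝ) - KK N (up e true ω)) := by
  have hc : (blk k x).card = (EF k).card := Finset.card_map _
  have hsub : blk k x ⊆ EF N := fun e he => mem_EF.2 (hs _ (mem_blk.1 he))
  refine le_trans ?_ (opn_bound h0 h1 (EF N) N (blk k x) hsub)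
  rw [hc]
  refine mul_le_mul_of_nonneg_left ?_ (pow_nonneg h0 _)
  refine Ex_mono h0 h1 _ fun ω => ?_
  by_cases hE : Ekx k N x ω
  · have := Ekx_drop hs hE
    have h2 : (KK N (opn (blk k x) ω) : ℝ) + 1 ≤ KK N ω := by exact_mod_cast this
    simp only [I, hE, if_true]; linarith
  · have : (KK N (opn (blk k x) ω) : ℝ) ≤ KK N ω := by exact_mod_cast KK_anti (le_opn _ ω)
    simp only [I, hE, if_false]; linarith

theorem toB_DepOn (n : ℤ) (x : Vert) : DepOn (edgesIn (box n)) (toB n x) :=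
  DepOn_exists fun _ => DepOn_and (DepOn_const _) (conn_DepOn _ _ _)
theorem Ekx_DepOn (k N : ℤ) (x : Vert) : DepOn (edgesIn (box N)) (Ekx k N x) :=
  DepOn_exists fun _ => DepOn_exists fun _ =>
    DepOn_and (DepOn_const _) (DepOn_and (DepOn_const _) (DepOn_and (toB_DepOn _ _) (DepOn_and (toB_DepOn _ _)
      (DepOn_not (conn_DepOn _ _ _)))))

theorem nrm_sub_comm (u v : Vert) : nrm (u - v) = nrm (v - u) := by
  rw [← nrm_neg, neg_sub]

/-- comparison with the centered event -/
theorem Ekx_trans {s : ℝ} (h0 : 0 ≤ s) (h1 : s ≤ 1) {k N : ℤ} {x : Vert} (hx : nrm x ≤ N)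
    (hs : ∀ v, nrm (v - x) ≤ k → v ∈ box N) :
    Pr s (EF (2 * N)) (Ekx k (2 * N) 0) ≤ Pr s (EF N) (Ekx k N x) := by
  have hN : 0 ≤ N := (nrm_nonneg x).trans hx
  have e1 : Pr s (EF (3 * N)) (fun ω => Ekx k (2 * N) 0 (pullCfg false (Tr x).e ω)) =
      Pr s (EF (2 * N)) (Ekx k (2 * N) 0) := by
    refine Pr_auto (Tr x) s (Ekx_DepOn k (2*N) 0) edgesIn_box_EF ?_ (fun ω => Iff.rfl)
    rintro e ⟨he, _⟩
    rw [mem_EF, Tr_e]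
    have : nrm e.1 ≤ 2 * N := he
    have := nrm_add_le e.1 x
    simp only; omega
  have e2 : Pr s (EF (3 * N)) (Ekx k N x) = Pr s (EF N) (Ekx k N x) :=
    Pr_marg s (Ekx_DepOn k N x) edgesIn_box_EF (edgesIn_box_EF' (box_mono (by omega)))
  rw [← e1, ← e2]
  refine Pr_mono h0 h1 _ fun ω => ?_
  rintro ⟨a, b, ha, hb, ⟨u, hu, hau⟩, ⟨v, hv, hbv⟩, hab⟩
  simp only [sub_zero] at ha hb
  have hbox : (Tr x).v ⁻¹' {w | nrm (w - x) ≤ 2 * N} = box (2 * N) := by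
    ext w; simp [Tr_v, box]
  have hsub : box N ⊆ {w | nrm (w - x) ≤ 2 * N} := by
    intro w hw
    have h3 : nrm w ≤ N := hw
    have h4 := nrm_add_le w (-x)
    rw [nrm_neg, ← sub_eq_add_neg] at h4
    show nrm (w - x) ≤ 2 * N
    omega
  rw [← hbox, Auto.conn, Tr_v, Tr_v] at hau hbv hab
  have hbd : ∀ c w : Vert, nrm c ≤ k → nrm w = 2 * N → conn ω {w | nrm (w - x) ≤ 2 * N} (c + x) (w + x) → toB N (c + x) ω := by
    intro c w hc hw hcw
    have hcN : nrm (c + x) ≤ N := hs (c + x) (by simpa using hc)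
    have hwN : N ≤ nrm (w + x) := by
      have h4 := nrm_add_le (w + x) (-x)
      rw [nrm_neg] at h4; simp only [add_neg_cancel_right] at h4
      omega
    obtain ⟨z, hz, h5, _⟩ := conn_first Lip_nrm0 (k := N) hcN hcw hwN
    exact ⟨z, hz, conn_mono le_rfl inter_subset_right h5⟩
  exact ⟨a + x, b + x, by simpa using ha, by simpa using hb, hbd a u ha hu hau, hbd b v hb hv hbv,
    fun h => hab (conn_mono le_rfl hsub h)⟩
end PartFive

noncomputable section PartSix
open scoped Classical

/-- block centers -/
def ctr (k : ℤ) (i : ℕ × ℕ) : Vert := ((2 * k + 1) * i.1, (2 * k + 1) * i.2)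

theorem unique_arith {M k π ε a b d : ℝ} (hM1 : 1 ≤ M) (hk : 0 ≤ k) (hπ : 0 ≤ π) (ha : 0 < a)
    (hab : a ≤ b) (hd : 0 < d) (hM : 12 * (2 * k + 1) ≤ M * (ε * a * d))
    (hfin : M * M * (b * π) * d ≤ 4 * (2 * ((2 * k + 1) * M) + 1)) : π ≤ ε := by
  have hM0 : 0 < M := by linarith
  have h1 : M * (M * a * d * π) ≤ M * (12 * (2 * k + 1)) := by
    have : M * (M * a * d * π) ≤ M * M * (b * π) * d := by
      calc M * (M * a * d * π) = (M * M * d * π) * a := by ring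
        _ ≤ (M * M * d * π) * b := by gcongr
        _ = _ := by ring
    have h3 : 1 ≤ (2 * k + 1) * M := by nlinarith
    linarith
  have h2 := le_of_mul_le_mul_left h1 hM0
  have h4 : (M * a * d) * π ≤ (M * a * d) * ε := by
    calc (M * a * d) * π ≤ 12 * (2 * k + 1) := h2
      _ ≤ M * (ε * a * d) := hM
      _ = _ := by ring
  exact le_of_mul_le_mul_left h4 (by positivity)

theorem unique_small {q ε : ℝ} (hq : 0 < q) (hq2 : q < 1 / 2) (hε : 0 < ε) {k : ℤ} (hk : 0 ≤ k) :
    ∃ s, q < s ∧ s < 1 / 2 ∧ ∃ R, k < R ∧ Pr s (EF R) (Ekx k R 0) ≤ ε := by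
  set c := (EF k).card
  have hd0 : 0 < 1 / 2 - q := by linarith
  have hkr : (0:ℝ) ≤ k := by exact_mod_cast hk
  obtain ⟨M0, hM0⟩ := exists_nat_gt (12 * (2 * k + 1) / (ε * q ^ c * (1 / 2 - q)))
  set M := M0 + 1
  have hM : 12 * (2 * (k:ℝ) + 1) ≤ M * (ε * q ^ c * (1 / 2 - q)) := by
    rw [div_lt_iff₀ (by positivity)] at hM0
    have : 0 < ε * q ^ c * (1 / 2 - q) := by positivity
    simp only [M]; push_cast; nlinarith
  set N : ℤ := (2 * k + 1) * M with hN
  have hM1 : (1:ℤ) ≤ M := by simp [M]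
  have hNk : 2 * k + 1 ≤ N := by nlinarith
  set f : ℝ → ℝ := fun s => Ex s (EF N) (fun ω => (KK N ω : ℝ)) with hf
  set f' : ℝ → ℝ := fun s => ∑ e ∈ EF N, Ex s (EF N) (fun ω => (KK N (up e true ω) : ℝ) - KK N (up e false ω))
  have hd : ∀ s, HasDerivAt f (f' s) s := fun s => russo (EF N) _ s
  obtain ⟨s, ⟨hs1, hs2⟩, hs3⟩ := exists_hasDerivAt_eq_slope f f' hq2
    (fun s _ => (hd s).continuousAt.continuousWithinAt) (fun s _ => hd s)
  have h0 : 0 ≤ s := by linarith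
  have h1 : s ≤ 1 := by linarith
  refine ⟨s, hs1, hs2, 2 * N, by omega, ?_⟩
  -- total sum
  have hg0 : ∀ e, 0 ≤ Ex s (EF N) (fun ω => (KK N (up e false ω) : ℝ) - KK N (up e true ω)) := fun e =>
    Ex_nonneg h0 h1 _ fun ω => by
      have : (KK N (up e true ω) : ℝ) ≤ KK N (up e false ω) := by
        exact_mod_cast KK_anti ((up_false_le e ω).trans (le_up_true e ω))
      linarith
  have hsum : ∑ e ∈ EF N, Ex s (EF N) (fun ω => (KK N (up e false ω) : ℝ) - KK N (up e true ω)) = - f' s := by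
    simp only [f', ← Finset.sum_neg_distrib]
    refine Finset.sum_congr rfl fun e _ => ?_
    rw [Ex_sub, Ex_sub]; ring
  have hfa : f q ≤ 4 * (2 * N + 1) := by
    have h2 : f q ≤ Ex q (EF N) (fun _ => ((sph N).card : ℝ)) :=
      Ex_mono hq.le (by linarith) _ fun ω => by exact_mod_cast KK_le N ω
    rw [Ex_const] at h2
    have h3 : ((sph N).card : ℝ) ≤ 4 * (2 * N + 1) := by exact_mod_cast sph_card N (by omega)
    linarith
  have hfb : 0 ≤ f (1/2) := Ex_nonneg (by norm_num) (by norm_num) _ fun ω => by positivity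
  have htot : ∑ e ∈ EF N, Ex s (EF N) (fun ω => (KK N (up e false ω) : ℝ) - KK N (up e true ω)) ≤
      4 * (2 * N + 1) / (1 / 2 - q) := by
    rw [hsum, hs3, ← neg_div, div_le_div_iff_of_pos_right hd0]
    linarith
  -- blocks
  set J := Finset.range M ×ˢ Finset.range M
  have hJ : ∀ i ∈ J, (0:ℤ) ≤ i.1 ∧ (i.1:ℤ) ≤ M - 1 ∧ (0:ℤ) ≤ i.2 ∧ (i.2:ℤ) ≤ M - 1 := by
    intro i hi
    simp only [J, Finset.mem_product, Finset.mem_range] at hi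
    omega
  have hbx : ∀ i ∈ J, ∀ v, nrm (v - ctr k i) ≤ k → v ∈ box N := by
    intro i hi v hv
    obtain ⟨a1, a2, a3, a4⟩ := hJ i hi
    rw [nrm_le] at hv
    rw [mem_box]
    simp only [ctr, Prod.fst_sub, Prod.snd_sub] at hv
    have b1 : 0 ≤ (2 * k + 1) * (i.1 : ℤ) := by positivity
    have b2 : 0 ≤ (2 * k + 1) * (i.2 : ℤ) := by positivity
    have b3 : (2 * k + 1) * (i.1 : ℤ) ≤ (2 * k + 1) * (M - 1) := by gcongr
    have b4 : (2 * k + 1) * (i.2 : ℤ) ≤ (2 * k + 1) * (M - 1) := by gcongr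
    have b5 : (2 * k + 1) * ((M:ℤ) - 1) = N - (2 * k + 1) := by rw [hN]; ring
    omega
  have hcx : ∀ i ∈ J, nrm (ctr k i) ≤ N := fun i hi => hbx i hi _ (by simpa [nrm_zero] using hk)
  have hpd : ∀ i ∈ J, ∀ j ∈ J, i ≠ j → Disjoint (blk k (ctr k i)) (blk k (ctr k j)) := by
    intro i _ j _ hij
    rw [Finset.disjoint_left]
    intro e he he'
    rw [mem_blk, nrm_le] at he he'
    simp only [ctr, Prod.fst_sub, Prod.snd_sub] at he he'
    apply hij
    have aux : ∀ a b t : ℤ, -k ≤ t - (2*k+1) * a → t - (2*k+1) * a ≤ k → -k ≤ t - (2*k+1) * b →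
        t - (2*k+1) * b ≤ k → a = b := by
      intro a b t q1 q2 q3 q4
      rcases lt_trichotomy a b with h | h | h
      · have : (2*k+1) * (a + 1) ≤ (2*k+1) * b := by gcongr; omega
        nlinarith
      · exact h
      · have : (2*k+1) * (b + 1) ≤ (2*k+1) * a := by gcongr; omega
        nlinarith
    have r1 := aux i.1 j.1 e.1.1 he.1 he.2.1 he'.1 he'.2.1
    have r2 := aux i.2 j.2 e.1.2 he.2.2.1 he.2.2.2 he'.2.2.1 he'.2.2.2
    exact Prod.ext (by exact_mod_cast r1) (by exact_mod_cast r2)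
  have hblk : ∑ i ∈ J, ∑ e ∈ blk k (ctr k i), Ex s (EF N) (fun ω => (KK N (up e false ω) : ℝ) - KK N (up e true ω)) ≤
      ∑ e ∈ EF N, Ex s (EF N) (fun ω => (KK N (up e false ω) : ℝ) - KK N (up e true ω)) := by
    rw [← Finset.sum_biUnion hpd]
    refine Finset.sum_le_sum_of_subset_of_nonneg ?_ fun e _ _ => hg0 e
    intro e he
    obtain ⟨i, hi, he⟩ := Finset.mem_biUnion.1 he
    exact mem_EF.2 (hbx i hi _ (mem_blk.1 he))
  set π := Pr s (EF (2 * N)) (Ekx k (2 * N) 0)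
  have hlow : ∑ _i ∈ J, s ^ c * π ≤ ∑ i ∈ J, ∑ e ∈ blk k (ctr k i), Ex s (EF N) (fun ω => (KK N (up e false ω) : ℝ) - KK N (up e true ω)) := by
    refine Finset.sum_le_sum fun i hi => le_trans ?_ (Ekx_pr h0 h1 (hbx i hi))
    exact mul_le_mul_of_nonneg_left (Ekx_trans h0 h1 (hcx i hi) (hbx i hi)) (pow_nonneg h0 _)
  rw [Finset.sum_const, Finset.card_product, Finset.card_range, nsmul_eq_mul] at hlow
  have hfin := (hlow.trans hblk).trans htot
  have hπ0 : 0 ≤ π := Pr_nonneg h0 h1 _ _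
  have hqs : q ^ c ≤ s ^ c := pow_le_pow_left₀ hq.le hs1.le c
  rw [le_div_iff₀ hd0] at hfin
  have hMr : (1:ℝ) ≤ M := by exact_mod_cast hM1
  have hNr : (N:ℝ) = (2 * k + 1) * M := by rw [hN]; push_cast; ring
  push_cast at hfin
  rw [hNr] at hfin
  exact unique_arith hMr hkr hπ0 (pow_pos hq c) hqs hd0 hM hfin
end PartSix

noncomputable section PartSeven
open scoped Classical

/-- dual edge map -/
def dl : Edge ≃ Edge where
  toFun e := if e.2 then ((e.1.1, e.1.2 + 1), false) else ((e.1.1 + 1, e.1.2), true)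
  invFun e := if e.2 then ((e.1.1 - 1, e.1.2), false) else ((e.1.1, e.1.2 - 1), true)
  left_inv := by rintro ⟨⟨a, b⟩, c⟩; cases c <;> simp
  right_inv := by rintro ⟨⟨a, b⟩, c⟩; cases c <;> simp
/-- dual configuration -/
def dualC (ω : Config) : Config := pullCfg true dl ω
theorem dualC_v (ω : Config) (i j : ℤ) : dualC ω ((i, j), true) = !ω ((i, j + 1), false) := by
  simp [dualC, pullCfg, dl]
theorem dualC_h (ω : Config) (i j : ℤ) : dualC ω ((i, j), false) = !ω ((i + 1, j), true) := by
  simp [dualC, pullCfg, dl]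

/-- indicator mod 2 -/
def ind (P : Prop) : ZMod 2 := if P then 1 else 0

/-- horizontal rectangle -/
def rc (R : ℤ) : Set Vert := {v | -R ≤ v.1 ∧ v.1 ≤ R + 1 ∧ -R ≤ v.2 ∧ v.2 ≤ R}
/-- vertical rectangle -/
def rc' (R : ℤ) : Set Vert := {v | -R ≤ v.1 ∧ v.1 ≤ R ∧ -R - 1 ≤ v.2 ∧ v.2 ≤ R}
/-- horizontal crossing -/
def LR (R : ℤ) (ω : Config) : Prop := ∃ u v, u ∈ rc R ∧ u.1 = -R ∧ v.1 = R + 1 ∧ conn ω (rc R) u v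
/-- vertical crossing -/
def TB (R : ℤ) (ω : Config) : Prop := ∃ u v, u ∈ rc' R ∧ u.2 = R ∧ v.2 = -R - 1 ∧ conn ω (rc' R) u v

theorem parity {R : ℤ} {ω : Config} {v0 v : Vert} (hc : conn ω (rc R) v0 v) :
    ∃ n : ℤ → ℤ → ZMod 2, (∀ i j, R ≤ j → n i j = 0) ∧
      (∀ i, n i (-R - 1) = ind (v0.1 ≤ i) + ind (v.1 ≤ i)) ∧
      (∀ i j, ω ((i, j), false) = false → n i (j - 1) = n i j) ∧
      (∀ i j, ω ((i, j), true) = false → n (i - 1) j + n i j =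
        ind (v.1 = i ∧ j < v.2) + ind (v0.1 = i ∧ j < v0.2)) := by
  have two : (2 : ZMod 2) = 0 := rfl
  induction hc with
  | refl =>
    refine ⟨fun _ _ => 0, fun _ _ _ => rfl, fun i => ?_, fun _ _ _ => rfl, fun i j _ => ?_⟩
    · linear_combination - two * ind (v0.1 ≤ i)
    · linear_combination - two * ind (v0.1 = i ∧ j < v0.2)
  | @tail v w _ hvw ih =>
    obtain ⟨n, h1, h2, h3, h4⟩ := ih
    obtain ⟨hadj, hv, hw⟩ := hvw
    -- horizontal step
    have hor : ∀ i0 y0 : ℤ, ω ((i0, y0), false) = true → v.2 = y0 → w.2 = y0 →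
        ((v.1 = i0 ∧ w.1 = i0 + 1) ∨ (v.1 = i0 + 1 ∧ w.1 = i0)) →
        ∃ n : ℤ → ℤ → ZMod 2, (∀ i j, R ≤ j → n i j = 0) ∧
      (∀ i, n i (-R - 1) = ind (v0.1 ≤ i) + ind (w.1 ≤ i)) ∧
      (∀ i j, ω ((i, j), false) = false → n i (j - 1) = n i j) ∧
      (∀ i j, ω ((i, j), true) = false → n (i - 1) j + n i j =
        ind (w.1 = i ∧ j < w.2) + ind (v0.1 = i ∧ j < v0.2)) := by
      intro i0 y0 ho hv2 hw2 hx
      obtain ⟨-, -, hv3, hv4⟩ := hv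
      refine ⟨fun i j => n i j + ind (i = i0 ∧ j < y0), ?_, ?_, ?_, ?_⟩
      · intro i j hj
        have : ¬ (i = i0 ∧ j < y0) := by omega
        simp [h1 i j hj, ind, this]
      · intro i
        have key : ind (i = i0 ∧ -R - 1 < y0) = ind (v.1 ≤ i) + ind (w.1 ≤ i) := by
          unfold ind; split_ifs <;> first | (exfalso; omega) | decide
        simp only [h2 i, key]
        linear_combination two * ind (v.1 ≤ i)
      · intro i j hj
        have key : ind (i = i0 ∧ j - 1 < y0) = ind (i = i0 ∧ j < y0) := by
          by_cases hij : i = i0 ∧ j = y0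
          · rw [hij.1, hij.2, ho] at hj; exact absurd hj (by simp)
          · unfold ind; split_ifs <;> first | (exfalso; omega) | rfl
        simp only [h3 i j hj, key]
      · intro i j hj
        have key : ind (i - 1 = i0 ∧ j < y0) + ind (i = i0 ∧ j < y0) =
            ind (v.1 = i ∧ j < v.2) + ind (w.1 = i ∧ j < w.2) := by
          unfold ind; split_ifs <;> first | (exfalso; omega) | decide
        have := h4 i j hj
        simp only
        linear_combination this + key + two * ind (v.1 = i ∧ j < v.2)
    have ver : ∀ i0 y0 : ℤ, ω ((i0, y0), true) = true → v.1 = i0 → w.1 = i0 →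
        ((v.2 = y0 ∧ w.2 = y0 + 1) ∨ (v.2 = y0 + 1 ∧ w.2 = y0)) →
        ∃ n : ℤ → ℤ → ZMod 2, (∀ i j, R ≤ j → n i j = 0) ∧
      (∀ i, n i (-R - 1) = ind (v0.1 ≤ i) + ind (w.1 ≤ i)) ∧
      (∀ i j, ω ((i, j), false) = false → n i (j - 1) = n i j) ∧
      (∀ i j, ω ((i, j), true) = false → n (i - 1) j + n i j =
        ind (w.1 = i ∧ j < w.2) + ind (v0.1 = i ∧ j < v0.2)) := by
      intro i0 y0 ho hv1 hw1 hy
      refine ⟨n, h1, ?_, h3, ?_⟩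
      · intro i; rw [h2 i, hv1, hw1]
      · intro i j hj
        rw [h4 i j hj]
        have key : ind (v.1 = i ∧ j < v.2) = ind (w.1 = i ∧ j < w.2) := by
          by_cases hij : i = i0 ∧ j = y0
          · rw [hij.1, hij.2, ho] at hj; exact absurd hj (by simp)
          · unfold ind; split_ifs <;> first | (exfalso; omega) | rfl
        rw [key]
    rcases openAdj_iff.1 hadj with ⟨ho, h⟩ | ⟨ho, h⟩ | ⟨ho, h⟩ | ⟨ho, h⟩
    · exact hor v.1 v.2 ho rfl (by rw [h]) (Or.inl ⟨rfl, by rw [h]⟩)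
    · exact ver v.1 v.2 ho rfl (by rw [h]) (Or.inl ⟨rfl, by rw [h]⟩)
    · exact hor w.1 w.2 ho (by rw [h]) rfl (Or.inr ⟨by rw [h], rfl⟩)
    · exact ver w.1 w.2 ho (by rw [h]) rfl (Or.inr ⟨by rw [h], rfl⟩)

theorem exclusive {R : ℤ} {ω : Config} (h1 : LR R ω) (h2 : TB R (dualC ω)) : False := by
  obtain ⟨v0, v, hv0, hv01, hv1, hc⟩ := h1
  obtain ⟨n, n1, n2, n3, n4⟩ := parity hc
  obtain ⟨f0, f, hf0, hf02, hf2, hcf⟩ := h2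
  have key : ∀ f, conn (dualC ω) (rc' R) f0 f → n f.1 f.2 = 0 := by
    intro f hf
    induction hf with
    | refl => exact n1 _ _ hf02.ge
    | @tail a b _ hab ih =>
      obtain ⟨hadj, ha, hb⟩ := hab
      have two : (2 : ZMod 2) = 0 := rfl
      have hor : ∀ i j : ℤ, dualC ω ((i, j), false) = true → -R ≤ i → i + 1 ≤ R → n i j = n (i+1) j := by
        intro i j ho hi hi'
        rw [dualC_h] at ho
        have := n4 (i+1) j (by simpa using ho)
        have e1 : ind (v.1 = i + 1 ∧ j < v.2) = 0 := by
          unfold ind; rw [if_neg]; omega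
        have e2 : ind (v0.1 = i + 1 ∧ j < v0.2) = 0 := by
          unfold ind; rw [if_neg]; omega
        rw [e1, e2, add_sub_cancel_right] at this
        linear_combination this - two * n (i+1) j
      have ver : ∀ i j : ℤ, dualC ω ((i, j), true) = true → n i j = n i (j+1) := by
        intro i j ho
        rw [dualC_v] at ho
        have := n3 i (j+1) (by simpa using ho)
        rwa [add_sub_cancel_right] at this
      obtain ⟨a1, a2⟩ := a
      obtain ⟨b1, b2⟩ := b
      simp only [rc', Set.mem_ofPred_eq] at ha hb
      simp only at ih ⊢
      rcases openAdj_iff.1 hadj with ⟨ho, h⟩ | ⟨ho, h⟩ | ⟨ho, h⟩ | ⟨ho, h⟩ <;> simp only [Prod.mk.injEq] at h <;>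
        obtain ⟨rfl, rfl⟩ := h
      · rw [← hor _ _ ho (by omega) (by omega), ih]
      · rw [← ver _ _ ho, ih]
      · rw [hor _ _ ho (by omega) (by omega), ih]
      · rw [ver _ _ ho, ih]
  have h0 := key f hcf
  have hfm := conn_mem hcf hf0
  simp only [rc', Set.mem_ofPred_eq] at hfm
  rw [hf2, n2] at h0
  have e1 : ind (v0.1 ≤ f.1) = 1 := if_pos (by omega)
  have e2 : ind (v.1 ≤ f.1) = 0 := if_neg (by omega)
  rw [e1, e2] at h0
  simp at h0

/-- right arm -/
def AR (k R : ℤ) (ω : Config) : Prop :=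
  ∃ a ∈ box k, ∃ v ∈ box R, v.1 = R ∧ conn ω (box R) a v ∧ ω (v, false) = true
theorem AR_DepOn (k R : ℤ) : DepOn (edgesIn (box (R + 1))) (AR k R) := by
  have hb : box R ⊆ box (R + 1) := box_mono (by omega)
  refine DepOn_exists fun a => DepOn_and (DepOn_const _) (DepOn_exists fun v => ?_)
  by_cases hv : v ∈ box R
  · have hin : (v, false) ∈ edgesIn (box (R + 1)) := by
      refine ⟨hb hv, ?_⟩
      rw [mem_box] at hv ⊢
      simp only [edgeTip, Prod.fst_add, Prod.snd_add, Bool.false_eq_true, if_false]; omega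
    exact DepOn_and (DepOn_const _) (DepOn_and (DepOn_const _) (DepOn_and
      ((conn_DepOn _ _ _).mono (edgesIn_mono hb)) (DepOn_edge hin _)))
  · simp only [hv, false_and]; exact DepOn_const _
theorem AR_mono (k R : ℤ) : ∀ ω ω' : Config, ω ≤ ω' → AR k R ω → AR k R ω' := by
  rintro ω ω' h ⟨a, ha, v, hv, h1, h2, h3⟩
  refine ⟨a, ha, v, hv, h1, conn_mono h subset_rfl h2, ?_⟩
  have := h (v, false)
  rw [h3] at this
  exact top_le_iff.1 this

theorem pullCfg_mono (τ : Edge ≃ Edge) {ω ω' : Config} (h : ω ≤ ω') : pullCfg false τ ω ≤ pullCfg false τ ω' := by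
  intro e
  simpa [pullCfg] using h (τ e)
theorem Auto.edgesIn (τ : Auto) {S : Set Vert} (hS : ∀ v ∈ S, τ.v v ∈ S) : ∀ e ∈ edgesIn S, τ.e e ∈ edgesIn S := by
  rintro e ⟨h1, h2⟩
  rcases τ.compat e with ⟨h3, h4⟩ | ⟨h3, h4⟩
  · exact ⟨h3 ▸ hS _ h1, h4 ▸ hS _ h2⟩
  · exact ⟨h3 ▸ hS _ h2, h4 ▸ hS _ h1⟩
theorem Fl_v (v : Vert) : Fl.v v = (-v.1, v.2) := rfl
theorem Sw_v (v : Vert) : Sw.v v = (v.2, v.1) := rfl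
theorem Fl_box (n : ℤ) (v : Vert) : Fl.v v ∈ box n ↔ v ∈ box n := by
  rw [mem_box, mem_box, Fl_v]; simp only; omega
theorem Sw_box (n : ℤ) (v : Vert) : Sw.v v ∈ box n ↔ v ∈ box n := by
  rw [mem_box, mem_box, Sw_v]; simp only; omega
/-- pull back an event -/
def pb (τ : Auto) (A : Config → Prop) (ω : Config) : Prop := A (pullCfg false τ.e ω)
theorem pb_mono {τ : Auto} {A : Config → Prop} (h : ∀ ω ω' : Config, ω ≤ ω' → A ω → A ω') :
    ∀ ω ω' : Config, ω ≤ ω' → pb τ A ω → pb τ A ω' := fun _ _ hω => h _ _ (pullCfg_mono _ hω)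
theorem pb_DepOn {τ : Auto} {A : Config → Prop} {S : Set Vert} (hS : ∀ v ∈ S, τ.v v ∈ S)
    (h : DepOn (edgesIn S) A) : DepOn (edgesIn S) (pb τ A) := by
  intro ω ω' hω
  apply h
  intro e he
  simp only [pullCfg, hω _ (τ.edgesIn hS e he)]
theorem pb_Pr {τ : Auto} {A : Config → Prop} {n : ℤ} (s : ℝ) (hS : ∀ v ∈ box n, τ.v v ∈ box n)
    (h : DepOn (edgesIn (box n)) A) : Pr s (EF n) (pb τ A) = Pr s (EF n) A :=
  Pr_auto τ s h edgesIn_box_EF (fun e he => edgesIn_box_EF (τ.edgesIn hS e he)) (fun _ => Iff.rfl)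

theorem fkg_anti {s : ℝ} (h0 : 0 ≤ s) (h1 : s ≤ 1) (F : Finset Edge) {p q : Config → Prop}
    (hp : ∀ ω ω' : Config, ω ≤ ω' → p ω → p ω') (hq : ∀ ω ω' : Config, ω ≤ ω' → q ω → q ω') :
    (1 - Pr s F p) * (1 - Pr s F q) ≤ 1 - Pr s F (fun ω => p ω ∨ q ω) := by
  have h := Ex_fkg h0 h1 F (I_monotone hp) (I_monotone hq)
  have e : Pr s F (fun ω => p ω ∨ q ω) = Pr s F p + Pr s F q - Ex s F (fun ω => I p ω * I q ω) := by
    unfold Pr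
    rw [← Ex_add, ← Ex_sub]
    congr 1; funext ω
    unfold I; by_cases hp : p ω <;> by_cases hq : q ω <;> simp [hp, hq]
  rw [e]
  unfold Pr at *
  nlinarith

theorem exit_box {R : ℤ} {ω : Config} {a v : Vert} (ha : nrm a ≤ R) (hc : conn ω (box (R+1)) a v) :
    (conn ω (box R) a v ∧ v ∈ box R) ∨ ∃ b c, conn ω (box R) a b ∧ b ∈ box R ∧ openAdj ω b c ∧ c ∉ box R := by
  induction hc with
  | refl => exact Or.inl ⟨conn_refl _ _ _, ha⟩
  | @tail b c _ hbc ih =>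
    rcases ih with ⟨h1, h2⟩ | h
    · by_cases hcR : c ∈ box R
      · exact Or.inl ⟨h1.tail ⟨hbc.1, h2, hcR⟩, hcR⟩
      · exact Or.inr ⟨b, c, h1, h2, hbc.1, hcR⟩
    · exact Or.inr h

theorem Auto.conn_inv (τ : Auto) {n : ℤ} (hb : ∀ v, τ.v v ∈ box n ↔ v ∈ box n) {ω : Config} {x y : Vert} :
    _root_.conn (pullCfg false τ.e ω) (box n) x y ↔ _root_.conn ω (box n) (τ.v x) (τ.v y) := by
  rw [← Auto.conn]
  have : τ.v ⁻¹' box n = box n := by ext v; exact hb v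
  rw [this]

theorem AL_iff {k R : ℤ} {ω : Config} : pb Fl (AR k R) ω ↔
    ∃ a ∈ box k, ∃ v ∈ box R, v.1 = -R ∧ conn ω (box R) a v ∧ ω ((v.1 - 1, v.2), false) = true := by
  unfold pb AR
  constructor
  · rintro ⟨a, ha, v, hv, h1, h2, h3⟩
    refine ⟨Fl.v a, (Fl_box _ _).2 ha, Fl.v v, (Fl_box _ _).2 hv, by rw [Fl_v]; simp [h1],
      (Fl.conn_inv (Fl_box R)).1 h2, ?_⟩
    simpa [pullCfg, Fl] using h3
  · rintro ⟨a, ha, v, hv, h1, h2, h3⟩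
    refine ⟨Fl.v a, (Fl_box _ _).2 ha, Fl.v v, (Fl_box _ _).2 hv, by rw [Fl_v]; simp [h1],
      (Fl.conn_inv (Fl_box R)).2 ?_, ?_⟩
    · simpa [Fl_v] using h2
    · simpa [pullCfg, Fl] using h3
theorem AT_iff {k R : ℤ} {ω : Config} : pb Sw (AR k R) ω ↔
    ∃ a ∈ box k, ∃ v ∈ box R, v.2 = R ∧ conn ω (box R) a v ∧ ω (v, true) = true := by
  unfold pb AR
  constructor
  · rintro ⟨a, ha, v, hv, h1, h2, h3⟩
    refine ⟨Sw.v a, (Sw_box _ _).2 ha, Sw.v v, (Sw_box _ _).2 hv, by rw [Sw_v]; simp [h1],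
      (Sw.conn_inv (Sw_box R)).1 h2, ?_⟩
    simpa [pullCfg, Sw, Prod.swap] using h3
  · rintro ⟨a, ha, v, hv, h1, h2, h3⟩
    refine ⟨Sw.v a, (Sw_box _ _).2 ha, Sw.v v, (Sw_box _ _).2 hv, by rw [Sw_v]; simp [h1],
      (Sw.conn_inv (Sw_box R)).2 ?_, ?_⟩
    · simpa [Sw_v] using h2
    · simpa [pullCfg, Sw] using h3
theorem AB_iff {k R : ℤ} {ω : Config} : pb Sw (pb Fl (AR k R)) ω ↔
    ∃ a ∈ box k, ∃ v ∈ box R, v.2 = -R ∧ conn ω (box R) a v ∧ ω ((v.1, v.2 - 1), true) = true := by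
  rw [show pb Sw (pb Fl (AR k R)) ω ↔ pb Fl (AR k R) (pullCfg false Sw.e ω) from Iff.rfl, AL_iff]
  constructor
  · rintro ⟨a, ha, v, hv, h1, h2, h3⟩
    refine ⟨Sw.v a, (Sw_box _ _).2 ha, Sw.v v, (Sw_box _ _).2 hv, by rw [Sw_v]; simp [h1],
      (Sw.conn_inv (Sw_box R)).1 h2, ?_⟩
    simpa [pullCfg, Sw] using h3
  · rintro ⟨a, ha, v, hv, h1, h2, h3⟩
    refine ⟨Sw.v a, (Sw_box _ _).2 ha, Sw.v v, (Sw_box _ _).2 hv, by rw [Sw_v]; simp [h1],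
      (Sw.conn_inv (Sw_box R)).2 ?_, ?_⟩
    · simpa [Sw_v] using h2
    · simpa [pullCfg, Sw] using h3

theorem armk_union {k R : ℤ} (hkR : k < R) {ω : Config} (h : armk k (R + 1) ω) :
    (AR k R ω ∨ pb Fl (AR k R) ω) ∨ (pb Sw (AR k R) ω ∨ pb Sw (pb Fl (AR k R)) ω) := by
  obtain ⟨a, ha, v, hv, hc⟩ := h
  have haR : nrm a ≤ R := le_trans ha hkR.le
  rcases exit_box haR hc with ⟨_, h⟩ | ⟨b, c, h1, h2, h3, h4⟩
  · have : nrm v ≤ R := h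
    omega
  · rw [mem_box] at h4
    have h2' := mem_box.1 h2
    rcases openAdj_iff.1 h3 with ⟨ho, h⟩ | ⟨ho, h⟩ | ⟨ho, h⟩ | ⟨ho, h⟩
    · rw [h] at h4; simp only at h4
      exact Or.inl (Or.inl ⟨a, ha, b, h2, by omega, h1, ho⟩)
    · rw [h] at h4; simp only at h4
      exact Or.inr (Or.inl (AT_iff.2 ⟨a, ha, b, h2, by omega, h1, ho⟩))
    · rw [h] at h2'; simp only at h2'
      refine Or.inl (Or.inr (AL_iff.2 ⟨a, ha, b, h2, by rw [h]; simp only; omega, h1, ?_⟩))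
      rw [h]; simpa using ho
    · rw [h] at h2'; simp only at h2'
      refine Or.inr (Or.inr (AB_iff.2 ⟨a, ha, b, h2, by rw [h]; simp only; omega, h1, ?_⟩))
      rw [h]; simpa using ho

theorem cross_of {k R : ℤ} (hkR : k < R) {ω : Config} (h1 : AR k R ω) (h2 : pb Fl (AR k R) ω)
    (h3 : pb Sw (AR k R) ω) (h4 : pb Sw (pb Fl (AR k R)) ω) (hu : ¬ Ekx k R 0 ω) : LR R ω ∧ TB R ω := by
  rw [AL_iff] at h2
  rw [AT_iff] at h3
  rw [AB_iff] at h4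
  obtain ⟨a1, ha1, v1, hv1, e1, c1, o1⟩ := h1
  obtain ⟨a2, ha2, v2, hv2, e2, c2, o2⟩ := h2
  obtain ⟨a3, ha3, v3, hv3, e3, c3, o3⟩ := h3
  obtain ⟨a4, ha4, v4, hv4, e4, c4, o4⟩ := h4
  have huc : ∀ a b v w, a ∈ box k → b ∈ box k → nrm v = R → nrm w = R → conn ω (box R) a v → conn ω (box R) b w →
      conn ω (box R) v w := by
    intro a b v w ha hb hv hw hav hbw
    have : conn ω (box R) a b := by
      by_contra hc
      exact hu ⟨a, b, by simpa [box] using ha, by simpa [box] using hb, ⟨v, hv, hav⟩, ⟨w, hw, hbw⟩, hc⟩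
    exact conn_trans (conn_symm hav) (conn_trans this hbw)
  have hn : ∀ v : Vert, v ∈ box R → (|v.1| = R ∨ |v.2| = R) → nrm v = R := by
    intro v hv h
    have h1 : nrm v ≤ R := hv
    have := le_max_left |v.1| |v.2|
    have := le_max_right |v.1| |v.2|
    unfold nrm at *
    rcases h with h | h <;> omega
  have hR : 0 ≤ R := (nrm_nonneg v1).trans hv1
  have n1 := hn v1 hv1 (Or.inl (by rw [e1, abs_of_nonneg hR]))
  have n2 := hn v2 hv2 (Or.inl (by rw [e2, abs_neg, abs_of_nonneg hR]))
  have n3 := hn v3 hv3 (Or.inr (by rw [e3, abs_of_nonneg hR]))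
  have n4 := hn v4 hv4 (Or.inr (by rw [e4, abs_neg, abs_of_nonneg hR]))
  have hs1 : box R ⊆ rc R := by intro v hv; rw [mem_box] at hv; simp only [rc, Set.mem_ofPred_eq]; omega
  have hs2 : box R ⊆ rc' R := by intro v hv; rw [mem_box] at hv; simp only [rc', Set.mem_ofPred_eq]; omega
  constructor
  · refine ⟨v2, (v1.1 + 1, v1.2), hs1 hv2, e2, by simp [e1], ?_⟩
    refine (conn_mono le_rfl hs1 (huc a2 a1 v2 v1 ha2 ha1 n2 n1 c2 c1)).tail ⟨?_, hs1 hv1, ?_⟩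
    · exact openAdj_iff.2 (Or.inl ⟨o1, rfl⟩)
    · rw [mem_box] at hv1; simp only [rc, Set.mem_ofPred_eq]; omega
  · refine ⟨v3, (v4.1, v4.2 - 1), hs2 hv3, e3, by simp [e4], ?_⟩
    refine (conn_mono le_rfl hs2 (huc a3 a4 v3 v4 ha3 ha4 n3 n4 c3 c4)).tail ⟨?_, hs2 hv4, ?_⟩
    · refine openAdj_iff.2 (Or.inr (Or.inr (Or.inr ⟨o4, by ext <;> simp⟩)))
    · rw [mem_box] at hv4; simp only [rc', Set.mem_ofPred_eq]; omega

theorem rc_box (R : ℤ) : rc R ⊆ box (R + 1) := by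
  intro v hv; rw [mem_box]; simp only [rc, Set.mem_ofPred_eq] at hv; omega
theorem rc'_box (R : ℤ) : rc' R ⊆ box (R + 1) := by
  intro v hv; rw [mem_box]; simp only [rc', Set.mem_ofPred_eq] at hv; omega

theorem no_cross {s : ℝ} (h0 : 0 ≤ s) (h1 : s ≤ 1 / 2) (R : ℤ) :
    Pr s (EF (R + 2)) (fun ω => LR R ω ∧ TB R ω) ≤ 1 / 2 := by
  have hs1 : s ≤ 1 := by linarith
  set F := EF (R + 2)
  set π := Pr s F (fun ω => LR R ω ∧ TB R ω)
  have a1 : π ≤ Pr s F (LR R) := Pr_mono h0 hs1 _ fun ω h => h.1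
  have a2 : π ≤ Pr s F (TB R) := Pr_mono h0 hs1 _ fun ω h => h.2
  have hT : DepOn (edgesIn (rc' R)) (TB R) :=
    DepOn_exists fun _ => DepOn_exists fun _ => DepOn_and (DepOn_const _) (DepOn_and (DepOn_const _)
      (DepOn_and (DepOn_const _) (conn_DepOn _ _ _)))
  have a3 : Pr s F (TB R) ≤ Pr (1 - s) F (TB R) :=
    Pr_mono_s h0 (by linarith) (by linarith) _ (by
      rintro ω ω' h ⟨u, v, hu, hu1, hv1, hc⟩
      exact ⟨u, v, hu, hu1, hv1, conn_mono h subset_rfl hc⟩)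
  have a4 : Pr s F (fun ω => TB R (dualC ω)) = Pr (1 - s) F (TB R) := by
    have := Ex_pullCfg' true dl s (F := F) (G := F) (g := I (TB R)) hT.I
      (edgesIn_box_EF' ((rc'_box R).trans (box_mono (by omega)))) (by
        rintro ⟨⟨i, j⟩, c⟩ ⟨he, _⟩
        simp only [rc', Set.mem_ofPred_eq] at he
        rw [mem_EF, nrm_le]
        cases c <;> simp only [dl, Equiv.coe_fn_mk, Bool.false_eq_true, if_false, if_true] <;> omega)
    simp only [if_true] at this
    exact this
  have a5 : Pr s F (LR R) + Pr s F (fun ω => TB R (dualC ω)) ≤ 1 := by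
    have : Pr s F (fun ω => TB R (dualC ω)) ≤ Pr s F (fun ω => ¬ LR R ω) :=
      Pr_mono h0 hs1 _ fun ω h h' => exclusive h' h
    rw [Pr_not] at this
    linarith
  linarith

theorem phi_lt_one {q : ℝ} (hq : 0 < q) (hq2 : q < 1 / 2) :
    ∃ n : ℤ, ∃ S : Finset Vert, (S : Set Vert) ⊆ box (n - 1) ∧ (0 : Vert) ∈ S ∧ phi q n S < 1 := by
  by_contra hcon
  push Not at hcon
  set q' := (q + 1 / 2) / 2 with hq'
  have hqq' : q < q' := by rw [hq']; linarith
  have hq'2 : q' < 1 / 2 := by rw [hq']; linarith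
  have hθ : 0 < 1 - Real.exp (-(q' - q)) := by
    have : Real.exp (-(q' - q)) < 1 := by
      rw [← Real.exp_zero]; exact Real.exp_lt_exp.2 (by linarith)
    linarith
  obtain ⟨k, hk, hk2⟩ := exists_k (q := q') (δ := (1/16)^4) (by linarith) (by linarith) hθ
    (fun n hn => dct hn hq.le hqq'.le (by linarith) (fun S hS h0 => hcon n S hS h0)) (by norm_num)
  obtain ⟨s, hs1, hs2, R, hkR, hE⟩ := unique_small (q := q') (ε := 1/8) (by linarith) hq'2 (by norm_num) hk
  have h0 : 0 ≤ s := by linarith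
  have h1 : s ≤ 1 := by linarith
  set F := EF (R + 1)
  have harm : 1 - (1/16:ℝ)^4 ≤ Pr s F (armk k (R + 1)) :=
    (hk2 (R+1) (by omega)).trans (Pr_mono_s (by linarith) hs1.le h1 _ fun ω ω' h => armk_mono h k (R+1))
  have m1 := AR_mono k R
  have d1 := AR_DepOn k R
  have m2 := pb_mono (τ := Fl) m1
  have d2 := pb_DepOn (τ := Fl) (fun v hv => (Fl_box (R+1) v).2 hv) d1
  have m3 := pb_mono (τ := Sw) m1
  have d3 := pb_DepOn (τ := Sw) (fun v hv => (Sw_box (R+1) v).2 hv) d1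
  have m4 := pb_mono (τ := Sw) m2
  have d4 := pb_DepOn (τ := Sw) (fun v hv => (Sw_box (R+1) v).2 hv) d2
  have p2 : Pr s F (pb Fl (AR k R)) = Pr s F (AR k R) := pb_Pr s (fun v hv => (Fl_box (R+1) v).2 hv) d1
  have p3 : Pr s F (pb Sw (AR k R)) = Pr s F (AR k R) := pb_Pr s (fun v hv => (Sw_box (R+1) v).2 hv) d1
  have p4 : Pr s F (pb Sw (pb Fl (AR k R))) = Pr s F (AR k R) :=
    (pb_Pr s (fun v hv => (Sw_box (R+1) v).2 hv) d2).trans p2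
  set α := Pr s F (AR k R)
  have hα1 : α ≤ 1 := Pr_le_one h0 h1 _ _
  have f1 := fkg_anti h0 h1 F m1 m2
  have f2 := fkg_anti h0 h1 F m3 m4
  have f3 := fkg_anti h0 h1 F (p := fun ω => AR k R ω ∨ pb Fl (AR k R) ω)
    (q := fun ω => pb Sw (AR k R) ω ∨ pb Sw (pb Fl (AR k R)) ω)
    (fun ω ω' h h' => h'.imp (m1 ω ω' h) (m2 ω ω' h)) (fun ω ω' h h' => h'.imp (m3 ω ω' h) (m4 ω ω' h))
  rw [p2] at f1
  rw [p3, p4] at f2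
  have hun := Pr_mono h0 h1 F (fun ω (h : armk k (R+1) ω) => armk_union hkR h)
  have hpow : (1 - α) ^ 4 ≤ (1/16:ℝ)^4 := by
    have : (1 - α) ^ 4 = ((1 - α) * (1 - α)) * ((1 - α) * (1 - α)) := by ring
    rw [this]
    have hnn : 0 ≤ (1 - α) * (1 - α) := mul_self_nonneg _
    calc _ ≤ _ := mul_le_mul f1 f2 hnn (hnn.trans f1)
      _ ≤ _ := f3
      _ ≤ _ := by linarith
  have hα : 1 - α ≤ 1 / 16 := le_of_pow_le_pow_left₀ (by norm_num) (by norm_num) hpow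
  -- change of F
  set G := EF (R + 2)
  have hsubFG : edgesIn (box (R + 1)) ⊆ (G : Set Edge) := edgesIn_box_EF' (box_mono (by omega))
  have g1 : Pr s G (AR k R) = α := Pr_marg s d1 edgesIn_box_EF hsubFG
  have g2 : Pr s G (pb Fl (AR k R)) = α := (Pr_marg s d2 edgesIn_box_EF hsubFG).trans p2
  have g3 : Pr s G (pb Sw (AR k R)) = α := (Pr_marg s d3 edgesIn_box_EF hsubFG).trans p3
  have g4 : Pr s G (pb Sw (pb Fl (AR k R))) = α := (Pr_marg s d4 edgesIn_box_EF hsubFG).trans p4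
  have g5 : Pr s G (Ekx k R 0) ≤ 1 / 8 := by
    rw [Pr_marg s (Ekx_DepOn k R 0) (F := EF R) edgesIn_box_EF (edgesIn_box_EF' (box_mono (by omega)))]
    exact hE
  have hfin := no_cross h0 hs2.le R
  have hbig : 1 - Pr s G (fun ω => LR R ω ∧ TB R ω) ≤ (1 - α) + (1 - α) + (1 - α) + (1 - α) + 1 / 8 := by
    have e1 := Pr_not s G (AR k R)
    have e2 := Pr_not s G (pb Fl (AR k R))
    have e3 := Pr_not s G (pb Sw (AR k R))
    have e4 := Pr_not s G (pb Sw (pb Fl (AR k R)))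
    rw [← Pr_not]
    refine le_trans (Pr_mono h0 h1 _ (q := fun ω => (((¬ AR k R ω ∨ ¬ pb Fl (AR k R) ω) ∨ ¬ pb Sw (AR k R) ω) ∨
      ¬ pb Sw (pb Fl (AR k R)) ω) ∨ Ekx k R 0 ω) ?_) ?_
    · intro ω h
      by_contra hh
      push Not at hh
      exact h (cross_of hkR hh.1.1.1.1 hh.1.1.1.2 hh.1.1.2 hh.1.2 hh.2)
    · refine (Pr_or_le h0 h1 _ _ _).trans (add_le_add ?_ g5)
      refine (Pr_or_le h0 h1 _ _ _).trans (add_le_add ?_ (by rw [e4, g4]))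
      refine (Pr_or_le h0 h1 _ _ _).trans (add_le_add ?_ (by rw [e3, g3]))
      refine (Pr_or_le h0 h1 _ _ _).trans (add_le_add (by rw [e1, g1]) (by rw [e2, g2]))
  linarith
end PartSeven

noncomputable section PartEight
open scoped Classical

/-- cluster of the origin inside `S` -/
def CC (S : Finset Vert) (ω : Config) : Finset Vert := S.filter fun y => conn ω S 0 y

theorem mem_CC {S : Finset Vert} {ω : Config} {y : Vert} : y ∈ CC S ω ↔ y ∈ S ∧ conn ω S 0 y := by
  simp [CC]

/-- edges of `S` touching `C` -/
def tch (S C : Finset Vert) : Set Edge :=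
  {e | e ∈ edgesIn (S : Set Vert) ∧ (e.1 ∈ C ∨ edgeTip e ∈ C)}

theorem CC_key {S C : Finset Vert} (h0 : (0 : Vert) ∈ S) {ω ω' : Config}
    (h : ∀ e ∈ tch S C, ω e = ω' e) (hC : CC S ω = C) : CC S ω' = C := by
  have h0C : (0 : Vert) ∈ C := by rw [← hC, mem_CC]; exact ⟨h0, conn_refl _ _ _⟩
  have e1 : ∀ y, conn ω S 0 y → conn ω' S 0 y ∧ y ∈ C := by
    intro y hy
    induction hy with
    | refl => exact ⟨conn_refl _ _ _, h0C⟩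
    | @tail b c hb hbc ih =>
      have hcC : c ∈ C := by
        rw [← hC, mem_CC]; exact ⟨hbc.2.2, Relation.ReflTransGen.tail hb hbc⟩
      refine ⟨Relation.ReflTransGen.tail ih.1 ⟨?_, hbc.2⟩, hcC⟩
      obtain ⟨e, ho, he⟩ := hbc.1
      refine ⟨e, ?_, he⟩
      rw [← h e ?_, ho]
      rcases he with ⟨rfl, rfl⟩ | ⟨rfl, rfl⟩
      · exact ⟨⟨hbc.2.1, hbc.2.2⟩, Or.inl ih.2⟩
      · exact ⟨⟨hbc.2.2, hbc.2.1⟩, Or.inl hcC⟩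
  have e2 : ∀ y, conn ω' S 0 y → y ∈ C := by
    intro y hy
    induction hy with
    | refl => exact h0C
    | @tail b c hb hbc ih =>
      have : openAdj ω b c := by
        obtain ⟨e, ho, he⟩ := hbc.1
        refine ⟨e, ?_, he⟩
        rw [h e ?_, ho]
        rcases he with ⟨rfl, rfl⟩ | ⟨rfl, rfl⟩
        · exact ⟨⟨hbc.2.1, hbc.2.2⟩, Or.inl ih⟩
        · exact ⟨⟨hbc.2.2, hbc.2.1⟩, Or.inr ih⟩
      rw [← hC, mem_CC] at ih ⊢
      exact ⟨hbc.2.2, Relation.ReflTransGen.tail ih.2 ⟨this, hbc.2⟩⟩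
  ext y
  constructor
  · intro hy; exact e2 y (mem_CC.1 hy).2
  · intro hy
    rw [← hC] at hy
    exact mem_CC.2 ⟨(mem_CC.1 hy).1, (e1 y (mem_CC.1 hy).2).1⟩

theorem CC_DepOn {S : Finset Vert} (h0 : (0 : Vert) ∈ S) (C : Finset Vert) :
    DepOn (tch S C) (fun ω => CC S ω = C) := fun _ _ h =>
  propext ⟨CC_key h0 h, CC_key h0 fun e he => (h e he).symm⟩

/-- last exit from a set -/
theorem conn_exit {ω : Config} {T C : Set Vert} {x y : Vert} (hx : x ∈ C) (hy : y ∉ C)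
    (h : conn ω T x y) : ∃ a b, a ∈ C ∧ b ∉ C ∧ openAdj ω a b ∧ conn ω (T \ C) b y := by
  induction h with
  | refl => exact absurd hx hy
  | @tail b c hb hbc ih =>
    by_cases hbC : b ∈ C
    · exact ⟨b, c, hbC, hy, hbc.1, conn_refl _ _ _⟩
    · obtain ⟨a, b', h1, h2, h3, h4⟩ := ih hbC
      exact ⟨a, b', h1, h2, h3, h4.tail ⟨hbc.1, ⟨hbc.2.1, hbC⟩, ⟨hbc.2.2, hy⟩⟩⟩

/-- arm from `b` to distance `m` avoiding `C` -/
def armC (C : Set Vert) (m : ℤ) (b : Vert) (ω : Config) : Prop :=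
  ∃ z, nrm (z - b) = m ∧ conn ω ({v | nrm (v - b) ≤ m} \ C) b z

theorem armC_DepOn (C : Set Vert) (m : ℤ) (b : Vert) :
    DepOn (edgesIn ({v | nrm (v - b) ≤ m} \ C)) (armC C m b) :=
  DepOn_exists fun _ => DepOn_and (DepOn_const _) (conn_DepOn _ _ _)

theorem arm_decomp {S : Finset Vert} {L m : ℤ} (hS : (S : Set Vert) ⊆ box (L - 1))
    (h0 : (0 : Vert) ∈ S) (hm : 0 ≤ m) {ω : Config} (h : arm0 (m + L) ω) :
    ∃ e ∈ bd L (S : Set Vert), inn (S : Set Vert) e ∈ CC S ω ∧ ω e = true ∧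
      armC (CC S ω : Set Vert) m (out (S : Set Vert) e) ω := by
  obtain ⟨v, hv, hc⟩ := h
  have h0C : (0 : Vert) ∈ CC S ω := mem_CC.2 ⟨h0, conn_refl _ _ _⟩
  have hvC : v ∉ (CC S ω : Set Vert) := by
    intro hvC
    have := hS (Finset.mem_coe.2 (mem_CC.1 (Finset.mem_coe.1 hvC)).1)
    have : nrm v ≤ L - 1 := this
    omega
  obtain ⟨a, b, ha, hb, hab, hbv⟩ := conn_exit (Finset.mem_coe.2 h0C) hvC hc
  have haS := mem_CC.1 (Finset.mem_coe.1 ha)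
  have hbS : b ∉ S := by
    intro hbS
    exact hb (Finset.mem_coe.2 (mem_CC.2 ⟨hbS, haS.2.tail ⟨hab, haS.1, hbS⟩⟩))
  have haL : nrm a ≤ L - 1 := hS haS.1
  have hbL : nrm b ≤ L := by have := nrm_adj hab; omega
  obtain ⟨e, ho, he⟩ := hab
  have hebd : e ∈ bd L (S : Set Vert) := by
    simp only [bd, Finset.mem_filter, mem_EF]
    rcases he with ⟨rfl, rfl⟩ | ⟨rfl, rfl⟩
    · exact ⟨by omega, Or.inl ⟨haS.1, hbS⟩⟩
    · exact ⟨by omega, Or.inr ⟨hbS, haS.1⟩⟩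
  have hio : inn (S : Set Vert) e = a ∧ out (S : Set Vert) e = b := by
    have hbS' : b ∉ (S : Set Vert) := hbS
    have haS' : a ∈ (S : Set Vert) := haS.1
    rcases he with ⟨rfl, rfl⟩ | ⟨rfl, rfl⟩
    · rw [inn, out, if_pos haS', if_pos haS']; exact ⟨rfl, rfl⟩
    · rw [inn, out, if_neg hbS', if_neg hbS']; exact ⟨rfl, rfl⟩
  refine ⟨e, hebd, ?_, ho, ?_⟩
  · rw [hio.1]; exact ha
  · rw [hio.2]
    have hvb : m ≤ nrm (v - b) := by
      have := nrm_add_le (v - b) b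
      rw [sub_add_cancel] at this
      omega
    obtain ⟨z, hz, h1, _⟩ := conn_first (Lip_nrm b) (k := m) (by simpa [nrm_zero] using hm) hbv hvb
    refine ⟨z, hz, conn_mono le_rfl ?_ h1⟩
    rintro w ⟨⟨_, h⟩, h'⟩
    exact ⟨h', h⟩

theorem armC_le {q : ℝ} (h0 : 0 ≤ q) (h1 : q ≤ 1) (C : Set Vert) {m L : ℤ} {b : Vert}
    (hb : nrm b ≤ L) : Pr q (EF (m + L)) (armC C m b) ≤ Pr q (EF m) (arm0 m) := by
  have e1 : Pr q (EF (m + L)) (armC ∅ m b) = Pr q (EF m) (arm0 m) := by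
    refine Pr_auto (Tr b) q (arm0_DepOn m) edgesIn_box_EF ?_ ?_
    · intro e he
      rw [Tr_e, mem_EF]
      have : nrm e.1 ≤ m := he.1
      have := nrm_add_le e.1 b
      simp only; omega
    · intro ω
      have hpre : (Tr b).v ⁻¹' ({v | nrm (v - b) ≤ m} \ ∅) = box m := by
        ext x; simp [Tr_v, box]
      have key : ∀ x, conn (pullCfg false (Tr b).e ω) (box m) 0 x ↔
          conn ω ({v | nrm (v - b) ≤ m} \ ∅) b (x + b) := by
        intro x
        rw [← hpre, Auto.conn, Tr_v, Tr_v, zero_add]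
      constructor
      · rintro ⟨z, hz, hc⟩
        refine ⟨z - b, hz, ?_⟩
        rw [key, sub_add_cancel]; exact hc
      · rintro ⟨z, hz, hc⟩
        refine ⟨z + b, by simpa using hz, (key z).1 hc⟩
  rw [← e1]
  refine Pr_mono h0 h1 _ ?_
  rintro ω ⟨z, hz, hc⟩
  refine ⟨z, hz, conn_mono le_rfl ?_ hc⟩
  rintro w ⟨h, _⟩; exact ⟨h, by simp⟩

theorem one_step {q : ℝ} (hq0 : 0 ≤ q) (hq1 : q ≤ 1) {S : Finset Vert} {L m : ℤ}
    (hS : (S : Set Vert) ⊆ box (L - 1)) (h0 : (0 : Vert) ∈ S) (hm : 0 ≤ m) :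
    Pr q (EF (m + L)) (arm0 (m + L)) ≤ phi q L (S : Set Vert) * Pr q (EF m) (arm0 m) := by
  set F := EF (m + L)
  set u := Pr q (EF m) (arm0 m)
  have hu : 0 ≤ u := Pr_nonneg hq0 hq1 _ _
  have hL1 : 1 ≤ L := by
    have h : nrm 0 ≤ L - 1 := hS (Finset.mem_coe.2 h0)
    rw [nrm_zero] at h; omega
  have hpt : ∀ ω, I (arm0 (m + L)) ω ≤ ∑ e ∈ bd L (S : Set Vert), ∑ C ∈ S.powerset,
      (if inn (S : Set Vert) e ∈ C then (I (fun ω => CC S ω = C) ω *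
        (I (fun ω => ω e = true) ω * I (armC (C : Set Vert) m (out (S : Set Vert) e)) ω)) else 0) := by
    intro ω
    have hnn : ∀ e ∈ bd L (S : Set Vert), ∀ C ∈ S.powerset, 0 ≤
      (if inn (S : Set Vert) e ∈ C then (I (fun ω => CC S ω = C) ω *
        (I (fun ω => ω e = true) ω * I (armC (C : Set Vert) m (out (S : Set Vert) e)) ω)) else 0) := by
      intro e _ C _
      split_ifs
      · exact mul_nonneg (I_nonneg _ _) (mul_nonneg (I_nonneg _ _) (I_nonneg _ _))
      · exact le_rfl
    by_cases h : arm0 (m + L) ω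
    · obtain ⟨e, he, h1, h2, h3⟩ := arm_decomp hS h0 hm h
      refine le_trans ?_ (Finset.single_le_sum (fun e he => Finset.sum_nonneg (hnn e he)) he)
      refine le_trans ?_ (Finset.single_le_sum (hnn e he) (a := CC S ω)
        (Finset.mem_powerset.2 (Finset.filter_subset _ _)))
      rw [if_pos h1]
      simp [I, h, h2, h3]
    · have : I (arm0 (m + L)) ω = 0 := by simp [I, h]
      rw [this]
      exact Finset.sum_nonneg fun e he => Finset.sum_nonneg (hnn e he)
  have hone : ∀ e ∈ bd L (S : Set Vert), ∀ C ∈ S.powerset, inn (S : Set Vert) e ∈ C →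
      Ex q F (fun ω => I (fun ω => CC S ω = C) ω *
        (I (fun ω => ω e = true) ω * I (armC (C : Set Vert) m (out (S : Set Vert) e)) ω)) ≤
      q * u * Pr q F (fun ω => CC S ω = C) := by
    intro e he C hC hi
    obtain ⟨hs1, hs2, hs3⟩ := bd_spec he
    have heF : e ∈ F := by
      have : nrm e.1 ≤ L := by
        unfold bd at he; simp only [Finset.mem_filter] at he; exact mem_EF.1 he.1
      exact mem_EF.2 (by omega)
    set B := edgesIn ({v | nrm (v - out (S : Set Vert) e) ≤ m} \ (C : Set Vert)) with hB
    have heB : e ∉ B := by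
      rintro ⟨h1, h2⟩
      rcases hs3 with ⟨h3, _⟩ | ⟨_, h3⟩
      · exact h1.2 (by rw [h3]; exact hi)
      · exact h2.2 (by rw [h3]; exact hi)
    have heS : e ∉ edgesIn (S : Set Vert) := by
      rintro ⟨h1, h2⟩
      rcases hs3 with ⟨_, h3⟩ | ⟨h3, _⟩
      · exact hs2 (h3 ▸ h2)
      · exact hs2 (h3 ▸ h1)
    have hd1 : Disjoint ({e} : Set Edge) B := Set.disjoint_singleton_left.2 heB
    have hd2 : Disjoint (tch S C) ({e} ∪ B) := by
      rw [Set.disjoint_left]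
      rintro e' ⟨h1, h2⟩ (h3 | h3)
      · exact heS (by rw [← Set.mem_singleton_iff.1 h3]; exact h1)
      · rcases h2 with h2 | h2
        · exact h3.1.2 h2
        · exact h3.2.2 h2
    have d1 : DepOn ({e} : Set Edge) (I (fun ω => ω e = true)) := (DepOn_edge (Set.mem_singleton e) true).I
    have d2 : DepOn B (I (armC (C : Set Vert) m (out (S : Set Vert) e))) := (armC_DepOn _ _ _).I
    rw [Ex_indep q hd2 F (CC_DepOn h0 C).I
      ((d1.mono Set.subset_union_left).comp₂ (d2.mono Set.subset_union_right) (fun a b => a * b)),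
      Ex_indep q hd1 F d1 d2]
    have e1 : Ex q F (I (fun ω => ω e = true)) = q := Ex_open q heF
    have hnb : nrm (out (S : Set Vert) e) ≤ L := by
      have h4 : nrm (inn (S : Set Vert) e) ≤ L - 1 := hS hs1
      have := nrm_adj (bd_adj he)
      omega
    have e2 : Ex q F (I (armC (C : Set Vert) m (out (S : Set Vert) e))) ≤ u := armC_le hq0 hq1 _ hnb
    have e3 : 0 ≤ Pr q F (fun ω => CC S ω = C) := Pr_nonneg hq0 hq1 _ _
    rw [e1]
    show Pr q F (fun ω => CC S ω = C) * _ ≤ _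
    calc Pr q F (fun ω => CC S ω = C) * (q * Ex q F (I (armC (C : Set Vert) m (out (S : Set Vert) e))))
        ≤ Pr q F (fun ω => CC S ω = C) * (q * u) := by gcongr
      _ = _ := by ring
  have hsum : ∀ e ∈ bd L (S : Set Vert), ∑ C ∈ S.powerset,
      (if inn (S : Set Vert) e ∈ C then Pr q F (fun ω => CC S ω = C) else 0) =
      Pr q (EF L) (fun ω => conn ω (S : Set Vert) 0 (inn (S : Set Vert) e)) := by
    intro e he
    have hm1 : Pr q (EF L) (fun ω => conn ω (S : Set Vert) 0 (inn (S : Set Vert) e)) =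
        Pr q F (fun ω => conn ω (S : Set Vert) 0 (inn (S : Set Vert) e)) :=
      Pr_marg q (conn_DepOn _ _ _) (edgesIn_box_EF' (hS.trans (box_mono (by omega))))
        (edgesIn_box_EF' (hS.trans (box_mono (by omega))))
    rw [hm1]
    have : ∀ ω, I (fun ω => conn ω (S : Set Vert) 0 (inn (S : Set Vert) e)) ω =
        ∑ C ∈ S.powerset, (if inn (S : Set Vert) e ∈ C then I (fun ω => CC S ω = C) ω else 0) := by
      intro ω
      rw [Finset.sum_eq_single_of_mem (CC S ω) (Finset.mem_powerset.2 (Finset.filter_subset _ _))]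
      · have := (bd_spec he).1
        have h5 : inn (S : Set Vert) e ∈ S := this
        simp [I, mem_CC, h5]
      · intro C _ hne
        have : ¬ CC S ω = C := fun h => hne h.symm
        simp [I, this]
    unfold Pr
    rw [show (I fun ω => conn ω (S : Set Vert) 0 (inn (S : Set Vert) e)) = _ from funext this, Ex_sum]
    refine Finset.sum_congr rfl fun C _ => ?_
    split_ifs
    · rfl
    · rw [Ex_const]
  calc Pr q F (arm0 (m + L)) ≤ _ := Ex_mono hq0 hq1 F hpt
    _ = ∑ e ∈ bd L (S : Set Vert), ∑ C ∈ S.powerset, Ex q F (fun ω =>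
      (if inn (S : Set Vert) e ∈ C then (I (fun ω => CC S ω = C) ω *
        (I (fun ω => ω e = true) ω * I (armC (C : Set Vert) m (out (S : Set Vert) e)) ω)) else 0)) := by
        rw [Ex_sum]; exact Finset.sum_congr rfl fun e _ => by rw [Ex_sum]
    _ ≤ ∑ e ∈ bd L (S : Set Vert), ∑ C ∈ S.powerset,
        q * u * (if inn (S : Set Vert) e ∈ C then Pr q F (fun ω => CC S ω = C) else 0) := by
        refine Finset.sum_le_sum fun e he => Finset.sum_le_sum fun C hC => ?_
        split_ifs with hi
        · exact hone e he C hC hi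
        · rw [Ex_const]; simp
    _ = phi q L (S : Set Vert) * u := by
        unfold phi
        simp only [← Finset.mul_sum]
        rw [Finset.sum_congr rfl hsum]; ring

theorem arm0_anti {ω : Config} {m n : ℤ} (hm : 0 ≤ m) (h : m ≤ n) (ha : arm0 n ω) : arm0 m ω := by
  obtain ⟨v, hv, hc⟩ := ha
  obtain ⟨z, hz, h1, _⟩ := conn_first Lip_nrm0 (k := m) (by simpa [nrm_zero] using hm) hc (by omega)
  exact ⟨z, hz, conn_mono le_rfl (fun w hw => hw.2) h1⟩

theorem arm_anti {q : ℝ} (hq0 : 0 ≤ q) (hq1 : q ≤ 1) {m n : ℤ} (hm : 0 ≤ m) (h : m ≤ n) :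
    Pr q (EF n) (arm0 n) ≤ Pr q (EF m) (arm0 m) := by
  rw [← Pr_marg q (arm0_DepOn m) (F := EF m) (G := EF n) edgesIn_box_EF
    (edgesIn_box_EF' (box_mono h))]
  exact Pr_mono hq0 hq1 _ fun ω => arm0_anti hm h

theorem exp_decay {q : ℝ} (hq : 0 < q) (hq2 : q < 1 / 2) :
    ∃ K c : ℝ, 0 < K ∧ 0 < c ∧ ∀ m : ℕ, Pr q (EF m) (arm0 m) ≤ K * Real.exp (-c * m) := by
  obtain ⟨L, S, hS, h0, hphi⟩ := phi_lt_one hq hq2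
  have hq1 : q ≤ 1 := by linarith
  have hL1 : 1 ≤ L := by
    have h : nrm 0 ≤ L - 1 := hS (Finset.mem_coe.2 h0)
    rw [nrm_zero] at h; omega
  obtain ⟨l, rfl⟩ : ∃ l : ℕ, L = l := ⟨L.toNat, by omega⟩
  have hl : 1 ≤ l := by omega
  set ρ := max (phi q l (S : Set Vert)) (1 / 2) with hρ
  have hρ0 : 0 < ρ := lt_of_lt_of_le (by norm_num) (le_max_right _ _)
  have hρ1 : ρ < 1 := max_lt hphi (by norm_num)
  have hk : ∀ k : ℕ, Pr q (EF (k * l : ℕ)) (arm0 (k * l : ℕ)) ≤ ρ ^ k := by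
    intro k
    induction k with
    | zero => simpa using Pr_le_one hq.le hq1 _ _
    | succ k ih =>
      have := one_step hq.le hq1 hS h0 (m := ((k * l : ℕ) : ℤ)) (by positivity)
      have e : (((k + 1) * l : ℕ) : ℤ) = ((k * l : ℕ) : ℤ) + l := by push_cast; ring
      rw [e]
      refine this.trans ?_
      rw [pow_succ, mul_comm]
      have h5 := Pr_nonneg hq.le hq1 (EF (k * l : ℕ)) (arm0 (k * l : ℕ))
      exact mul_le_mul ih (le_max_left _ _) (h5.trans ih |>.trans le_rfl |> fun _ => by
        unfold phi
        exact mul_nonneg hq.le (Finset.sum_nonneg fun e _ => Pr_nonneg hq.le hq1 _ _)) (by positivity)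
  have hlog : Real.log ρ < 0 := Real.log_neg hρ0 hρ1
  have hl' : (0 : ℝ) < l := by positivity
  refine ⟨Real.exp (-Real.log ρ), -Real.log ρ / l, Real.exp_pos _, div_pos (by linarith) hl', fun m => ?_⟩
  have hle : m / l * l ≤ m := Nat.div_mul_le_self m l
  refine (arm_anti hq.le hq1 (m := ((m / l * l : ℕ) : ℤ)) (by positivity) (by exact_mod_cast hle)).trans ?_
  refine (hk _).trans ?_
  rw [← Real.exp_add]
  have : ρ ^ (m / l) = Real.exp ((m / l : ℕ) * Real.log ρ) := by
    rw [Real.exp_nat_mul, Real.exp_log hρ0]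
  rw [this, Real.exp_le_exp]
  have h6 : (m : ℝ) / l ≤ (m / l : ℕ) + 1 := by
    rw [div_le_iff₀ hl']
    have := Nat.lt_div_mul_add (a := m) (b := l) hl
    have h7 : (m : ℝ) ≤ (m / l : ℕ) * l + l := by exact_mod_cast this.le
    linarith
  have h8 : -(-Real.log ρ / l) * m = (m : ℝ) / l * Real.log ρ := by field_simp
  rw [h8]
  nlinarith
end PartEight

noncomputable section PartNine
open scoped Classical

/-- the configuration with all edges open -/
def full : Config := fun _ => true

theorem full_adj (e : Edge) : openAdj full e.1 (edgeTip e) := ⟨e, rfl, Or.inl ⟨rfl, rfl⟩⟩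

theorem potential (R : ℤ) (σ : Edge → ZMod 2)
    (h : ∀ i j : ℤ, -R ≤ i → i + 1 ≤ R → -R ≤ j → j + 1 ≤ R →
      σ ((i, j), false) + σ ((i + 1, j), true) + σ ((i, j + 1), false) + σ ((i, j), true) = 0) :
    ∃ f : Vert → ZMod 2, ∀ e ∈ edgesIn (box R), f (edgeTip e) = f e.1 + σ e := by
  have two : ∀ a : ZMod 2, a + a = 0 := by decide
  let g : ℤ → ℕ → ZMod 2 := fun x k => ∑ i ∈ Finset.range k, σ ((x, -R + i), true)
  let hh : ℕ → ZMod 2 := fun k => ∑ i ∈ Finset.range k, σ ((-R + i, -R), false)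
  refine ⟨fun v => hh (v.1 + R).toNat + g v.1 (v.2 + R).toNat, ?_⟩
  have key : ∀ (x : ℤ) (k : ℕ), -R ≤ x → x + 1 ≤ R → -R + k ≤ R →
      g (x + 1) k = g x k + σ ((x, -R), false) + σ ((x, -R + k), false) := by
    intro x k hx1 hx2 hk
    induction k with
    | zero => simp [g, two]
    | succ k ih =>
      have ih := ih (by push_cast at hk; omega)
      have e1 : g (x + 1) (k + 1) = g (x + 1) k + σ ((x + 1, -R + k), true) := Finset.sum_range_succ _ _
      have e2 : g x (k + 1) = g x k + σ ((x, -R + k), true) := Finset.sum_range_succ _ _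
      have e3 := h x (-R + k) hx1 hx2 (by omega) (by push_cast at hk; omega)
      rw [e1, e2, ih]
      have e4 : (-R + ((k + 1 : ℕ) : ℤ)) = -R + k + 1 := by push_cast; ring
      rw [e4]
      have : ∀ a b c d A B : ZMod 2, a + b + c + d = 0 → A + B + a + b = A + d + B + c := by decide
      exact this _ _ _ _ _ _ e3
  rintro ⟨⟨x, y⟩, b⟩ ⟨h1, h2⟩
  rw [mem_box] at h1 h2
  cases b
  · simp [edgeTip] at h1 h2 ⊢
    have e0 : (x + 1 + R).toNat = (x + R).toNat + 1 := by omega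
    have e1 : hh ((x + R).toNat + 1) = hh (x + R).toNat + σ ((-R + (x + R).toNat, -R), false) :=
      Finset.sum_range_succ _ _
    have e2 : (-R + ((x + R).toNat : ℤ)) = x := by omega
    have e3 := key x (y + R).toNat (by omega) (by omega) (by omega)
    have e4 : (-R + ((y + R).toNat : ℤ)) = y := by omega
    rw [e4] at e3
    rw [e2] at e1
    rw [e0, e1, e3]
    have : ∀ a b c d : ZMod 2, a + b + (c + b + d) = a + c + d := by decide
    exact this _ _ _ _
  · simp [edgeTip] at h1 h2 ⊢
    have e0 : (y + 1 + R).toNat = (y + R).toNat + 1 := by omega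
    have e1 : g x ((y + R).toNat + 1) = g x (y + R).toNat + σ ((x, -R + (y + R).toNat), true) :=
      Finset.sum_range_succ _ _
    have e4 : (-R + ((y + R).toNat : ℤ)) = y := by omega
    rw [e4] at e1
    rw [e0, e1, add_assoc]

/-- edges of the box between `D` and its complement -/
def cutE (R : ℤ) (D : Set Vert) (e : Edge) : Prop :=
  e ∈ edgesIn (box R) ∧ ((e.1 ∈ D ∧ edgeTip e ∉ D) ∨ (e.1 ∉ D ∧ edgeTip e ∈ D))

theorem ind_tip {P Q : Prop} : ind ((P ∧ ¬ Q) ∨ (¬ P ∧ Q)) = ind P + ind Q := by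
  unfold ind
  by_cases hP : P <;> by_cases hQ : Q <;> simp [hP, hQ]
  decide

theorem cut_lemma {R : ℤ} {C D : Set Vert} {ω : Config}
    (hC : ∀ u ∈ C, ∀ v ∈ C, conn full (box R ∩ C) u v)
    (hD : ∀ u ∈ D, ∀ v ∈ D, conn full (box R ∩ D) u v)
    (hCD : ∀ v ∈ C, v ∉ D)
    (hcut : ∀ e, cutE R D e → ω e = false ∧ (e.1 ∈ C ∨ edgeTip e ∈ C))
    {e e' : Edge} (he : cutE R D e) (he' : cutE R D e') :
    conn (dualC ω) univ e.1 e'.1 := by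
  let σ : Edge → ZMod 2 := fun a => if conn (dualC ω) univ e.1 a.1 then ind (cutE R D a) else 0
  have hσ1 : ∀ a, cutE R D a → conn (dualC ω) univ e.1 a.1 → σ a = 1 := by
    intro a h1 h2; simp [σ, h1, h2, ind]
  have hσ0 : ∀ a, ¬ cutE R D a → σ a = 0 := by
    intro a h1; simp [σ, h1, ind]
  have hv : ∀ i j, ω ((i, j + 1), false) = false → openAdj (dualC ω) (i, j) (i, j + 1) := by
    intro i j h
    rw [openAdj_iff]; right; left
    exact ⟨by rw [dualC_v, h]; rfl, rfl⟩
  have hh : ∀ i j, ω ((i + 1, j), true) = false → openAdj (dualC ω) (i, j) (i + 1, j) := by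
    intro i j h
    rw [openAdj_iff]; left
    exact ⟨by rw [dualC_h, h]; rfl, rfl⟩
  obtain ⟨f, hf⟩ := potential R σ (by
    intro i j hi hi' hj hj'
    have r1 : σ ((i, j), false) = if conn (dualC ω) univ e.1 (i, j) then ind (cutE R D ((i, j), false)) else 0 := rfl
    have r2 : σ ((i, j), true) = if conn (dualC ω) univ e.1 (i, j) then ind (cutE R D ((i, j), true)) else 0 := rfl
    have r3 : σ ((i + 1, j), true) = if conn (dualC ω) univ e.1 (i, j) then ind (cutE R D ((i + 1, j), true)) else 0 := by
      by_cases hc : cutE R D ((i + 1, j), true)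
      · have ha := hh i j (hcut _ hc).1
        have : conn (dualC ω) univ e.1 (i + 1, j) ↔ conn (dualC ω) univ e.1 (i, j) :=
          ⟨fun h => h.tail ⟨openAdj_symm ha, trivial, trivial⟩, fun h => h.tail ⟨ha, trivial, trivial⟩⟩
        simp only [σ, this]
      · rw [hσ0 _ hc]; simp [ind, hc]
    have r4 : σ ((i, j + 1), false) = if conn (dualC ω) univ e.1 (i, j) then ind (cutE R D ((i, j + 1), false)) else 0 := by
      by_cases hc : cutE R D ((i, j + 1), false)
      · have ha := hv i j (hcut _ hc).1
        have : conn (dualC ω) univ e.1 (i, j + 1) ↔ conn (dualC ω) univ e.1 (i, j) :=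
          ⟨fun h => h.tail ⟨openAdj_symm ha, trivial, trivial⟩, fun h => h.tail ⟨ha, trivial, trivial⟩⟩
        simp only [σ, this]
      · rw [hσ0 _ hc]; simp [ind, hc]
    rw [r1, r2, r3, r4]
    split_ifs with hface
    · have b00 : ((i, j) : Vert) ∈ box R := mem_box.2 ⟨hi, by simp; omega, hj, by simp; omega⟩
      have b10 : ((i + 1, j) : Vert) ∈ box R := mem_box.2 ⟨by simp; omega, hi', hj, by simp; omega⟩
      have b01 : ((i, j + 1) : Vert) ∈ box R := mem_box.2 ⟨hi, by simp; omega, by simp; omega, hj'⟩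
      have b11 : ((i + 1, j + 1) : Vert) ∈ box R := mem_box.2 ⟨by simp; omega, hi', by simp; omega, hj'⟩
      have c1 : ind (cutE R D ((i, j), false)) = ind ((i, j) ∈ D) + ind ((i + 1, j) ∈ D) := by
        rw [← ind_tip]; simp [cutE, edgesIn, edgeTip, b00, b10]
      have c2 : ind (cutE R D ((i, j), true)) = ind ((i, j) ∈ D) + ind ((i, j + 1) ∈ D) := by
        rw [← ind_tip]; simp [cutE, edgesIn, edgeTip, b00, b01]
      have c3 : ind (cutE R D ((i + 1, j), true)) = ind ((i + 1, j) ∈ D) + ind ((i + 1, j + 1) ∈ D) := by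
        rw [← ind_tip]; simp [cutE, edgesIn, edgeTip, b10, b11]
      have c4 : ind (cutE R D ((i, j + 1), false)) = ind ((i, j + 1) ∈ D) + ind ((i + 1, j + 1) ∈ D) := by
        rw [← ind_tip]; simp [cutE, edgesIn, edgeTip, b01, b11]
      rw [c1, c2, c3, c4]
      have : ∀ a b c d : ZMod 2, a + b + (b + d) + (c + d) + (a + c) = 0 := by decide
      exact this _ _ _ _
    · simp)
  have hconst : ∀ T : Set Vert, (∀ a, a.1 ∈ T → edgeTip a ∈ T → ¬ cutE R D a) →
      ∀ u v, conn full (box R ∩ T) u v → f u = f v := by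
    intro T hT u v huv
    induction huv with
    | refl => rfl
    | @tail b c _ hbc ih =>
      rw [ih]
      obtain ⟨⟨a, _, ha⟩, hb, hc⟩ := hbc
      rcases ha with ⟨rfl, rfl⟩ | ⟨rfl, rfl⟩
      · rw [hf a ⟨hb.1, hc.1⟩, hσ0 a (hT a hb.2 hc.2), add_zero]
      · rw [hf a ⟨hc.1, hb.1⟩, hσ0 a (hT a hc.2 hb.2), add_zero]
  have hCc : ∀ u ∈ C, ∀ v ∈ C, f u = f v := fun u hu v hv =>
    hconst C (fun a h1 h2 h3 => by
      rcases h3.2 with h | h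
      · exact hCD _ h1 h.1
      · exact hCD _ h2 h.2) u v (hC u hu v hv)
  have hDc : ∀ u ∈ D, ∀ v ∈ D, f u = f v := fun u hu v hv =>
    hconst D (fun a h1 h2 h3 => by
      rcases h3.2 with h | h
      · exact h.2 h2
      · exact h.1 h1) u v (hD u hu v hv)
  have hends : ∀ a, cutE R D a → ∃ u ∈ C, ∃ v ∈ D, f u + f v = σ a := by
    intro a ha
    have two : ∀ x y : ZMod 2, x + (x + y) = y := by decide
    have two' : ∀ x y : ZMod 2, x + y + x = y := by decide
    have h1 := hf a ha.1
    have h2 := (hcut a ha).2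
    rcases ha.2 with h | h
    · have : edgeTip a ∈ C := by
        rcases h2 with h2 | h2
        · exact absurd h.1 (hCD _ h2)
        · exact h2
      exact ⟨_, this, _, h.1, by rw [h1, two']⟩
    · have : a.1 ∈ C := by
        rcases h2 with h2 | h2
        · exact h2
        · exact absurd h.2 (hCD _ h2)
      exact ⟨_, this, _, h.2, by rw [h1, two]⟩
  obtain ⟨u, hu, v, hv, huv⟩ := hends e he
  obtain ⟨u', hu', v', hv', huv'⟩ := hends e' he'
  rw [hCc u' hu' u hu, hDc v' hv' v hv, huv, hσ1 e he (conn_refl _ _ _)] at huv'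
  by_contra hcon
  simp [σ, hcon] at huv'

theorem hline (ω' : Config) (hω : ω' = full) (S : Set Vert) (y a : ℤ) (k : ℕ)
    (h : ∀ i : ℤ, a ≤ i → i ≤ a + k → ((i, y) : Vert) ∈ S) : conn ω' S (a, y) (a + k, y) := by
  subst hω
  induction k with
  | zero => simpa using conn_refl _ _ _
  | succ k ih =>
    refine (ih fun i h1 h2 => h i h1 (by push_cast; omega)).tail ⟨?_, h _ (by omega) (by push_cast; omega), h _ (by push_cast; omega) le_rfl⟩
    rw [openAdj_iff]; left
    exact ⟨rfl, by push_cast; ext <;> simp <;> ring⟩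
theorem hline' {S : Set Vert} {y a b : ℤ} (hab : a ≤ b)
    (h : ∀ i : ℤ, a ≤ i → i ≤ b → ((i, y) : Vert) ∈ S) : conn full S (a, y) (b, y) := by
  have := hline full rfl S y a (b - a).toNat (fun i h1 h2 => h i h1 (by omega))
  rwa [show a + ((b - a).toNat : ℤ) = b by omega] at this
theorem vline (S : Set Vert) (x a : ℤ) (k : ℕ)
    (h : ∀ i : ℤ, a ≤ i → i ≤ a + k → ((x, i) : Vert) ∈ S) : conn full S (x, a) (x, a + k) := by
  induction k with
  | zero => simpa using conn_refl _ _ _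
  | succ k ih =>
    refine (ih fun i h1 h2 => h i h1 (by push_cast; omega)).tail ⟨?_, h _ (by omega) (by push_cast; omega), h _ (by push_cast; omega) le_rfl⟩
    rw [openAdj_iff]; right; left
    exact ⟨rfl, by push_cast; ext <;> simp <;> ring⟩
theorem vline' {S : Set Vert} {x a b : ℤ} (hab : a ≤ b)
    (h : ∀ i : ℤ, a ≤ i → i ≤ b → ((x, i) : Vert) ∈ S) : conn full S (x, a) (x, b) := by
  have := vline S x a (b - a).toNat (fun i h1 h2 => h i h1 (by omega))
  rwa [show a + ((b - a).toNat : ℤ) = b by omega] at this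

theorem nrm_eq {v : Vert} {r : ℤ} : nrm v = r ↔ (-r ≤ v.1 ∧ v.1 ≤ r ∧ -r ≤ v.2 ∧ v.2 ≤ r) ∧
    (v.1 = r ∨ v.1 = -r ∨ v.2 = r ∨ v.2 = -r) := by
  rw [← nrm_le]
  constructor
  · intro h
    refine ⟨h.le, ?_⟩
    unfold nrm at h
    rcases max_choice |v.1| |v.2| with h' | h' <;> rw [h'] at h <;>
      rcases abs_choice (v.1) with h3 | h3 <;> rcases abs_choice (v.2) with h4 | h4 <;> omega
  · rintro ⟨h, h'⟩
    refine le_antisymm h ?_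
    unfold nrm
    have h1 := le_abs_self v.1
    have h2 := neg_abs_le v.1
    have h3 := le_abs_self v.2
    have h4 := neg_abs_le v.2
    rcases h' with h' | h' | h' | h'
    · exact le_max_of_le_left (by omega)
    · exact le_max_of_le_left (by omega)
    · exact le_max_of_le_right (by omega)
    · exact le_max_of_le_right (by omega)

theorem ring_conn {r : ℤ} (hr : 0 ≤ r) {u v : Vert} (hu : nrm u = r) (hv : nrm v = r) :
    conn full {w | nrm w = r} u v := by
  have key : ∀ u : Vert, nrm u = r → conn full {w | nrm w = r} u (r, r) := by
    rintro ⟨x, y⟩ hu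
    have h0 := nrm_eq.1 hu
    simp only at h0
    obtain ⟨⟨h1, h2, h3, h4⟩, h5⟩ := h0
    have right : ∀ y, -r ≤ y → y ≤ r → conn full {w | nrm w = r} (r, y) (r, r) := fun y h1 h2 =>
      vline' h2 fun i h3 h4 => nrm_eq.2 ⟨by simp; omega, by simp⟩
    have top : ∀ x, -r ≤ x → x ≤ r → conn full {w | nrm w = r} (x, r) (r, r) := fun y h1 h2 =>
      hline' h2 fun i h3 h4 => nrm_eq.2 ⟨by simp; omega, by simp⟩
    rcases h5 with rfl | rfl | rfl | rfl
    · exact right _ h3 h4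
    · exact conn_trans (vline' h4 fun i h3 h4 => nrm_eq.2 ⟨by simp; omega, by simp⟩)
        (top _ (by omega) (by omega))
    · exact top _ h1 h2
    · exact conn_trans (hline' h2 fun i h3 h4 => nrm_eq.2 ⟨by simp; omega, by simp⟩)
        (right _ (by omega) (by omega))
  exact conn_trans (key u hu) (conn_symm (key v hv))
end PartNine

noncomputable section PartTen
open scoped Classical

/-- all dual clusters are small -/
def good (m n : ℤ) (ω : Config) : Prop :=
  ∀ z v, conn (dualC ω) univ z v → nrm (v - z) < m + max (nrm z - n) 0

theorem conn_self {ω : Config} {T : Set Vert} {x v : Vert} (h : conn ω T x v) :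
    conn ω (T ∩ {w | conn ω T x w}) x v := by
  induction h with
  | refl => exact conn_refl _ _ _
  | @tail b c hb hbc ih =>
    exact ih.tail ⟨hbc.1, ⟨hbc.2.1, hb⟩, ⟨hbc.2.2, Relation.ReflTransGen.tail hb hbc⟩⟩

theorem conn_cross {ω : Config} {T D : Set Vert} {x y : Vert} (h : conn ω T x y) (hx : x ∉ D)
    (hy : y ∈ D) : ∃ a b, a ∈ T ∧ b ∈ T ∧ a ∉ D ∧ b ∈ D ∧ openAdj ω a b := by
  induction h with
  | refl => exact absurd hy hx
  | @tail b c hb hbc ih =>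
    by_cases hbD : b ∈ D
    · exact ih hbD
    · exact ⟨b, c, hbc.2.1, hbc.2.2, hbD, hy, hbc.1⟩

theorem le_full (ω : Config) : ω ≤ full := fun _ => le_top

/-- the outer region -/
def reg (ω : Config) (R : ℤ) (x d : Vert) : Set Vert :=
  {v | conn full (box R \ {w | conn ω (box R) x w}) d v}

theorem reg_sub {ω : Config} {R : ℤ} {x d : Vert} (hd : d ∈ box R) (hxd : ¬ conn ω (box R) x d)
    {v : Vert} (hv : v ∈ reg ω R x d) : v ∈ box R ∧ ¬ conn ω (box R) x v :=
  conn_mem hv (show d ∈ box R \ {w | conn ω (box R) x w} from ⟨hd, hxd⟩)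

theorem cutC {ω : Config} {R : ℤ} {x d : Vert} (hd : d ∈ box R)
    (hxd : ¬ conn ω (box R) x d) {e e' : Edge} (he : cutE R (reg ω R x d) e)
    (he' : cutE R (reg ω R x d) e') : conn (dualC ω) univ e.1 e'.1 := by
  refine cut_lemma (C := {w | conn ω (box R) x w}) ?_ ?_ ?_ ?_ he he'
  · intro u hu v hv
    exact conn_mono (le_full ω) subset_rfl (conn_trans (conn_symm (conn_self hu)) (conn_self hv))
  · intro u hu v hv
    refine conn_mono le_rfl ?_ (conn_trans (conn_symm (conn_self hu)) (conn_self hv))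
    exact fun w hw => ⟨hw.1.1, hw.2⟩
  · intro v hv hv'
    exact (reg_sub hd hxd hv').2 hv
  · have key : ∀ a u w, ((a : Edge).1 = u ∧ edgeTip a = w ∨ a.1 = w ∧ edgeTip a = u) →
        u ∈ reg ω R x d → w ∈ box R → w ∉ reg ω R x d → ω a = false ∧ conn ω (box R) x w := by
      intro a u w ha hu hw hwD
      have huu := reg_sub hd hxd hu
      have hwC : conn ω (box R) x w := by
        by_contra hcon
        exact hwD (Relation.ReflTransGen.tail hu ⟨⟨a, rfl, ha⟩, huu, ⟨hw, hcon⟩⟩)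
      refine ⟨?_, hwC⟩
      by_contra hcon
      have ho : ω a = true := by simpa using hcon
      exact huu.2 (hwC.tail ⟨⟨a, ho, ha.symm⟩, hw, huu.1⟩)
    rintro a ⟨⟨h1, h2⟩, ⟨h3, h4⟩ | ⟨h3, h4⟩⟩
    · have := key a _ _ (Or.inl ⟨rfl, rfl⟩) h3 h2 h4
      exact ⟨this.1, Or.inr this.2⟩
    · have := key a _ _ (Or.inr ⟨rfl, rfl⟩) h4 h1 h3
      exact ⟨this.1, Or.inl this.2⟩

theorem cluster_conn {ω : Config} {x y : Vert} : y ∈ cluster ω x ↔ conn ω univ x y := by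
  unfold cluster conn
  simp

theorem box_finite (R : ℤ) : (box R).Finite := by
  refine (boxF R).finite_toSet.subset fun v hv => ?_
  exact Finset.mem_coe.2 (mem_boxF.2 hv)

theorem Cinf_ring {ω : Config} {x : Vert} {r : ℤ} (hx : x ∈ Cinf ω) (hr : nrm x ≤ r) :
    ∃ z, nrm z = r ∧ conn ω (box r) x z := by
  have : ¬ cluster ω x ⊆ box r := fun h => hx ((box_finite r).subset h)
  obtain ⟨v, hv, hvr⟩ := Set.not_subset.1 this
  have hvr' : ¬ nrm v ≤ r := hvr
  obtain ⟨z, hz, h1, _⟩ := conn_first Lip_nrm0 hr (cluster_conn.1 hv) (by omega)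
  exact ⟨z, hz, conn_mono le_rfl (fun w hw => hw.2) h1⟩

theorem good_conn {m n : ℤ} {ω : Config} (hg : good m n ω) (hmn : 2 * m ≤ n) {x y : Vert}
    (hx : x ∈ Cinf ω) (hy : y ∈ Cinf ω) (hxn : 2 * nrm x ≤ n) (hyn : 2 * nrm y ≤ n) :
    conn ω (box n) x y := by
  by_contra hcon
  have hx0 := nrm_nonneg x
  have hy0 := nrm_nonneg y
  have hyb : y ∈ box n := by show nrm y ≤ n; omega
  have key : ∀ r, nrm x ≤ r → nrm y ≤ r → r ≤ n → ∃ e : Edge, nrm e.1 = r ∧ cutE n (reg ω n x y) e := by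
    intro r h1 h2 h3
    obtain ⟨z, hz, hxz⟩ := Cinf_ring hx h1
    obtain ⟨w, hw, hyw⟩ := Cinf_ring hy h2
    have hz' : z ∉ reg ω n x y := fun h => (reg_sub hyb hcon h).2 (conn_mono le_rfl (box_mono h3) hxz)
    have hw' : w ∈ reg ω n x y := by
      refine conn_mono (le_full ω) ?_ (conn_self (conn_mono le_rfl (box_mono h3) hyw))
      rintro u ⟨hu1, hu2⟩
      exact ⟨hu1, fun hu3 => hcon (conn_trans hu3 (conn_symm hu2))⟩
    obtain ⟨a, b, ha, hb, haD, hbD, e, _, he⟩ := conn_cross (ring_conn (by omega) hz hw) hz' hw'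
    have ha' : nrm a = r := ha
    have hb' : nrm b = r := hb
    have han : a ∈ box n := by show nrm a ≤ n; omega
    have hbn : b ∈ box n := by show nrm b ≤ n; omega
    refine ⟨e, ?_, ?_⟩
    · rcases he with ⟨h, _⟩ | ⟨h, _⟩ <;> rw [h] <;> assumption
    · rcases he with ⟨rfl, rfl⟩ | ⟨rfl, rfl⟩
      · exact ⟨⟨han, hbn⟩, Or.inr ⟨haD, hbD⟩⟩
      · exact ⟨⟨hbn, han⟩, Or.inl ⟨hbD, haD⟩⟩
  obtain ⟨e, he, hec⟩ := key (n / 2) (by omega) (by omega) (by omega)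
  obtain ⟨e', he', hec'⟩ := key n (by omega) (by omega) (by omega)
  have h1 := hg _ _ (cutC hyb hcon hec' hec)
  rw [he'] at h1
  have h2 := nrm_add_le (e'.1 - e.1) e.1
  rw [sub_add_cancel, he, he', ← nrm_neg, neg_sub] at h2
  simp at h1
  omega

theorem nrm_bds (w : Vert) : w.1 ≤ nrm w ∧ -w.1 ≤ nrm w ∧ w.2 ≤ nrm w ∧ -w.2 ≤ nrm w := by
  have := nrm_le.1 (le_refl (nrm w))
  omega

theorem good_inf {m n : ℤ} {ω : Config} (hg : good m n ω) (hm : 0 ≤ m) (hmn : 2 * m ≤ n) {x z : Vert}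
    (hxn : 2 * nrm x ≤ n) (hz : nrm (z - x) = m) (hxz : conn ω univ x z) : x ∈ Cinf ω := by
  by_contra hfin
  have hfin : (cluster ω x).Finite := Set.not_infinite.1 hfin
  obtain ⟨M, hM⟩ := (hfin.image nrm).bddAbove
  have hcl : ∀ w, conn ω univ x w → nrm w ≤ M := fun w hw =>
    hM (Set.mem_image_of_mem _ (cluster_conn.2 hw))
  set R := M + 1 with hR
  have hxM : nrm x ≤ M := hcl x (conn_refl _ _ _)
  have hx0 := nrm_nonneg x
  set C : Set Vert := {w | conn ω (box R) x w} with hC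
  have hCM : ∀ w ∈ C, nrm w ≤ M := fun w hw => hcl w (conn_mono le_rfl (Set.subset_univ _) hw)
  have hCfin : C.Finite := hfin.subset fun w hw => cluster_conn.2 (conn_mono le_rfl (Set.subset_univ _) hw)
  have hxC : x ∈ C := conn_refl _ _ _
  have hzC : z ∈ C := by
    refine conn_mono le_rfl ?_ (conn_self hxz)
    rintro w ⟨_, hw⟩
    show nrm w ≤ R
    have := hcl w hw
    omega
  set d : Vert := (R, R) with hd
  have hdn : nrm d = R := by rw [nrm_eq]; simp [hd]; omega
  have hdb : d ∈ box R := hdn.le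
  have hxd : ¬ conn ω (box R) x d := fun h => by have := hCM d h; omega
  set D := reg ω R x d with hD
  have hring : ∀ w, nrm w = R → w ∈ D := by
    intro w hw
    refine conn_mono le_rfl ?_ (ring_conn (by omega) hdn hw)
    intro u hu
    have hu' : nrm u = R := hu
    exact ⟨hu'.le, fun hu2 => by have := hCM u hu2; omega⟩
  have hDC : ∀ w ∈ C, w ∉ D := fun w hw h => (reg_sub hdb hxd h).2 hw
  have hcb : ∀ a b : ℤ, ((a, b) : Vert) ∈ C → -M ≤ a ∧ a ≤ M ∧ -M ≤ b ∧ b ≤ M := fun a b h =>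
    nrm_le.1 (hCM _ h)
  have hbR : ∀ a b : ℤ, -R ≤ a → a ≤ R → -R ≤ b → b ≤ R → ((a, b) : Vert) ∈ box R :=
    fun a b h1 h2 h3 h4 => mem_box.2 ⟨h1, h2, h3, h4⟩
  have HR : ∀ a b : ℤ, ((a, b) : Vert) ∈ C → (∀ i, a < i → ((i, b) : Vert) ∉ C) →
      cutE R D ((a, b), false) := by
    intro a b h h'
    have hb := hcb a b h
    have hin : ((a + 1, b) : Vert) ∈ D := by
      refine conn_trans (hring (R, b) (nrm_eq.2 ⟨by simp; omega, by simp⟩)) (conn_symm ?_)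
      exact hline' (by omega) fun i h1 h2 => ⟨hbR _ _ (by omega) (by omega) (by omega) (by omega), h' i (by omega)⟩
    refine ⟨⟨hbR _ _ (by omega) (by omega) (by omega) (by omega), ?_⟩, Or.inr ⟨hDC _ h, ?_⟩⟩
    · simpa [edgeTip] using (reg_sub hdb hxd hin).1
    · simpa [edgeTip] using hin
  have HL : ∀ a b : ℤ, ((a, b) : Vert) ∈ C → (∀ i, i < a → ((i, b) : Vert) ∉ C) →
      cutE R D ((a - 1, b), false) := by
    intro a b h h'
    have hb := hcb a b h
    have hin : ((a - 1, b) : Vert) ∈ D := by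
      refine conn_trans (hring (-R, b) (nrm_eq.2 ⟨by simp; omega, by simp⟩)) ?_
      exact hline' (by omega) fun i h1 h2 => ⟨hbR _ _ (by omega) (by omega) (by omega) (by omega), h' i (by omega)⟩
    refine ⟨⟨(reg_sub hdb hxd hin).1, ?_⟩, Or.inl ⟨hin, ?_⟩⟩
    · simpa [edgeTip] using hbR a b (by omega) (by omega) (by omega) (by omega)
    · simpa [edgeTip] using hDC _ h
  have HT : ∀ a b : ℤ, ((a, b) : Vert) ∈ C → (∀ i, b < i → ((a, i) : Vert) ∉ C) →
      cutE R D ((a, b), true) := by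
    intro a b h h'
    have hb := hcb a b h
    have hin : ((a, b + 1) : Vert) ∈ D := by
      refine conn_trans (hring (a, R) (nrm_eq.2 ⟨by simp; omega, by simp⟩)) (conn_symm ?_)
      exact vline' (by omega) fun i h1 h2 => ⟨hbR _ _ (by omega) (by omega) (by omega) (by omega), h' i (by omega)⟩
    refine ⟨⟨hbR _ _ (by omega) (by omega) (by omega) (by omega), ?_⟩, Or.inr ⟨hDC _ h, ?_⟩⟩
    · simpa [edgeTip] using (reg_sub hdb hxd hin).1
    · simpa [edgeTip] using hin
  have HB : ∀ a b : ℤ, ((a, b) : Vert) ∈ C → (∀ i, i < b → ((a, i) : Vert) ∉ C) →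
      cutE R D ((a, b - 1), true) := by
    intro a b h h'
    have hb := hcb a b h
    have hin : ((a, b - 1) : Vert) ∈ D := by
      refine conn_trans (hring (a, -R) (nrm_eq.2 ⟨by simp; omega, by simp⟩)) ?_
      exact vline' (by omega) fun i h1 h2 => ⟨hbR _ _ (by omega) (by omega) (by omega) (by omega), h' i (by omega)⟩
    refine ⟨⟨(reg_sub hdb hxd hin).1, ?_⟩, Or.inl ⟨hin, ?_⟩⟩
    · simpa [edgeTip] using hbR a b (by omega) (by omega) (by omega) (by omega)
    · simpa [edgeTip] using hDC _ h
  have hdist : ∀ e e', cutE R D e → cutE R D e' →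
      nrm (e'.1 - e.1) < m + max (nrm e.1 - n) 0 := fun e e' h h' => hg _ _ (cutC hdb hxd h h')
  obtain ⟨eR, heR, hR1, hR2⟩ : ∃ e : Edge, cutE R D e ∧ x.1 ≤ e.1.1 ∧ e.1.2 = x.2 := by
    obtain ⟨w, ⟨hwC, hw2⟩, hmax⟩ := Set.exists_max_image (C ∩ {w | w.2 = x.2}) (fun w => w.1)
      (hCfin.subset Set.inter_subset_left) ⟨x, hxC, rfl⟩
    have hw2 : w.2 = x.2 := hw2
    refine ⟨_, HR w.1 w.2 hwC fun i hi hiC => ?_, hmax x ⟨hxC, rfl⟩, hw2⟩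
    have := hmax (i, w.2) ⟨hiC, hw2⟩
    simp at this; omega
  obtain ⟨eL, heL, hL1, hL2⟩ : ∃ e : Edge, cutE R D e ∧ e.1.1 ≤ x.1 ∧ e.1.2 = x.2 := by
    obtain ⟨w, ⟨hwC, hw2⟩, hmax⟩ := Set.exists_min_image (C ∩ {w | w.2 = x.2}) (fun w => w.1)
      (hCfin.subset Set.inter_subset_left) ⟨x, hxC, rfl⟩
    have hw2 : w.2 = x.2 := hw2
    have := hmax x ⟨hxC, rfl⟩
    refine ⟨_, HL w.1 w.2 hwC fun i hi hiC => ?_, by simp; omega, hw2⟩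
    have := hmax (i, w.2) ⟨hiC, hw2⟩
    simp at this; omega
  have hx4 := nrm_bds x
  have hbound : ∀ e, cutE R D e → nrm e.1 ≤ n := by
    intro e he
    by_contra hcon
    have d1 := hdist e eR he heR
    have d2 := hdist e eL he heL
    have b1 := nrm_bds (eR.1 - e.1)
    have b2 := nrm_bds (eL.1 - e.1)
    simp only [Prod.fst_sub, Prod.snd_sub] at b1 b2
    have b3 := (nrm_eq.1 (rfl : nrm e.1 = nrm e.1)).2
    rw [max_eq_left (by omega)] at d1 d2
    omega
  have hdist' : ∀ e e', cutE R D e → cutE R D e' → nrm (e'.1 - e.1) < m := by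
    intro e e' h h'
    have := hdist e e' h h'
    have h3 := hbound e h
    rw [max_eq_right (by omega)] at this
    omega
  have hzx := (nrm_eq.1 hz).2
  simp only [Prod.fst_sub, Prod.snd_sub] at hzx
  obtain ⟨w1, hw1C, hw1⟩ := Set.exists_max_image C (fun w => w.1) hCfin ⟨x, hxC⟩
  obtain ⟨w2, hw2C, hw2⟩ := Set.exists_min_image C (fun w => w.1) hCfin ⟨x, hxC⟩
  obtain ⟨w3, hw3C, hw3⟩ := Set.exists_max_image C (fun w => w.2) hCfin ⟨x, hxC⟩
  obtain ⟨w4, hw4C, hw4⟩ := Set.exists_min_image C (fun w => w.2) hCfin ⟨x, hxC⟩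
  have c1 := HR w1.1 w1.2 hw1C fun i hi hiC => by have := hw1 _ hiC; simp at this; omega
  have c2 := HL w2.1 w2.2 hw2C fun i hi hiC => by have := hw2 _ hiC; simp at this; omega
  have c3 := HT w3.1 w3.2 hw3C fun i hi hiC => by have := hw3 _ hiC; simp at this; omega
  have c4 := HB w4.1 w4.2 hw4C fun i hi hiC => by have := hw4 _ hiC; simp at this; omega
  have d1 := hdist' _ _ c1 c2
  have d2 := hdist' _ _ c3 c4
  have b1 := nrm_bds (((w2.1 - 1, w2.2) : Vert) - (w1.1, w1.2))
  have b2 := nrm_bds (((w4.1, w4.2 - 1) : Vert) - (w3.1, w3.2))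
  simp only [Prod.fst_sub, Prod.snd_sub] at b1 b2 d1 d2
  have k1 := hw1 x hxC
  have k2 := hw1 z hzC
  have k3 := hw2 x hxC
  have k4 := hw2 z hzC
  have k5 := hw3 x hxC
  have k6 := hw3 z hzC
  have k7 := hw4 x hxC
  have k8 := hw4 z hzC
  omega
end PartTen

noncomputable section PartEleven
open scoped Classical

theorem latBox_eq (n : ℕ) : latBox n = box (n : ℤ) := by
  ext v; simp [latBox, box, nrm]
theorem Ctilde_finite (ω : Config) (n : ℕ) : (Ctilde ω n).Finite :=
  (box_finite n).subset (by rw [← latBox_eq]; exact Set.inter_subset_right)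
theorem compIn_sub (ω : Config) (n : ℕ) (x : Vert) : compIn ω n x ⊆ Ctilde ω n := Set.inter_subset_right
theorem giant_sub (ω : Config) (n : ℕ) : giant ω n ⊆ Ctilde ω n := compIn_sub _ _ _

theorem giant_max {ω : Config} {n : ℕ} {x : Vert} (hx : x ∈ Ctilde ω n) :
    (compIn ω n x).ncard ≤ (giant ω n).ncard := by
  obtain ⟨y, hy, hmax⟩ := Set.exists_max_image (Ctilde ω n) (fun y => (compIn ω n y).ncard)
    (Ctilde_finite ω n) ⟨x, hx⟩
  have := Classical.epsilon_spec (p := fun x => x ∈ Ctilde ω n ∧ ∀ y ∈ Ctilde ω n,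
    (compIn ω n y).ncard ≤ (compIn ω n x).ncard) ⟨y, hy, hmax⟩
  exact this.2 x hx

theorem Cinf_conn {ω : Config} {x y : Vert} (hx : x ∈ Cinf ω) (h : conn ω univ x y) : y ∈ Cinf ω := by
  have : cluster ω x ⊆ cluster ω y := fun w hw =>
    cluster_conn.2 (conn_trans (conn_symm h) (cluster_conn.1 hw))
  exact Set.Infinite.mono this hx

theorem compIn_conn {ω : Config} {n : ℕ} {x y : Vert} (hx : x ∈ Cinf ω) (hxn : x ∈ box (n : ℤ))
    (h : conn ω (box n) x y) : y ∈ compIn ω n x := by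
  have hin : ∀ w, conn ω (box n) x w → w ∈ Ctilde ω n := fun w hw =>
    ⟨Cinf_conn hx (conn_mono le_rfl (Set.subset_univ _) hw), by rw [latBox_eq]; exact conn_mem hw hxn⟩
  refine ⟨?_, hin y h⟩
  show Relation.ReflTransGen (adjIn ω n) x y
  induction h with
  | refl => exact Relation.ReflTransGen.refl
  | @tail b c hb hbc ih => exact ih.tail ⟨hbc.1, hin b hb, hin c (Relation.ReflTransGen.tail hb hbc)⟩

theorem giant_large {ω : Config} {m : ℤ} {n : ℕ} (hg : good m n ω) (hm : 0 ≤ m) (hmn : 2 * m ≤ n)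
    (W : Finset Vert) (hW : ∀ x ∈ W, 2 * nrm x ≤ n ∧ ∃ z, nrm (z - x) = m ∧ conn ω univ x z) :
    W.card ≤ (giant ω n).ncard := by
  rcases W.eq_empty_or_nonempty with rfl | ⟨x, hx⟩
  · simp
  have hinf : ∀ y ∈ W, y ∈ Cinf ω := fun y hy => by
    obtain ⟨h1, z, h2, h3⟩ := hW y hy
    exact good_inf hg hm hmn h1 h2 h3
  have hxn : x ∈ box (n : ℤ) := by
    have := (hW x hx).1
    have := nrm_nonneg x
    show nrm x ≤ n
    omega
  have hsub : (W : Set Vert) ⊆ compIn ω n x := fun y hy =>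
    compIn_conn (hinf x hx) hxn (good_conn hg hmn (hinf x hx) (hinf y hy) (hW x hx).1 (hW y hy).1)
  calc W.card = (W : Set Vert).ncard := (Set.ncard_coe_finset W).symm
    _ ≤ (compIn ω n x).ncard := Set.ncard_le_ncard hsub ((Ctilde_finite ω n).subset (compIn_sub _ _ _))
    _ ≤ _ := giant_max ⟨hinf x hx, by rw [latBox_eq]; exact hxn⟩

theorem cheeger_le {ω : Config} {G : Set Vert} {n : ℕ} (hG : G ⊆ box (n : ℤ))
    (hbig : 4 * (2 * n + 1) ≤ G.ncard) :
    cheeger ω G ≤ 4 * (2 * n + 1) / (G.ncard : ℝ) := by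
  have hGf : G.Finite := (box_finite n).subset hG
  set g := G.ncard with hg
  let H : ℤ → Set Vert := fun t => {v | v ∈ G ∧ v.1 ≤ t}
  have hHG : ∀ t, H t ⊆ G := fun t v hv => hv.1
  have hHf : ∀ t, (H t).Finite := fun t => hGf.subset (hHG t)
  have hcolcard : ∀ t : ℤ, (((Finset.Icc (-(n : ℤ)) n).image fun j => ((t, j) : Vert)) : Set Vert).ncard ≤ 2 * n + 1 := by
    intro t
    rw [Set.ncard_coe_finset]
    refine Finset.card_image_le.trans ?_
    simp; omega
  have hcol : ∀ t : ℤ, (H (t + 1)).ncard ≤ (H t).ncard + (2 * n + 1) := by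
    intro t
    have : H (t + 1) ⊆ H t ∪ (((Finset.Icc (-(n : ℤ)) n).image fun j => ((t + 1, j) : Vert)) : Set Vert) := by
      rintro ⟨a, b⟩ ⟨h1, h2⟩
      have hb := mem_box.1 (hG h1)
      simp only at h2 hb
      by_cases h : a ≤ t
      · exact Or.inl ⟨h1, h⟩
      · right
        have ha : a = t + 1 := by omega
        simp [ha]; omega
    calc (H (t + 1)).ncard ≤ _ := Set.ncard_le_ncard this ((hHf t).union (Finset.finite_toSet _))
      _ ≤ _ := Set.ncard_union_le _ _
      _ ≤ _ := Nat.add_le_add_left (hcolcard (t + 1)) _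
  have hex : ∃ k : ℕ, g < 2 * (H (-(n : ℤ) - 1 + k)).ncard := by
    refine ⟨2 * n + 1, ?_⟩
    have : H (-(n : ℤ) - 1 + (2 * n + 1 : ℕ)) = G := by
      ext v
      refine ⟨fun h => h.1, fun h => ⟨h, ?_⟩⟩
      have := mem_box.1 (hG h)
      push_cast; omega
    rw [this]; omega
  set k := Nat.find hex with hk
  have hk1 : g < 2 * (H (-(n : ℤ) - 1 + k)).ncard := Nat.find_spec hex
  have hk0 : k ≠ 0 := by
    intro h0
    rw [h0] at hk1
    have : H (-(n : ℤ) - 1 + (0 : ℕ)) = ∅ := by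
      ext v
      refine ⟨fun h => ?_, fun h => absurd h (Set.notMem_empty v)⟩
      have h2 : v.1 ≤ -(n : ℤ) - 1 + (0 : ℕ) := h.2
      have := mem_box.1 (hG h.1)
      push_cast at h2; omega
    rw [this] at hk1
    simp at hk1
  obtain ⟨j, hj⟩ := Nat.exists_eq_succ_of_ne_zero hk0
  have hj1 : ¬ g < 2 * (H (-(n : ℤ) - 1 + j)).ncard := Nat.find_min hex (by omega)
  set t : ℤ := -(n : ℤ) - 1 + j with ht
  have hkt : -(n : ℤ) - 1 + (k : ℤ) = t + 1 := by rw [hj]; push_cast; omega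
  rw [hkt] at hk1
  have h2 := hcol t
  have hlow : g < 4 * (H t).ncard := by omega
  have hbd : (edgeBdry ω G (H t)).ncard ≤ 2 * n + 1 := by
    have hsub : edgeBdry ω G (H t) ⊆
        (((Finset.Icc (-(n : ℤ)) n).image fun j => (((t, j), false) : Edge)) : Set Edge) := by
      rintro ⟨⟨a, b⟩, c⟩ ⟨_, h1, h2, h3⟩
      have hb := mem_box.1 (hG h1)
      have k1 : ((a, b) : Vert) ∈ H t ↔ a ≤ t := ⟨fun h => h.2, fun h => ⟨h1, h⟩⟩
      have k2 : edgeTip ((a, b), c) ∈ H t ↔ (edgeTip ((a, b), c)).1 ≤ t := ⟨fun h => h.2, fun h => ⟨h2, h⟩⟩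
      simp only at h3
      rw [k1, k2] at h3
      cases c
      · simp [edgeTip] at h3 hb ⊢
        omega
      · simp [edgeTip] at h3
        omega
    refine (Set.ncard_le_ncard hsub (Finset.finite_toSet _)).trans ?_
    rw [Set.ncard_coe_finset]
    refine Finset.card_image_le.trans ?_
    simp; omega
  have hpos : 0 < (H t).ncard := by omega
  have hle : cheeger ω G ≤ ((edgeBdry ω G (H t)).ncard : ℝ) / ((H t).ncard : ℝ) := by
    refine csInf_le ⟨0, ?_⟩ ⟨H t, hHG t, hpos, by omega, rfl⟩
    rintro r ⟨_, _, _, _, rfl⟩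
    positivity
  refine hle.trans ?_
  have hposR : (0 : ℝ) < (H t).ncard := by exact_mod_cast hpos
  have hgpos : (0 : ℝ) < g := by exact_mod_cast (by omega : 0 < g)
  rw [div_le_div_iff₀ hposR hgpos]
  have a1 : ((edgeBdry ω G (H t)).ncard : ℝ) ≤ 2 * n + 1 := by exact_mod_cast hbd
  have a2 : (g : ℝ) ≤ 4 * (H t).ncard := by exact_mod_cast hlow.le
  calc ((edgeBdry ω G (H t)).ncard : ℝ) * g ≤ (2 * n + 1) * (4 * (H t).ncard) :=
        mul_le_mul a1 a2 hgpos.le (by positivity)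
    _ = _ := by ring

theorem Phi_le {ω : Config} {n : ℕ} {κ : ℝ} (hκ : 0 < κ) (hn : 1 ≤ n) (hn12 : 12 ≤ κ * n)
    (hbig : κ * (n : ℝ) ^ 2 ≤ (giant ω n).ncard) : Phi ω n ≤ (12 / κ) / n := by
  have hn' : (1 : ℝ) ≤ n := by exact_mod_cast hn
  have hsub : giant ω n ⊆ box (n : ℤ) := (giant_sub ω n).trans (by
    rw [← latBox_eq]; exact Set.inter_subset_right)
  have h1 : (4 * (2 * (n : ℝ) + 1)) ≤ (giant ω n).ncard := by nlinarith
  have h2 : 4 * (2 * n + 1) ≤ (giant ω n).ncard := by exact_mod_cast h1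
  refine (cheeger_le hsub h2).trans ?_
  rw [div_div]
  calc 4 * (2 * (n : ℝ) + 1) / (giant ω n).ncard ≤ (12 * n) / (κ * (n : ℝ) ^ 2) := by
        apply div_le_div₀ (by positivity) (by linarith) (by positivity) hbig
    _ = _ := by field_simp

theorem Phi_empty {ω : Config} {n : ℕ} (h : Cinf ω = ∅) : Phi ω n = 0 := by
  have : giant ω n = ∅ := by
    have := giant_sub ω n
    rw [Ctilde, h, Set.empty_inter] at this
    exact Set.subset_empty_iff.1 this
  unfold Phi cheeger
  rw [this]
  convert Real.sInf_empty
  ext r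
  simp only [Set.mem_ofPred_eq, Set.mem_empty_iff_false, iff_false]
  rintro ⟨H, h1, h2, _⟩
  rw [Set.subset_empty_iff.1 h1] at h2
  simp at h2
end PartEleven

noncomputable section PartTwelve
open scoped Classical

theorem armC_eq (q : ℝ) {m L : ℤ} {b : Vert} (hb : nrm b + m ≤ L) :
    Pr q (EF L) (armC ∅ m b) = Pr q (EF m) (arm0 m) := by
  refine Pr_auto (Tr b) q (arm0_DepOn m) edgesIn_box_EF ?_ ?_
  · intro e he
    rw [Tr_e, mem_EF]
    have : nrm e.1 ≤ m := he.1
    have := nrm_add_le e.1 b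
    simp only; omega
  · intro ω
    have hpre : (Tr b).v ⁻¹' ({v | nrm (v - b) ≤ m} \ ∅) = box m := by
      ext x; simp [Tr_v, box]
    have key : ∀ x, conn (pullCfg false (Tr b).e ω) (box m) 0 x ↔
        conn ω ({v | nrm (v - b) ≤ m} \ ∅) b (x + b) := by
      intro x
      rw [← hpre, Auto.conn, Tr_v, Tr_v, zero_add]
    constructor
    · rintro ⟨z, hz, hc⟩
      refine ⟨z - b, hz, ?_⟩
      rw [key, sub_add_cancel]; exact hc
    · rintro ⟨z, hz, hc⟩
      refine ⟨z + b, by simpa using hz, (key z).1 hc⟩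

theorem ballE_sub {m L : ℤ} {b : Vert} (hb : nrm b + m ≤ L) :
    edgesIn ({v | nrm (v - b) ≤ m} \ ∅) ⊆ (EF L : Set Edge) := by
  rintro e ⟨⟨h1, _⟩, _⟩
  have h1 : nrm (e.1 - b) ≤ m := h1
  have := nrm_add_le (e.1 - b) b
  rw [sub_add_cancel] at this
  exact Finset.mem_coe.2 (mem_EF.2 (by omega))

theorem arm_of_far {ω : Config} {m : ℤ} (hm : 0 ≤ m) {x v : Vert} (h : conn ω univ x v)
    (hv : m ≤ nrm (v - x)) : armC ∅ m x ω := by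
  obtain ⟨z, hz, h1, _⟩ := conn_first (Lip_nrm x) (k := m) (by simpa [nrm_zero] using hm) h hv
  refine ⟨z, hz, conn_mono le_rfl ?_ h1⟩
  rintro w ⟨_, hw⟩
  exact ⟨hw, fun h => h⟩

theorem P_arm {P : Measure Config} {p : ℝ} (h0 : 0 ≤ p) (h1 : p ≤ 1) (hP : IsBernoulli P p)
    (m : ℤ) (b : Vert) : P {ω | armC ∅ m b ω} ≤ ENNReal.ofReal (Pr p (EF m) (arm0 m)) := by
  rw [← armC_eq p (b := b) le_rfl]
  exact P_le h0 h1 hP ((armC_DepOn ∅ m b).mono (ballE_sub le_rfl))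

theorem P_dual_arm {P : Measure Config} {p : ℝ} (h0 : 0 ≤ p) (h1 : p ≤ 1) (hP : IsBernoulli P p)
    (m : ℤ) (b : Vert) : P {ω | armC ∅ m b (dualC ω)} ≤ ENNReal.ofReal (Pr (1 - p) (EF m) (arm0 m)) := by
  set F := EF (nrm b + m)
  have hG : ∀ e ∈ edgesIn ({v | nrm (v - b) ≤ m} \ ∅), dl e ∈ F.map dl.toEmbedding := by
    intro e he
    rw [Finset.mem_map_equiv, Equiv.symm_apply_apply]
    exact ballE_sub le_rfl he
  have e1 : Pr p (F.map dl.toEmbedding) (fun ω => armC ∅ m b (dualC ω)) = Pr (1 - p) F (armC ∅ m b) := by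
    have := Ex_pullCfg' true dl p (armC_DepOn ∅ m b).I (ballE_sub le_rfl) hG
    exact this
  rw [← armC_eq (1 - p) (b := b) le_rfl, ← e1]
  refine P_le h0 h1 hP ?_
  intro ω ω' h
  refine armC_DepOn ∅ m b _ _ fun e he => ?_
  have := h _ (Finset.mem_coe.2 (hG e he))
  simp [dualC, pullCfg, this]

theorem Cinf_null {P : Measure Config} {p : ℝ} (h0 : 0 ≤ p) (h1 : p ≤ 1) (hP : IsBernoulli P p)
    (h : ∀ ε > 0, ∃ m : ℕ, Pr p (EF m) (arm0 m) < ε) : P {ω | Cinf ω ≠ ∅} = 0 := by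
  have hx : ∀ x, P {ω | x ∈ Cinf ω} = 0 := by
    intro x
    refine nonpos_iff_eq_zero.1 (ENNReal.le_of_forall_pos_le_add fun ε hε _ => ?_)
    obtain ⟨m, hm⟩ := h ε (by exact_mod_cast hε)
    rw [zero_add]
    refine (measure_mono ?_).trans ((P_arm h0 h1 hP m x).trans ?_)
    · intro ω hω
      have hω : (cluster ω x).Infinite := hω
      have : ¬ cluster ω x ⊆ box (m + nrm x) := fun h => hω ((box_finite _).subset h)
      obtain ⟨v, hv, hvr⟩ := Set.not_subset.1 this
      have hvr : ¬ nrm v ≤ m + nrm x := hvr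
      have h3 := nrm_add_le (v - x) x
      rw [sub_add_cancel] at h3
      exact arm_of_far (by positivity) (cluster_conn.1 hv) (by omega)
    · rw [← ENNReal.ofReal_coe_nnreal]
      exact ENNReal.ofReal_le_ofReal hm.le
  have : {ω | Cinf ω ≠ ∅} ⊆ ⋃ x, {ω | x ∈ Cinf ω} := by
    intro ω hω
    obtain ⟨x, hx⟩ := Set.nonempty_iff_ne_empty.2 hω
    exact Set.mem_iUnion.2 ⟨x, hx⟩
  exact measure_mono_null this (measure_iUnion_null hx)

theorem summable_int : Summable (fun i : ℤ => 1 / (1 + |(i : ℝ)|) ^ 2) := by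
  have s1 : Summable (fun i : ℤ => 1 / (i : ℝ) ^ 2) := Real.summable_one_div_int_pow.2 (by norm_num)
  have s2 : Summable (fun i : ℤ => if i = 0 then (1 : ℝ) else 0) :=
    summable_of_hasFiniteSupport ((Set.finite_singleton (0 : ℤ)).subset (by
      intro i hi; by_contra h; simp at h; simp [h] at hi))
  refine Summable.of_nonneg_of_le (fun i => by positivity) (fun i => ?_) (s1.add s2)
  by_cases hi : i = 0
  · simp [hi]
  · simp only [hi, if_false, add_zero]
    have : (i : ℝ) ≠ 0 := by exact_mod_cast hi
    have h2 : (0 : ℝ) < (i : ℝ) ^ 2 := by positivity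
    apply one_div_le_one_div_of_le h2
    rw [← sq_abs]
    have := abs_nonneg (i : ℝ)
    nlinarith

theorem exp_poly {c : ℝ} (hc : 0 < c) : ∃ K : ℝ, 0 < K ∧ ∀ s : ℝ, 0 ≤ s →
    Real.exp (-c * s) ≤ K * (1 / (1 + s) ^ 4) := by
  refine ⟨Real.exp c * (24 / c ^ 4), by positivity, fun s hs => ?_⟩
  have h1 := Real.pow_div_factorial_le_exp (c * (1 + s)) (by positivity) 4
  have h2 : Real.exp (-c * s) = Real.exp c * (Real.exp (c * (1 + s)))⁻¹ := by
    rw [← Real.exp_neg, ← Real.exp_add]; congr 1; ring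
  rw [h2, mul_assoc]
  gcongr
  have h3 : (c * (1 + s)) ^ 4 / ((Nat.factorial 4 : ℕ) : ℝ) = c ^ 4 * (1 + s) ^ 4 / 24 := by
    simp [Nat.factorial]; ring
  rw [h3] at h1
  calc (Real.exp (c * (1 + s)))⁻¹ ≤ (c ^ 4 * (1 + s) ^ 4 / 24)⁻¹ := by
        apply inv_anti₀ (by positivity) h1
    _ = _ := by field_simp

theorem good_prob {P : Measure Config} {p : ℝ} (hp : 1 / 2 < p) (hp1 : p < 1) (hP : IsBernoulli P p) :
    ∃ K c : ℝ, 0 < K ∧ 0 < c ∧ ∀ m n : ℕ,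
      P {ω | ¬ good m n ω} ≤ ENNReal.ofReal (K * (1 + n) ^ 4 * Real.exp (-c * m)) := by
  obtain ⟨K1, c, hK1, hc, hdec⟩ := exp_decay (q := 1 - p) (by linarith) (by linarith)
  obtain ⟨K2, hK2, hpoly⟩ := exp_poly hc
  have hsum : Summable (fun z : ℤ × ℤ => (1 / (1 + |(z.1 : ℝ)|) ^ 2) * (1 / (1 + |(z.2 : ℝ)|) ^ 2)) :=
    summable_int.mul_of_nonneg summable_int (fun i => by positivity) (fun i => by positivity)
  set Z := ∑' z : ℤ × ℤ, (1 / (1 + |(z.1 : ℝ)|) ^ 2) * (1 / (1 + |(z.2 : ℝ)|) ^ 2) with hZ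
  have hZ0 : 0 ≤ Z := tsum_nonneg fun z => by positivity
  refine ⟨K1 * K2 * (Z + 1), c, by positivity, hc, fun m n => ?_⟩
  let s : ℤ × ℤ → ℕ := fun z => (nrm z - n).toNat
  have hs : ∀ z, ((s z : ℕ) : ℤ) = max (nrm z - n) 0 := fun z => Int.toNat_eq_max _
  have hsub : {ω | ¬ good m n ω} ⊆ ⋃ z : ℤ × ℤ, {ω | armC ∅ ((m + s z : ℕ) : ℤ) z (dualC ω)} := by
    intro ω hω
    have hω : ¬ good m n ω := hω
    unfold good at hω
    push Not at hω
    obtain ⟨z, v, h1, h2⟩ := hω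
    refine Set.mem_iUnion.2 ⟨z, arm_of_far (by positivity) h1 ?_⟩
    push_cast
    rw [hs]; exact h2
  have hterm : ∀ z : ℤ × ℤ, K1 * Real.exp (-c * ((m + s z : ℕ) : ℝ)) ≤
      (K1 * K2 * (1 + n) ^ 4 * Real.exp (-c * m)) *
        ((1 / (1 + |(z.1 : ℝ)|) ^ 2) * (1 / (1 + |(z.2 : ℝ)|) ^ 2)) := by
    intro z
    have h1 := hpoly (s z) (by positivity)
    have h2 : Real.exp (-c * ((m + s z : ℕ) : ℝ)) = Real.exp (-c * m) * Real.exp (-c * s z) := by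
      rw [← Real.exp_add]; congr 1; push_cast; ring
    have b := nrm_le.1 (show nrm z ≤ n + s z by rw [hs]; have := le_max_left (nrm z - n) 0; omega)
    have b1 : |(z.1 : ℝ)| ≤ n + s z := by
      rw [abs_le]; constructor
      · have := b.1; exact_mod_cast (by omega : -((n : ℤ) + s z) ≤ z.1)
      · exact_mod_cast b.2.1
    have b2 : |(z.2 : ℝ)| ≤ n + s z := by
      rw [abs_le]; constructor
      · have := b.2.2.1; exact_mod_cast (by omega : -((n : ℤ) + s z) ≤ z.2)
      · exact_mod_cast b.2.2.2
    have hn0 : (0 : ℝ) ≤ n := by positivity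
    have hs0 : (0 : ℝ) ≤ s z := by positivity
    have d1 : 1 + |(z.1 : ℝ)| ≤ (1 + n) * (1 + s z) := by nlinarith
    have d2 : 1 + |(z.2 : ℝ)| ≤ (1 + n) * (1 + s z) := by nlinarith
    have d3 : (1 + |(z.1 : ℝ)|) ^ 2 * (1 + |(z.2 : ℝ)|) ^ 2 ≤ (1 + (n : ℝ)) ^ 4 * (1 + s z) ^ 4 := by
      calc (1 + |(z.1 : ℝ)|) ^ 2 * (1 + |(z.2 : ℝ)|) ^ 2
          ≤ ((1 + (n : ℝ)) * (1 + s z)) ^ 2 * ((1 + n) * (1 + s z)) ^ 2 := by gcongr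
        _ = _ := by ring
    have d4 : 1 / (1 + (s z : ℝ)) ^ 4 ≤ (1 + n) ^ 4 *
        ((1 / (1 + |(z.1 : ℝ)|) ^ 2) * (1 / (1 + |(z.2 : ℝ)|) ^ 2)) := by
      rw [one_div_mul_one_div, mul_one_div, div_le_div_iff₀ (by positivity) (by positivity)]
      linarith
    rw [h2]
    calc K1 * (Real.exp (-c * m) * Real.exp (-c * s z))
        ≤ K1 * (Real.exp (-c * m) * (K2 * ((1 + n) ^ 4 *
        ((1 / (1 + |(z.1 : ℝ)|) ^ 2) * (1 / (1 + |(z.2 : ℝ)|) ^ 2))))) := by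
          gcongr
          exact h1.trans (by gcongr)
      _ = _ := by ring
  calc P {ω | ¬ good m n ω} ≤ _ := measure_mono hsub
    _ ≤ ∑' z : ℤ × ℤ, P {ω | armC ∅ ((m + s z : ℕ) : ℤ) z (dualC ω)} := measure_iUnion_le _
    _ ≤ ∑' z : ℤ × ℤ, ENNReal.ofReal ((K1 * K2 * (1 + n) ^ 4 * Real.exp (-c * m)) *
        ((1 / (1 + |(z.1 : ℝ)|) ^ 2) * (1 / (1 + |(z.2 : ℝ)|) ^ 2))) := by
        refine ENNReal.tsum_le_tsum fun z => ?_
        refine (P_dual_arm (by linarith) hp1.le hP _ z).trans (ENNReal.ofReal_le_ofReal ?_)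
        exact (hdec _).trans (hterm z)
    _ = ENNReal.ofReal ((K1 * K2 * (1 + n) ^ 4 * Real.exp (-c * m)) * Z) := by
        rw [← ENNReal.ofReal_tsum_of_nonneg (fun z => by positivity) (hsum.mul_left _), tsum_mul_left]
    _ ≤ _ := by
        apply ENNReal.ofReal_le_ofReal
        have : 0 ≤ K1 * K2 * (1 + (n : ℝ)) ^ 4 * Real.exp (-c * m) := by positivity
        nlinarith

/-- few arms on a sublattice -/
def Bad (θ : ℝ) (m M : ℕ) (r : Vert) (ω : Config) : Prop :=
  ∑ i ∈ Finset.range M ×ˢ Finset.range M,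
    I (armC ∅ m (r + ((2 * m + 1 : ℤ) * i.1, (2 * m + 1 : ℤ) * i.2))) ω ≤ θ / 4 * (M : ℝ) ^ 2

theorem Bad_prob {P : Measure Config} {p θ : ℝ} (h0 : 0 ≤ p) (h1 : p ≤ 1) (hP : IsBernoulli P p)
    (m M : ℕ) (hθ : θ ≤ Pr p (EF m) (arm0 m)) (r : Vert) :
    P {ω | Bad θ m M r ω} ≤ ENNReal.ofReal (Real.exp (-(θ / 4 * (M : ℝ) ^ 2))) := by
  set J := Finset.range M ×ˢ Finset.range M with hJ
  let x : ℕ × ℕ → Vert := fun i => r + ((2 * m + 1 : ℤ) * i.1, (2 * m + 1 : ℤ) * i.2)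
  obtain ⟨L, hL⟩ : ∃ L : ℤ, ∀ i ∈ J, nrm (x i) + m ≤ L := by
    obtain ⟨L, hL⟩ := (J.finite_toSet.image fun i => nrm (x i) + m).bddAbove
    exact ⟨L, fun i hi => hL (Set.mem_image_of_mem _ (Finset.mem_coe.2 hi))⟩
  let X : ℕ × ℕ → Config → ℝ := fun i => I (armC ∅ m (x i))
  let A : ℕ × ℕ → Set Edge := fun i => edgesIn ({v | nrm (v - x i) ≤ m} \ ∅)
  have hX : ∀ i, DepOn (A i) (X i) := fun i => (armC_DepOn _ _ _).I
  have hdep : DepOn (EF L : Set Edge) (Bad θ m M r) := by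
    intro ω ω' h
    have : ∑ i ∈ J, X i ω = ∑ i ∈ J, X i ω' :=
      Finset.sum_congr rfl fun i hi => ((hX i).mono (ballE_sub (hL i hi))) ω ω' h
    show (∑ i ∈ J, X i ω ≤ _) = (∑ i ∈ J, X i ω' ≤ _)
    rw [this]
  refine (P_le h0 h1 hP hdep).trans (ENNReal.ofReal_le_ofReal ?_)
  set a := θ / 4 * (M : ℝ) ^ 2
  have hX01 : ∀ i ω, X i ω = 0 ∨ X i ω = 1 := by
    intro i ω; simp only [X, I]; split_ifs <;> simp
  have he1 : Real.exp (-1) ≤ 1 / 2 := by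
    have := Real.exp_one_gt_d9
    rw [Real.exp_neg, one_div]
    apply inv_anti₀ (by norm_num); linarith
  have hpt : ∀ ω, I (Bad θ m M r) ω ≤ Real.exp a * ∏ i ∈ J, (1 - 1 / 2 * X i ω) := by
    intro ω
    have hnn : ∀ i, Real.exp (- X i ω) ≤ 1 - 1 / 2 * X i ω := by
      intro i
      rcases hX01 i ω with h | h <;> rw [h]
      · simp
      · linarith
    have hprod : Real.exp (-∑ i ∈ J, X i ω) ≤ ∏ i ∈ J, (1 - 1 / 2 * X i ω) := by
      rw [← Finset.sum_neg_distrib, Real.exp_sum]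
      exact Finset.prod_le_prod (fun i _ => (Real.exp_pos _).le) fun i _ => hnn i
    unfold I
    split_ifs with hb
    · have hb : ∑ i ∈ J, X i ω ≤ a := hb
      calc (1 : ℝ) = Real.exp a * Real.exp (-a) := by rw [← Real.exp_add]; simp
        _ ≤ Real.exp a * Real.exp (-∑ i ∈ J, X i ω) := by gcongr
        _ ≤ _ := by gcongr
    · exact mul_nonneg (Real.exp_pos _).le ((Real.exp_pos _).le.trans hprod)
  have hdisj : ∀ i ∈ J, ∀ j ∈ J, i ≠ j → Disjoint (A i) (A j) := by
    intro i _ j _ hij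
    rw [Set.disjoint_left]
    rintro e ⟨⟨e1, _⟩, _⟩ ⟨⟨e2, _⟩, _⟩
    have e1 := nrm_le.1 e1
    have e2 := nrm_le.1 e2
    simp only [x, Prod.fst_sub, Prod.snd_sub, Prod.fst_add, Prod.snd_add] at e1 e2
    have aux : ∀ a b : ℕ, ((2 * (m : ℤ) + 1) * a - (2 * m + 1) * b ≤ 2 * m) → a ≤ b := by
      intro a b h
      by_contra hcon
      have h3 : (b : ℤ) + 1 ≤ a := by exact_mod_cast (by omega : b + 1 ≤ a)
      nlinarith
    apply hij
    ext
    · exact le_antisymm (aux _ _ (by omega)) (aux _ _ (by omega))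
    · exact le_antisymm (aux _ _ (by omega)) (aux _ _ (by omega))
  calc Pr p (EF L) (Bad θ m M r) ≤ _ := Ex_mono h0 h1 _ hpt
    _ = Real.exp a * ∏ i ∈ J, Ex p (EF L) (fun ω => 1 - 1 / 2 * X i ω) := by
        rw [Ex_mul, Ex_prod p (EF L) A _ (fun i => (hX i).comp fun t => 1 - 1 / 2 * t) J hdisj]
    _ ≤ Real.exp a * ∏ i ∈ J, Real.exp (-(θ / 2)) := by
        gcongr with i hi
        · intro i hi
          refine Ex_nonneg h0 h1 _ fun ω => ?_
          rcases hX01 i ω with h | h <;> rw [h] <;> norm_num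
        · rw [Ex_sub, Ex_const, Ex_mul]
          have : Ex p (EF L) (X i) = Pr p (EF m) (arm0 m) := armC_eq p (hL i hi)
          rw [this]
          have := Real.add_one_le_exp (-(θ / 2))
          linarith
    _ = _ := by
        rw [Finset.prod_const, ← Real.exp_nat_mul, ← Real.exp_add, hJ, Finset.card_product, Finset.card_range]
        congr 1
        push_cast
        simp only [a]; ring
end PartTwelve

noncomputable section PartThirteen
open scoped Classical

/-- the sites of the shifted sublattices -/
def site (m : ℕ) (q : (ℕ × ℕ) × (ℕ × ℕ)) : Vert :=
  ((q.1.1 : ℤ), (q.1.2 : ℤ)) + ((2 * m + 1 : ℤ) * q.2.1, (2 * m + 1 : ℤ) * q.2.2)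

theorem div_aux {l a b a' b' : ℕ} (ha : a < l) (ha' : a' < l)
    (h : (a : ℤ) + l * b = a' + l * b') : a = a' ∧ b = b' := by
  have h : a + l * b = a' + l * b' := by exact_mod_cast h
  have hl : 0 < l := by omega
  have h1 : (a + l * b) / l = b := by
    rw [Nat.add_mul_div_left _ _ hl, Nat.div_eq_of_lt ha, zero_add]
  have h2 : (a' + l * b') / l = b' := by
    rw [Nat.add_mul_div_left _ _ hl, Nat.div_eq_of_lt ha', zero_add]
  have hb : b = b' := by rw [← h1, ← h2, h]
  subst hb
  exact ⟨by omega, rfl⟩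

theorem sqrt_facts {n : ℕ} (hn : 64 ≤ n) :
    8 ≤ n.sqrt ∧ n.sqrt * n.sqrt ≤ n ∧ n < (n.sqrt + 1) * (n.sqrt + 1) := by
  refine ⟨?_, Nat.sqrt_le n, Nat.lt_succ_sqrt n⟩
  rw [Nat.le_sqrt]; omega

theorem large_det {ω : Config} {θ : ℝ} (hθ : 0 < θ) {n : ℕ} (hn : 64 ≤ n)
    (hg : good (n.sqrt : ℤ) n ω)
    (hb : ∀ r ∈ Finset.range (2 * n.sqrt + 1) ×ˢ Finset.range (2 * n.sqrt + 1),
      ¬ Bad θ n.sqrt (n.sqrt / 8) ((r.1 : ℤ), (r.2 : ℤ)) ω) :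
    θ / 4096 * (n : ℝ) ^ 2 ≤ (giant ω n).ncard := by
  obtain ⟨h8, hs1, hs2⟩ := sqrt_facts hn
  set m := n.sqrt with hm
  set M := m / 8 with hM
  set R := Finset.range (2 * m + 1) ×ˢ Finset.range (2 * m + 1) with hR
  set J := Finset.range M ×ˢ Finset.range M with hJ
  have hM8 : 8 * M ≤ m := by omega
  have hM16 : m ≤ 16 * M := by omega
  let Q := (R ×ˢ J).filter fun q => armC ∅ m (site m q) ω
  have hinj : Set.InjOn (site m) (Q : Set ((ℕ × ℕ) × (ℕ × ℕ))) := by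
    rintro ⟨⟨a, b⟩, ⟨c, d⟩⟩ hq ⟨⟨a', b'⟩, ⟨c', d'⟩⟩ hq' h
    simp only [Q, hR, hJ, Finset.coe_filter, Finset.mem_product, Finset.mem_range, Set.mem_ofPred_eq] at hq hq'
    simp only [site, Prod.mk_add_mk, Prod.mk.injEq] at h
    have e1 := div_aux (l := 2 * m + 1) hq.1.1.1 hq'.1.1.1 (by push_cast; exact h.1)
    have e2 := div_aux (l := 2 * m + 1) hq.1.1.2 hq'.1.1.2 (by push_cast; exact h.2)
    rw [e1.1, e1.2, e2.1, e2.2]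
  have hcard : (((Q.image (site m)).card : ℕ) : ℝ) =
      ∑ r ∈ R, ∑ i ∈ J, I (armC ∅ m (site m (r, i))) ω := by
    rw [Finset.card_image_of_injOn hinj, Finset.card_filter, ← Finset.sum_product']
    push_cast
    rfl
  have hle : (Q.image (site m)).card ≤ (giant ω n).ncard := by
    refine giant_large hg (by positivity) (by nlinarith) _ ?_
    intro x hx
    obtain ⟨⟨⟨a, b⟩, ⟨c, d⟩⟩, hq, rfl⟩ := Finset.mem_image.1 hx
    simp only [Q, hR, hJ, Finset.mem_filter, Finset.mem_product, Finset.mem_range] at hq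
    obtain ⟨⟨⟨ha, hb⟩, hc, hd⟩, z, hz, hzc⟩ := hq
    constructor
    · have key : ∀ a c : ℕ, a < 2 * m + 1 → c < M → 2 * (a + (2 * m + 1) * c) ≤ n := by
        intro a c ha hc
        have : (2 * m + 1) * (c + 1) ≤ (2 * m + 1) * M := Nat.mul_le_mul_left _ hc
        nlinarith
      have k1 := key a c ha hc
      have k2 := key b d hb hd
      have : nrm (site m ((a, b), (c, d))) ≤ (n : ℤ) / 2 := by
        rw [nrm_le]
        simp only [site, Prod.mk_add_mk]
        zify at k1 k2
        have p1 : 0 ≤ (2 * (m : ℤ) + 1) * c := by positivity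
        have p2 : 0 ≤ (2 * (m : ℤ) + 1) * d := by positivity
        refine ⟨?_, ?_, ?_, ?_⟩ <;> omega
      omega
    · exact ⟨z, hz, conn_mono le_rfl (Set.subset_univ _) hzc⟩
  have hlow : ∑ r ∈ R, (θ / 4 * (M : ℝ) ^ 2) ≤ ∑ r ∈ R, ∑ i ∈ J, I (armC ∅ m (site m (r, i))) ω := by
    refine Finset.sum_le_sum fun r hr => ?_
    exact (not_le.1 (hb r hr)).le
  rw [Finset.sum_const, hR, Finset.card_product, Finset.card_range, nsmul_eq_mul, ← hR, ← hcard] at hlow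
  have hle' : (((Q.image (site m)).card : ℕ) : ℝ) ≤ (giant ω n).ncard := by exact_mod_cast hle
  refine le_trans ?_ (hlow.trans hle')
  have r1 : n ≤ 32 * ((2 * m + 1) * M) := by nlinarith
  have r2 : (n : ℝ) ≤ 32 * ((2 * m + 1) * M) := by exact_mod_cast r1
  have r3 : (n : ℝ) ^ 2 ≤ (32 * ((2 * m + 1) * M)) ^ 2 := by gcongr
  push_cast
  calc θ / 4096 * (n : ℝ) ^ 2 ≤ θ / 4096 * (32 * ((2 * m + 1) * M)) ^ 2 := by gcongr
    _ = _ := by ring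

theorem prob_bound {P : Measure Config} {p θ : ℝ} (hp : 1 / 2 < p) (hp1 : p < 1) (hP : IsBernoulli P p)
    (hθ : 0 < θ) (hθm : ∀ m : ℕ, θ ≤ Pr p (EF m) (arm0 m)) :
    ∃ K c, 0 < K ∧ 0 < c ∧ ∀ n : ℕ, 64 ≤ n →
      P {ω | ¬ (θ / 4096 * (n : ℝ) ^ 2 ≤ (giant ω n).ncard)} ≤
        ENNReal.ofReal (K * (1 + n) ^ 4 * Real.exp (-c * n.sqrt)) := by
  obtain ⟨K, c, hK, hc, hgood⟩ := good_prob hp hp1 hP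
  refine ⟨K + 9, min c (θ / 1024), by positivity, by positivity, fun n hn => ?_⟩
  obtain ⟨h8, hs1, hs2⟩ := sqrt_facts hn
  have hdet := fun ω => large_det (ω := ω) hθ hn
  set m := n.sqrt with hm
  set M := m / 8 with hM
  set R := Finset.range (2 * m + 1) ×ˢ Finset.range (2 * m + 1) with hR
  have hM16 : m ≤ 16 * M := by omega
  have hsub : {ω | ¬ (θ / 4096 * (n : ℝ) ^ 2 ≤ (giant ω n).ncard)} ⊆
      {ω | ¬ good (m : ℤ) n ω} ∪ ⋃ r ∈ R, {ω | Bad θ m M ((r.1 : ℤ), (r.2 : ℤ)) ω} := by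
    intro ω hω
    by_contra hcon
    rw [Set.mem_union, not_or] at hcon
    refine hω (hdet ω (not_not.1 hcon.1) fun r hr hB => hcon.2 ?_)
    exact Set.mem_biUnion (Finset.mem_coe.2 hr) hB
  set d := min c (θ / 1024) with hd
  have e1 : Real.exp (-c * m) ≤ Real.exp (-d * m) := by
    have : d ≤ c := min_le_left _ _
    apply Real.exp_le_exp.2; gcongr
  have e2 : Real.exp (-(θ / 4 * (M : ℝ) ^ 2)) ≤ Real.exp (-d * m) := by
    have h1 : d ≤ θ / 1024 := min_le_right _ _
    have h2 : (m : ℝ) ≤ 16 * M := by exact_mod_cast hM16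
    have h3 : (8 : ℝ) ≤ m := by exact_mod_cast h8
    have h4 : (m : ℝ) ≤ 256 * (M : ℝ) ^ 2 := by nlinarith
    apply Real.exp_le_exp.2
    have : d * m ≤ θ / 1024 * (256 * (M : ℝ) ^ 2) := by gcongr
    linarith
  have e3 : ((2 * m + 1 : ℕ) : ℝ) * ((2 * m + 1 : ℕ) : ℝ) ≤ 9 * (1 + (n : ℝ)) ^ 4 := by
    have h1 : 2 * m + 1 ≤ 3 * (1 + n) := by nlinarith
    have h2 : ((2 * m + 1 : ℕ) : ℝ) ≤ 3 * (1 + n) := by exact_mod_cast h1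
    have h3 : (1 : ℝ) ≤ 1 + n := by linarith [Nat.cast_nonneg (α := ℝ) n]
    calc ((2 * m + 1 : ℕ) : ℝ) * ((2 * m + 1 : ℕ) : ℝ) ≤ (3 * (1 + n)) * (3 * (1 + n)) := by gcongr
      _ = 9 * (1 + (n : ℝ)) ^ 2 := by ring
      _ ≤ _ := by gcongr; norm_num
  have hlast := hgood m n
  have hsum : ∑ r ∈ R, P {ω | Bad θ m M ((r.1 : ℤ), (r.2 : ℤ)) ω} ≤
      ENNReal.ofReal (9 * (1 + (n : ℝ)) ^ 4 * Real.exp (-d * m)) := by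
    calc ∑ r ∈ R, P {ω | Bad θ m M ((r.1 : ℤ), (r.2 : ℤ)) ω}
        ≤ ∑ r ∈ R, ENNReal.ofReal (Real.exp (-d * m)) :=
          Finset.sum_le_sum fun r _ => (Bad_prob (by linarith) hp1.le hP m M (hθm m) _).trans
            (ENNReal.ofReal_le_ofReal e2)
      _ = ENNReal.ofReal (∑ r ∈ R, Real.exp (-d * m)) :=
          (ENNReal.ofReal_sum_of_nonneg fun _ _ => (Real.exp_pos _).le).symm
      _ ≤ _ := by
          apply ENNReal.ofReal_le_ofReal
          rw [Finset.sum_const, hR, Finset.card_product, Finset.card_range, nsmul_eq_mul]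
          push_cast at e3 ⊢
          gcongr
  calc P {ω | ¬ (θ / 4096 * (n : ℝ) ^ 2 ≤ (giant ω n).ncard)} ≤ _ := measure_mono hsub
    _ ≤ _ := measure_union_le _ _
    _ ≤ ENNReal.ofReal (K * (1 + n) ^ 4 * Real.exp (-d * m)) +
        ENNReal.ofReal (9 * (1 + (n : ℝ)) ^ 4 * Real.exp (-d * m)) := by
        refine add_le_add ?_ ?_
        · exact hlast.trans (ENNReal.ofReal_le_ofReal (by gcongr))
        · exact (measure_biUnion_finset_le _ _).trans hsum
    _ = _ := by
        rw [← ENNReal.ofReal_add (by positivity) (by positivity)]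
        congr 1; ring

theorem analysis {K c : ℝ} (hK : 0 < K) (hc : 0 < c) :
    ∃ K', 0 < K' ∧ ∀ n : ℕ, 1 ≤ n →
      K * (1 + n) ^ 4 * Real.exp (-c * n.sqrt) ≤ K' * Real.exp (-1 * (Real.log n) ^ 2) := by
  refine ⟨16 * K * Real.exp (c + 96 ^ 2 / (4 * c)), by positivity, fun n hn => ?_⟩
  have hn1 : (1 : ℝ) ≤ n := by exact_mod_cast hn
  have hn0 : (0 : ℝ) < n := by linarith
  set m := n.sqrt with hm
  set u := (n : ℝ) ^ (1 / 8 : ℝ) with hu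
  have hu1 : 1 ≤ u := Real.one_le_rpow hn1 (by norm_num)
  have hu8 : u ^ 8 = n := by
    rw [hu, ← Real.rpow_natCast, ← Real.rpow_mul hn0.le]; norm_num
  have hlog : Real.log n ≤ 8 * u := by
    have := Real.log_le_rpow_div hn0.le (ε := 1 / 8) (by norm_num)
    linarith
  have hlog0 : 0 ≤ Real.log n := Real.log_nonneg hn1
  have hmu : u ^ 4 ≤ m + 1 := by
    have h1 : n < (m + 1) * (m + 1) := Nat.lt_succ_sqrt n
    have h2 : (n : ℝ) ≤ ((m : ℝ) + 1) * (m + 1) := by exact_mod_cast h1.le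
    have h3 : (u ^ 4) ^ 2 ≤ ((m : ℝ) + 1) ^ 2 := by rw [← pow_mul]; norm_num; rw [hu8]; linarith
    exact le_of_sq_le_sq (by linarith) (by positivity)
  have h4 : (1 + (n : ℝ)) ^ 4 ≤ 16 * Real.exp (4 * Real.log n) := by
    have e : Real.exp (4 * Real.log n) = (n : ℝ) ^ 4 := by
      rw [show (4 : ℝ) * Real.log n = ((4 : ℕ) : ℝ) * Real.log n by norm_num, Real.exp_nat_mul,
        Real.exp_log hn0]
    rw [e]
    calc (1 + (n : ℝ)) ^ 4 ≤ (2 * n) ^ 4 := by gcongr; linarith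
      _ = _ := by ring
  calc K * (1 + n) ^ 4 * Real.exp (-c * m)
      ≤ K * (16 * Real.exp (4 * Real.log n)) * Real.exp (-c * m) := by gcongr
    _ = 16 * K * Real.exp (4 * Real.log n + -c * m) := by rw [Real.exp_add]; ring
    _ ≤ 16 * K * Real.exp ((c + 96 ^ 2 / (4 * c)) + -1 * (Real.log n) ^ 2) := by
        refine mul_le_mul_of_nonneg_left (Real.exp_le_exp.2 ?_) (by positivity)
        have a1 : (Real.log n) ^ 2 ≤ 64 * u ^ 2 := by nlinarith
        have a2 : 4 * Real.log n ≤ 32 * u ^ 2 := by nlinarith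
        have a3 : c * u ^ 4 ≤ c * (m + 1) := by gcongr
        have a4 : 96 * u ^ 2 - c * u ^ 4 ≤ 96 ^ 2 / (4 * c) := by
          rw [le_div_iff₀ (by positivity)]
          nlinarith [sq_nonneg (2 * c * u ^ 2 - 96)]
        nlinarith
    _ = _ := by rw [Real.exp_add]; ring

theorem compl_bound {P : Measure Config} [IsProbabilityMeasure P] {S : Set Config} {t : ℝ}
    (ht : 0 ≤ t) (h : P Sᶜ ≤ ENNReal.ofReal t) : ENNReal.ofReal (1 - t) ≤ P S := by
  rw [ENNReal.ofReal_sub _ ht, tsub_le_iff_right, ENNReal.ofReal_one]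
  calc (1 : ENNReal) = P (S ∪ Sᶜ) := by rw [Set.union_compl_self, measure_univ]
    _ ≤ P S + P Sᶜ := measure_union_le _ _
    _ ≤ _ := by gcongr

theorem cheeger_main (p : ℝ) (hp : 1 / 2 < p) (hp1 : p < 1)
    (P : MeasureTheory.Measure Config) (hP : IsBernoulli P p) :
    ∃ c c₁ c₂ : ℝ, 0 < c ∧ 0 < c₁ ∧ 0 < c₂ ∧
      ∀ n : ℕ, 1 ≤ n →
        ENNReal.ofReal (1 - c₁ * Real.exp (-c₂ * (Real.log n) ^ 2)) ≤
          P {ω : Config | Phi ω n ≤ c / n} := by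
  have := hP.1
  by_cases hcase : ∃ θ > 0, ∀ m : ℕ, θ ≤ Pr p (EF m) (arm0 m)
  · obtain ⟨θ, hθ, hθm⟩ := hcase
    obtain ⟨K, c, hK, hc, hprob⟩ := prob_bound hp hp1 hP hθ hθm
    obtain ⟨K', hK', han⟩ := analysis hK hc
    set κ := θ / 4096 with hκ
    have hκ0 : 0 < κ := by positivity
    obtain ⟨N, hN⟩ := exists_nat_ge (12 / κ)
    set N0 : ℕ := max N 64 with hN0
    refine ⟨12 / κ, K' + Real.exp ((Real.log N0) ^ 2), 1, by positivity, by positivity, one_pos, fun n hn => ?_⟩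
    have hn0 : (0 : ℝ) < n := by exact_mod_cast hn
    by_cases hlt : n < N0
    · have h1 : 1 - (K' + Real.exp ((Real.log N0) ^ 2)) * Real.exp (-1 * (Real.log n) ^ 2) ≤ 0 := by
        have l0 : 0 ≤ Real.log n := Real.log_nonneg (by exact_mod_cast hn)
        have l1 : Real.log n ≤ Real.log N0 := Real.log_le_log hn0 (by exact_mod_cast hlt.le)
        have l2 : (Real.log n) ^ 2 ≤ (Real.log N0) ^ 2 := by gcongr
        have l3 : 1 ≤ Real.exp ((Real.log N0) ^ 2) * Real.exp (-1 * (Real.log n) ^ 2) := by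
          rw [← Real.exp_add]; exact Real.one_le_exp (by linarith)
        have l4 : 0 ≤ K' * Real.exp (-1 * (Real.log n) ^ 2) := by positivity
        rw [add_mul]; linarith
      rw [ENNReal.ofReal_of_nonpos h1]; exact zero_le
    · have hge : N0 ≤ n := not_lt.1 hlt
      have h64 : 64 ≤ n := (le_max_right _ _).trans hge
      have hNn : N ≤ n := (le_max_left _ _).trans hge
      have h12 : 12 ≤ κ * n := by
        have : 12 / κ ≤ (n : ℝ) := hN.trans (by exact_mod_cast hNn)
        rw [div_le_iff₀ hκ0] at this
        linarith
      refine compl_bound (by positivity) ?_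
      refine (measure_mono ?_).trans ((hprob n h64).trans (ENNReal.ofReal_le_ofReal ?_))
      · intro ω hω hcon
        exact hω (Phi_le hκ0 hn h12 hcon)
      · refine (han n hn).trans ?_
        gcongr
        linarith [Real.exp_pos ((Real.log N0) ^ 2)]
  · push Not at hcase
    have hnull := Cinf_null (by linarith) hp1.le hP hcase
    refine ⟨1, 1, 1, one_pos, one_pos, one_pos, fun n hn => ?_⟩
    refine compl_bound (by positivity) ?_
    refine (measure_mono ?_).trans (hnull.le.trans zero_le)
    intro ω hω hcon
    apply hω
    show Phi ω n ≤ 1 / n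
    rw [Phi_empty hcon]; positivity
end PartThirteen

/-- For `p ∈ (1/2, 1)` there are positive constants `c(p), c₁(p), c₂(p)` such that for all
`n ≥ 1`, with probability at least `1 - c₁ exp(-c₂ log² n)`, one has `Φₙ ≤ c · n⁻¹`. -/
theorem cheeger_constant_upper_bound (p : ℝ) (hp : 1 / 2 < p) (hp1 : p < 1)
    (P : MeasureTheory.Measure Config) (hP : IsBernoulli P p) :
    ∃ c c₁ c₂ : ℝ, 0 < c ∧ 0 < c₁ ∧ 0 < c₂ ∧
      ∀ n : ℕ, 1 ≤ n →
        ENNReal.ofReal (1 - c₁ * Real.exp (-c₂ * (Real.log n) ^ 2)) ≤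
          P {ω : Config | Phi ω n ≤ c / n} := by
  exact cheeger_main p hp hp1 P hP
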